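/- arXiv:1303.0268 — 8 statements merged into one kernel-verified Lean document; each statement's English description precedes it below -/
import Mathlib

section
/- Consider a binary deep belief network whose layers all have width n = 2^{k−1} + k for some integer k ≥ 1. If the network has L ≥ 1 + 2^S layers for some S ∈ {0,1,…,2^{k−1}}, then the maximal information divergence from the DBN model satisfies D_{DBN} ≤ ( 2^{k−1} − S ) · log(2). -/
open scoped BigOperators

section Prelim

variable {𝒳 : Type*} [Fintype 𝒳]

/-- A probability distribution on the finite set `𝒳`, as a nonnegative function summing to 1. -/
def IsProb (p : 𝒳 → ℝ) : Prop := (∀ x, 0 ≤ p x) ∧ ∑ x, p x = 1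

/-- Kullback–Leibler divergence with the conventions `0·log 0 = 0` and
`D(p‖q) = ∞` if `supp p ⊄ supp q`. -/
noncomputable def KL (p q : 𝒳 → ℝ) : EReal :=
  if ∀ x, p x ≠ 0 → q x ≠ 0 then ((∑ x, p x * Real.log (p x / q x) : ℝ) : EReal)
  else ⊤

/-- Information divergence from a model: `D(p‖ℳ) = inf_{q ∈ ℳ} D(p‖q)`. -/
noncomputable def divFrom (p : 𝒳 → ℝ) (M : Set (𝒳 → ℝ)) : EReal :=
  ⨅ q ∈ M, KL p q

/-- Maximal information divergence from a model: `D_ℳ = max_{p ∈ Δ(𝒳)} D(p‖ℳ)`. -/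
noncomputable def maxDiv (M : Set (𝒳 → ℝ)) : EReal :=
  ⨆ (p : 𝒳 → ℝ) (_ : IsProb p), divFrom p M

end Prelim

/-- Sigmoid conditional of a binary unit: $σ(1|z) = 1/(1 + \exp(-∑_j w_j z_j - b))$. -/
noncomputable def sigCond (n : ℕ) (w : Fin n → ℝ) (b : ℝ) (y : Fin 2)
    (z : Fin n → Fin 2) : ℝ :=
  if y = 1 then 1 / (1 + Real.exp (-(∑ j, w j * ((z j : ℕ) : ℝ)) - b))
  else 1 - 1 / (1 + Real.exp (-(∑ j, w j * ((z j : ℕ) : ℝ)) - b))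

/-- Joint RBM distribution on the deepest two layers:
$r(v,h) = \exp(vᵀWh + bᵀv + cᵀh)/Z$. -/
noncomputable def binRBMJoint (n : ℕ) (W : Fin n → Fin n → ℝ) (b c : Fin n → ℝ)
    (v h : Fin n → Fin 2) : ℝ :=
  Real.exp ((∑ i, ∑ j, W i j * ((v i : ℕ) : ℝ) * ((h j : ℕ) : ℝ)) +
      (∑ i, b i * ((v i : ℕ) : ℝ)) + (∑ j, c j * ((h j : ℕ) : ℝ))) /
    ∑ v' : Fin n → Fin 2, ∑ h' : Fin n → Fin 2,
      Real.exp ((∑ i, ∑ j, W i j * ((v' i : ℕ) : ℝ) * ((h' j : ℕ) : ℝ)) +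
        (∑ i, b i * ((v' i : ℕ) : ℝ)) + (∑ j, c j * ((h' j : ℕ) : ℝ)))

/-- The binary deep belief network model with $L' + 2$ layers of width $n$:
marginals on the first layer of
$p(x^{(1)},…,x^{(L)}) = r(x^{(L-1)},x^{(L)}) ∏_{l=1}^{L-2} ∏_i σ_i^{(l)}(x_i^{(l)}|x^{(l+1)})$. -/
def binDBN (n L' : ℕ) : Set ((Fin n → Fin 2) → ℝ) :=
  {p | ∃ (W : Fin L' → Fin n → Fin n → ℝ) (b : Fin L' → Fin n → ℝ)
        (Wr : Fin n → Fin n → ℝ) (br cr : Fin n → ℝ),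
    ∀ v, p v = ∑ xs : Fin (L' + 2) → (Fin n → Fin 2),
      if xs 0 = v then
        binRBMJoint n Wr br cr (xs ⟨L', by omega⟩) (xs ⟨L' + 1, by omega⟩) *
          ∏ l : Fin L', ∏ i : Fin n,
            sigCond n (W l i) (b l i) (xs l.castSucc.castSucc i) (xs l.succ.castSucc)
      else 0}

open Filter Topology

/-- A real function on the binary cube that is the restriction of an affine function. -/
def IsCubeAffine {n : ℕ} (g : (Fin n → Fin 2) → ℝ) : Prop :=
  ∃ (w : Fin n → ℝ) (b : ℝ), ∀ z, g z = ∑ j, w j * ((z j : ℕ) : ℝ) + b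

namespace IsCubeAffine

variable {n : ℕ} {g h : (Fin n → Fin 2) → ℝ}

theorem const (c : ℝ) : IsCubeAffine (fun _ : Fin n → Fin 2 => c) :=
  ⟨0, c, by simp⟩

theorem coord (i : Fin n) (φ : Fin 2 → ℝ) : IsCubeAffine (fun z => φ (z i)) := by
  refine ⟨Pi.single i (φ 1 - φ 0), φ 0, fun z => ?_⟩
  rw [Finset.sum_eq_single i (fun j _ hj => by simp [hj]) (by simp)]
  rcases Fin.exists_fin_two.1 ⟨z i, rfl⟩ with h | h <;> simp [h]

theorem add (hg : IsCubeAffine g) (hh : IsCubeAffine h) : IsCubeAffine (fun z => g z + h z) := by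
  obtain ⟨w, b, hw⟩ := hg
  obtain ⟨w', b', hw'⟩ := hh
  refine ⟨w + w', b + b', fun z => ?_⟩
  simp only [hw, hw', Pi.add_apply, add_mul, Finset.sum_add_distrib]
  ring

theorem const_mul (c : ℝ) (hg : IsCubeAffine g) : IsCubeAffine (fun z => c * g z) := by
  obtain ⟨w, b, hw⟩ := hg
  refine ⟨fun j => c * w j, c * b, fun z => ?_⟩
  simp only [hw, mul_add, Finset.mul_sum, mul_assoc]

theorem sub (hg : IsCubeAffine g) (hh : IsCubeAffine h) : IsCubeAffine (fun z => g z - h z) := by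
  simpa [sub_eq_add_neg] using hg.add (hh.const_mul (-1))

theorem sum {ι : Type*} (s : Finset ι) {f : ι → (Fin n → Fin 2) → ℝ}
    (hf : ∀ i, IsCubeAffine (f i)) : IsCubeAffine (fun z => ∑ i ∈ s, f i z) := by
  classical
  induction s using Finset.induction_on with
  | empty => simpa using const (n := n) 0
  | insert a s ha ih => simpa [Finset.sum_insert ha] using (hf a).add ih

end IsCubeAffine

/-- The probability that a binary variable with success probability `μ` takes the value `y`. -/
def bernoulliMass (μ : ℝ) (y : Fin 2) : ℝ := if y = 1 then μ else 1 - μ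

theorem sigCond_eq_bernoulliMass (n : ℕ) (w : Fin n → ℝ) (b : ℝ) (y : Fin 2)
    (z : Fin n → Fin 2) :
    sigCond n w b y z = bernoulliMass (Real.sigmoid (∑ j, w j * ((z j : ℕ) : ℝ) + b)) y := by
  have h : -(∑ j, w j * ((z j : ℕ) : ℝ)) - b = -(∑ j, w j * ((z j : ℕ) : ℝ) + b) := by ring
  simp only [sigCond, bernoulliMass, Real.sigmoid_def, h, one_div]

theorem sum_ite_zero_eq_sum_cons {α : Type*} [Fintype α] [DecidableEq α] {m : ℕ} (v : α)
    (F : (Fin (m + 1) → α) → ℝ) :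
    ∑ xs, (if xs 0 = v then F xs else 0) = ∑ xs : Fin m → α, F (Fin.cons v xs) := by
  rw [← (Fin.consEquiv (fun _ : Fin (m + 1) => α)).sum_comp,
    Fintype.sum_prod_type, Finset.sum_eq_single v]
  · exact Finset.sum_congr rfl fun xs _ => if_pos rfl
  · exact fun u _ hu => Finset.sum_eq_zero fun xs _ => if_neg hu
  · simp

theorem sum_mul_sum_ite_eq {α β : Type*} [Fintype α] [Fintype β] [DecidableEq α] (f : β → α)
    (A : α → ℝ) (G : β → ℝ) :
    ∑ z, A z * ∑ x, (if f x = z then G x else 0) = ∑ x, A (f x) * G x := by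
  simp only [Finset.mul_sum]
  rw [Finset.sum_comm]
  refine Finset.sum_congr rfl fun x _ => ?_
  rw [Finset.sum_eq_single (f x) (fun z _ hz => by rw [if_neg hz.symm, mul_zero]) (by simp),
    if_pos rfl]

/-- Adding a sigmoid layer below a deep belief network. -/
theorem binDBN_succ {n L' : ℕ} {q : (Fin n → Fin 2) → ℝ} (hq : q ∈ binDBN n L')
    (W : Fin n → Fin n → ℝ) (b : Fin n → ℝ) :
    (fun y => ∑ z, (∏ i, sigCond n (W i) (b i) (y i) z) * q z) ∈ binDBN n (L' + 1) := by
  obtain ⟨W', b', Wr, br, cr, h⟩ := hq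
  refine ⟨Fin.cons W W', Fin.cons b b', Wr, br, cr, fun v => ?_⟩
  simp only [h]
  rw [sum_mul_sum_ite_eq (fun xs : Fin (L' + 2) → Fin n → Fin 2 => xs 0)]
  refine Eq.trans ?_ (sum_ite_zero_eq_sum_cons (m := L' + 2) v fun xs =>
    binRBMJoint n Wr br cr (xs ⟨L' + 1, by omega⟩) (xs ⟨L' + 1 + 1, by omega⟩) *
      ∏ l : Fin (L' + 1), ∏ i : Fin n,
        sigCond n ((Fin.cons W W' : Fin (L' + 1) → Fin n → Fin n → ℝ) l i)
          ((Fin.cons b b' : Fin (L' + 1) → Fin n → ℝ) l i)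
          (xs l.castSucc.castSucc i) (xs l.succ.castSucc)).symm
  refine Finset.sum_congr rfl fun xs _ => ?_
  rw [Fin.prod_univ_succ, mul_left_comm]
  rfl

/-- The response of a sigmoid unit in the limit of an infinitely scaled preactivation `g`, with
`θ` the preactivation where `g` vanishes. -/
noncomputable def limitUnit (g θ : ℝ) : ℝ :=
  if 0 < g then 1 else if g < 0 then 0 else Real.sigmoid θ

theorem tendsto_sigmoid_limitUnit (g θ : ℝ) :
    Tendsto (fun t : ℝ => Real.sigmoid (t * g + θ)) atTop (𝓝 (limitUnit g θ)) := by
  unfold limitUnit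
  split_ifs with h1 h2
  · exact Real.tendsto_sigmoid_atTop.comp
      (tendsto_atTop_add_const_right _ _ (tendsto_id.atTop_mul_const h1))
  · exact Real.tendsto_sigmoid_atBot.comp
      (tendsto_atBot_add_const_right _ _ (tendsto_id.atTop_mul_const_of_neg h2))
  · have : g = 0 := le_antisymm (not_lt.1 h1) (not_lt.1 h2)
    simp [this]

theorem tendsto_bernoulliMass {f : ℝ → ℝ} {μ : ℝ} (h : Tendsto f atTop (𝓝 μ)) (y : Fin 2) :
    Tendsto (fun t => bernoulliMass (f t) y) atTop (𝓝 (bernoulliMass μ y)) := by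
  unfold bernoulliMass
  split_ifs
  · exact h
  · exact h.const_sub 1

theorem closure_binDBN_succ {n L' : ℕ} {q : (Fin n → Fin 2) → ℝ} (hq : q ∈ closure (binDBN n L'))
    {g θ : Fin n → (Fin n → Fin 2) → ℝ} (hg : ∀ i, IsCubeAffine (g i))
    (hθ : ∀ i, IsCubeAffine (θ i)) :
    (fun y => ∑ z, (∏ i, bernoulliMass (limitUnit (g i z) (θ i z)) (y i)) * q z) ∈
      closure (binDBN n (L' + 1)) := by
  have aff : ∀ t : ℝ, ∀ i, IsCubeAffine (fun z => t * g i z + θ i z) :=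
    fun t i => ((hg i).const_mul t).add (hθ i)
  have key : ∀ t : ℝ, ∀ q ∈ closure (binDBN n L'),
      (fun y => ∑ z, (∏ i, bernoulliMass (Real.sigmoid (t * g i z + θ i z)) (y i)) * q z) ∈
        closure (binDBN n (L' + 1)) := by
    intro t q hq
    have cont : Continuous fun (q : (Fin n → Fin 2) → ℝ) (y : Fin n → Fin 2) =>
        ∑ z, (∏ i, bernoulliMass (Real.sigmoid (t * g i z + θ i z)) (y i)) * q z :=
      continuous_pi fun y => continuous_finsetSum _ fun z _ =>
        continuous_const.mul (continuous_apply z)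
    refine map_mem_closure cont hq ?_
    intro q hq
    choose W b hWb using aff t
    simpa only [sigCond_eq_bernoulliMass, ← hWb] using binDBN_succ hq W b
  refine isClosed_closure.mem_of_tendsto (b := atTop) ?_ (Eventually.of_forall fun t => key t q hq)
  refine tendsto_pi_nhds.2 fun y => tendsto_finsetSum _ fun z _ => Tendsto.mul_const _ ?_
  exact tendsto_finsetProd _ fun i _ =>
    tendsto_bernoulliMass (tendsto_sigmoid_limitUnit (g i z) (θ i z)) (y i)

theorem rbm_mem_binDBN {n : ℕ} {H : Fin n → (Fin n → Fin 2) → ℝ} (hH : ∀ j, IsCubeAffine (H j)) :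
    (fun v => (∏ j, (1 + Real.exp (H j v))) / ∑ v', ∏ j, (1 + Real.exp (H j v'))) ∈
      binDBN n 0 := by
  choose W c hW using hH
  have marg : ∀ v : Fin n → Fin 2, ∑ h : Fin n → Fin 2,
      Real.exp ((∑ i, ∑ j, W j i * ((v i : ℕ) : ℝ) * ((h j : ℕ) : ℝ)) +
        (∑ i, (0 : Fin n → ℝ) i * ((v i : ℕ) : ℝ)) + (∑ j, c j * ((h j : ℕ) : ℝ))) =
      ∏ j, (1 + Real.exp (H j v)) := by
    intro v
    have h1 : ∀ j, 1 + Real.exp (H j v) = ∑ u : Fin 2, Real.exp (((u : ℕ) : ℝ) * H j v) := by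
      simp
    simp only [h1]
    rw [Finset.prod_univ_sum, Fintype.piFinset_univ]
    refine Finset.sum_congr rfl fun h _ => ?_
    rw [← Real.exp_sum, Finset.sum_comm]
    simp only [Pi.zero_apply, zero_mul, Finset.sum_const_zero, add_zero]
    rw [← Finset.sum_add_distrib]
    congr 1
    refine Finset.sum_congr rfl fun j _ => ?_
    rw [hW, ← Finset.sum_mul]
    ring
  refine ⟨Fin.elim0, Fin.elim0, fun i j => W j i, 0, c, fun v => ?_⟩
  rw [sum_ite_zero_eq_sum_cons (m := 1) v fun xs =>
    binRBMJoint n (fun i j => W j i) 0 c (xs ⟨0, by omega⟩) (xs ⟨0 + 1, by omega⟩) *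
      ∏ l : Fin 0, ∏ i : Fin n,
        sigCond n ((Fin.elim0 l : Fin n → Fin n → ℝ) i) ((Fin.elim0 l : Fin n → ℝ) i)
          (xs l.castSucc.castSucc i) (xs l.succ.castSucc)]
  rw [← (Equiv.funUnique (Fin 1) (Fin n → Fin 2)).symm.sum_comp]
  simp only [Finset.univ_eq_empty, Finset.prod_empty, mul_one, binRBMJoint, marg]
  rw [← Finset.sum_div, ← marg v]
  rfl

/-- Limits of restricted Boltzmann machines: each hidden unit `j` carries the mass on the face
where `G j` equals one. -/
theorem closure_binDBN_zero {n : ℕ} {G θ : Fin n → (Fin n → Fin 2) → ℝ}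
    (hG : ∀ j, IsCubeAffine (G j)) (hθ : ∀ j, IsCubeAffine (θ j)) {ρ : (Fin n → Fin 2) → ℝ}
    (hsum : ∑ v, ρ v = 1)
    (hρ : ∀ v, (∃ j, G j v = 1 ∧ (∀ i, i ≠ j → G i v < 0) ∧ ρ v = Real.exp (θ j v)) ∨
      ((∀ i, G i v < 0) ∧ ρ v = 0)) :
    ρ ∈ closure (binDBN n 0) := by
  have neg : ∀ j v, G j v < 0 →
      Tendsto (fun t : ℝ => 1 + Real.exp (t * G j v + θ j v)) atTop (𝓝 1) := by
    intro j v h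
    simpa using (Real.tendsto_exp_atBot.comp
      (tendsto_atBot_add_const_right _ (θ j v) (tendsto_id.atTop_mul_const_of_neg h))).const_add 1
  have hexp : Tendsto (fun t : ℝ => Real.exp (-t)) atTop (𝓝 0) :=
    Real.tendsto_exp_neg_atTop_nhds_zero
  have lim : ∀ v, Tendsto
      (fun t : ℝ => Real.exp (-t) * ∏ j, (1 + Real.exp (t * G j v + θ j v))) atTop (𝓝 (ρ v)) := by
    intro v
    rcases hρ v with ⟨j, hj, hi, h⟩ | ⟨hi, h⟩
    · have split : ∀ t : ℝ, Real.exp (-t) * ∏ i, (1 + Real.exp (t * G i v + θ i v)) =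
          (Real.exp (-t) + Real.exp (θ j v)) *
            ∏ i ∈ Finset.univ.erase j, (1 + Real.exp (t * G i v + θ i v)) := by
        intro t
        rw [← Finset.mul_prod_erase _ _ (Finset.mem_univ j), ← mul_assoc, hj, mul_add,
          ← Real.exp_add]
        congr 3
        · ring
        · ring
      simp only [split]
      have h2 := tendsto_finsetProd (Finset.univ.erase j)
        fun i hij => neg i v (hi i (Finset.ne_of_mem_erase hij))
      simpa [h] using (hexp.add_const (Real.exp (θ j v))).mul h2
    · have h2 := tendsto_finsetProd Finset.univ fun i _ => neg i v (hi i)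
      simpa [h] using hexp.mul h2
  have lim' : Tendsto (fun (t : ℝ) v =>
      (∏ j, (1 + Real.exp (t * G j v + θ j v))) /
        ∑ v', ∏ j, (1 + Real.exp (t * G j v' + θ j v'))) atTop (𝓝 ρ) := by
    refine tendsto_pi_nhds.2 fun v => ?_
    have h := (lim v).div (tendsto_finsetSum Finset.univ fun v' _ => lim v') (by simp [hsum])
    rw [hsum, div_one] at h
    refine h.congr fun t => ?_
    simp only [Pi.div_apply]
    rw [← Finset.mul_sum, mul_div_mul_left _ _ (Real.exp_pos _).ne']
  exact mem_closure_of_tendsto lim' (Eventually.of_forall fun t =>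
    rbm_mem_binDBN fun j => ((hG j).const_mul t).add (hθ j))

theorem bernoulliMass_zero_or_one {u y : Fin 2} :
    bernoulliMass (if u = 1 then 1 else 0) y = if y = u then 1 else 0 := by
  revert u y
  simp [Fin.forall_fin_two, bernoulliMass]

theorem fin_two_add_one_add_one (u : Fin 2) : u + 1 + 1 = u := by
  revert u; decide

theorem fin_two_eq_add_one_of_ne {u y : Fin 2} (h : y ≠ u) : y = u + 1 := by
  revert u y; decide

theorem fin_two_ne_add_one (u : Fin 2) : u ≠ u + 1 := by
  revert u; decide

theorem limitUnit_of_pos {g : ℝ} (h : 0 < g) (θ : ℝ) : limitUnit g θ = 1 := if_pos h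

theorem limitUnit_of_neg {g : ℝ} (h : g < 0) (θ : ℝ) : limitUnit g θ = 0 := by
  rw [limitUnit, if_neg h.not_gt, if_pos h]

theorem limitUnit_signed {p C : ℝ} (hp : 0 < p) (hC : p < C) (b u : Fin 2) (θ : ℝ) :
    limitUnit ((if b = 1 then 1 else -1) * (p - if u = b then 0 else C)) θ =
      if u = 1 then 1 else 0 := by
  rcases Fin.exists_fin_two.1 ⟨b, rfl⟩ with rfl | rfl <;>
  rcases Fin.exists_fin_two.1 ⟨u, rfl⟩ with rfl | rfl
  · exact limitUnit_of_neg (by simpa using hp) θ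
  · exact limitUnit_of_pos (by simpa using hC) θ
  · exact limitUnit_of_neg (by simpa using hC) θ
  · exact limitUnit_of_pos (by simpa using hp) θ

/-- The product law of independent bits that copy `z`, except for the bit `i₀` which is flipped
with probability `r`. -/
theorem prod_copy_except {n : ℕ} (P : Fin n → Fin 2 → ℝ) (z y : Fin n → Fin 2) (i₀ : Fin n)
    (r : ℝ) (h₀ : ∀ u, P i₀ u = if u = z i₀ then 1 - r else r)
    (h : ∀ i, i ≠ i₀ → ∀ u, P i u = if u = z i then 1 else 0) :
    ∏ i, P i (y i) = (if y = z then 1 - r else 0) +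
      if y = Function.update z i₀ (z i₀ + 1) then r else 0 := by
  rw [← Finset.mul_prod_erase _ _ (Finset.mem_univ i₀),
    Finset.prod_congr rfl fun i hi => h i (Finset.ne_of_mem_erase hi) (y i)]
  have hz : z ≠ Function.update z i₀ (z i₀ + 1) := fun h => by
    have := congrFun h i₀
    rw [Function.update_self] at this
    exact fin_two_ne_add_one _ this
  by_cases hy : ∀ i, i ≠ i₀ → y i = z i
  · rw [Finset.prod_congr rfl fun i hi => if_pos (hy i (Finset.ne_of_mem_erase hi)),
      Finset.prod_const_one, mul_one, h₀]
    by_cases h0 : y i₀ = z i₀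
    · have : y = z := funext fun i => by
        by_cases hi : i = i₀
        · rw [hi, h0]
        · exact hy i hi
      rw [if_pos h0, if_pos this, if_neg (this ▸ hz), add_zero]
    · have : y = Function.update z i₀ (z i₀ + 1) := funext fun i => by
        by_cases hi : i = i₀
        · rw [hi, Function.update_self, fin_two_eq_add_one_of_ne h0]
        · rw [Function.update_of_ne hi, hy i hi]
      rw [if_neg h0, if_pos this, if_neg (this ▸ hz.symm), zero_add]
  · push Not at hy
    obtain ⟨i, hi, hne⟩ := hy
    rw [Finset.prod_eq_zero (Finset.mem_erase.2 ⟨hi, Finset.mem_univ i⟩) (if_neg hne), mul_zero,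
      if_neg (fun h => hne (by rw [h])),
      if_neg (fun h => hne (by rw [h, Function.update_of_ne hi])), add_zero]

/-- Every distribution in the closure of a deep belief network is in the closure of deeper ones. -/
theorem closure_binDBN_mono {n L' M' : ℕ} (h : L' ≤ M') :
    closure (binDBN n L') ⊆ closure (binDBN n M') := by
  refine Nat.le_induction subset_rfl (fun M _ ih => ih.trans fun q hq => ?_) M' h
  have key := closure_binDBN_succ hq (g := fun i z => if z i = 1 then 1 else -1)
    (θ := fun _ _ => 0) (fun i => .coord i fun u => if u = 1 then 1 else -1) fun _ => .const 0
  convert key using 2 with y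
  have lim : ∀ z : Fin n → Fin 2, ∀ i, limitUnit (if z i = 1 then 1 else -1) 0 =
      if z i = 1 then 1 else 0 := by
    intro z i
    split_ifs <;> simp [limitUnit]
  simp only [lim, bernoulliMass_zero_or_one]
  rw [Finset.sum_eq_single y]
  · simp
  · intro z _ hz
    obtain ⟨i, hi⟩ := Function.ne_iff.1 hz.symm
    rw [Finset.prod_eq_zero (Finset.mem_univ i) (if_neg hi), zero_mul]
  · simp

theorem exists_sigmoid_eq : ∃ ℓ : ℝ → ℝ, ∀ μ, 0 < μ → μ < 1 → Real.sigmoid (ℓ μ) = μ := by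
  have h : ∀ μ : ℝ, ∃ x, 0 < μ → μ < 1 → Real.sigmoid x = μ := by
    intro μ
    by_cases hμ : μ ∈ Set.Ioo (0 : ℝ) 1
    · rw [← Real.range_sigmoid] at hμ
      obtain ⟨x, hx⟩ := hμ
      exact ⟨x, fun _ _ => hx⟩
    · exact ⟨0, fun h0 h1 => absurd ⟨h0, h1⟩ hμ⟩
  choose ℓ hℓ using h
  exact ⟨ℓ, hℓ⟩

/-- A partition of the binary cube into faces, labelled by `edge` and `level`, such that for every
label `e` consecutive levels are exchanged by flipping the bit `unit t e`, with distinct bits for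
distinct labels. The coordinate `free` is free on every face, and `penalty e t` is an affine
function that vanishes exactly on the face with labels `e` and `t`. -/
structure FacePaths (n N : ℕ) (E : Type*) where
  free : Fin n
  edge : (Fin n → Fin 2) → E
  level : (Fin n → Fin 2) → ℕ
  level_le : ∀ v, level v ≤ N
  penalty : E → ℕ → (Fin n → Fin 2) → ℝ
  penalty_affine : ∀ e t, IsCubeAffine (penalty e t)
  penalty_eq_zero : ∀ v, penalty (edge v) (level v) v = 0
  one_le_penalty : ∀ e t v, t ≤ N → ¬(edge v = e ∧ level v = t) → 1 ≤ penalty e t v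
  unit : ℕ → E → Fin n
  bit : ℕ → E → Fin 2
  unit_injective : ∀ t, Function.Injective (unit t)
  unit_ne_free : ∀ t e, unit t e ≠ free
  apply_unit : ∀ t v, t < N → level v = t → v (unit t (edge v)) = bit t (edge v)
  edge_flip : ∀ t v,
    edge (Function.update v (unit t (edge v)) (v (unit t (edge v)) + 1)) = edge v
  level_flip : ∀ t v, t < N → level v = t →
    level (Function.update v (unit t (edge v)) (v (unit t (edge v)) + 1)) = t + 1
  level_flip_succ : ∀ t v, t < N → level v = t + 1 →
    level (Function.update v (unit t (edge v)) (v (unit t (edge v)) + 1)) = t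

namespace FacePaths

variable {n N : ℕ} {E : Type*} (F : FacePaths n N E)

/-- Flip the bit that leads from level `t` to level `t + 1`. -/
def flip (t : ℕ) (v : Fin n → Fin 2) : Fin n → Fin 2 :=
  Function.update v (F.unit t (F.edge v)) (v (F.unit t (F.edge v)) + 1)

theorem flip_flip (t : ℕ) (v : Fin n → Fin 2) : F.flip t (F.flip t v) = v := by
  have h : F.edge (F.flip t v) = F.edge v := F.edge_flip t v
  rw [flip, h, flip, Function.update_self, fin_two_add_one_add_one, Function.update_idem,
    Function.update_eq_self]

theorem flip_apply_free (t : ℕ) (v : Fin n → Fin 2) : F.flip t v F.free = v F.free :=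
  Function.update_of_ne (F.unit_ne_free t _).symm _ _

/-- A sigmoid layer can flip, in the limit, the bits leading from level `t` to level `t + 1` with
arbitrary probabilities. -/
theorem closure_binDBN_flip {L' t : ℕ} (ht : t < N) {q : (Fin n → Fin 2) → ℝ}
    (hq : q ∈ closure (binDBN n L')) (r : Fin 2 → E → ℝ) (h0 : ∀ x e, 0 < r x e)
    (h1 : ∀ x e, r x e < 1) :
    (fun y => ∑ z, ((if y = z then
        1 - (if F.level z = t then r (z F.free) (F.edge z) else 0) else 0) +
      (if y = F.flip t z then
        (if F.level z = t then r (z F.free) (F.edge z) else 0) else 0)) * q z) ∈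
      closure (binDBN n (L' + 1)) := by
  obtain ⟨ℓ, hℓ⟩ := exists_sigmoid_eq
  let C : E → ℝ := fun e => ∑ v, |F.penalty e t v| + 1
  have hC : ∀ e v, F.penalty e t v < C e := fun e v =>
    (le_abs_self _).trans_lt ((Finset.single_le_sum (f := fun v => |F.penalty e t v|)
      (fun _ _ => abs_nonneg _) (Finset.mem_univ v)).trans_lt (lt_add_one _))
  let gE : E → (Fin n → Fin 2) → ℝ := fun e z => (if F.bit t e = 1 then 1 else -1) *
    (F.penalty e t z - if z (F.unit t e) = F.bit t e then 0 else C e)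
  let θE : E → (Fin n → Fin 2) → ℝ := fun e z =>
    ℓ (if F.bit t e = 1 then 1 - r (z F.free) e else r (z F.free) e)
  let g : Fin n → (Fin n → Fin 2) → ℝ :=
    Function.extend (F.unit t) gE fun i z => if z i = 1 then 1 else -1
  let θ : Fin n → (Fin n → Fin 2) → ℝ := Function.extend (F.unit t) θE fun _ _ => 0
  have hg : ∀ i, IsCubeAffine (g i) := by
    intro i
    by_cases hi : ∃ e, F.unit t e = i
    · obtain ⟨e, rfl⟩ := hi
      simp only [g, (F.unit_injective t).extend_apply]
      exact ((F.penalty_affine e t).sub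
        (.coord _ fun u => if u = F.bit t e then 0 else C e)).const_mul _
    · simp only [g, Function.extend_apply' _ _ _ hi]
      exact .coord i fun u => if u = 1 then 1 else -1
  have hθ : ∀ i, IsCubeAffine (θ i) := by
    intro i
    by_cases hi : ∃ e, F.unit t e = i
    · obtain ⟨e, rfl⟩ := hi
      simp only [θ, (F.unit_injective t).extend_apply]
      exact .coord F.free fun u => ℓ (if F.bit t e = 1 then 1 - r u e else r u e)
    · simp only [θ, Function.extend_apply' _ _ _ hi]
      exact .const 0
  have copy : ∀ z i, ¬(F.level z = t ∧ i = F.unit t (F.edge z)) →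
      limitUnit (g i z) (θ i z) = if z i = 1 then 1 else 0 := by
    intro z i hzi
    by_cases hi : ∃ e, F.unit t e = i
    · obtain ⟨e, rfl⟩ := hi
      have hp : 1 ≤ F.penalty e t z :=
        F.one_le_penalty e t z ht.le fun h => hzi ⟨h.2, by rw [h.1]⟩
      simp only [g, gE, (F.unit_injective t).extend_apply]
      exact limitUnit_signed (one_pos.trans_le hp) (hC e z) _ _ _
    · simp only [g, Function.extend_apply' _ _ _ hi]
      split_ifs <;> simp [limitUnit]
  have flipped : ∀ z, F.level z = t → ∀ u,
      bernoulliMass (limitUnit (g (F.unit t (F.edge z)) z) (θ (F.unit t (F.edge z)) z)) u =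
        if u = z (F.unit t (F.edge z)) then 1 - r (z F.free) (F.edge z)
          else r (z F.free) (F.edge z) := by
    intro z hz u
    have hp : F.penalty (F.edge z) t z = 0 := hz ▸ F.penalty_eq_zero z
    have hb := F.apply_unit t z ht hz
    have h0 := h0 (z F.free) (F.edge z)
    have h1 := h1 (z F.free) (F.edge z)
    simp only [g, θ, gE, θE, (F.unit_injective t).extend_apply, hp, hb]
    simp only [if_true, sub_zero, mul_zero, limitUnit, lt_irrefl, if_false]
    rw [hℓ _ (by split_ifs <;> linarith) (by split_ifs <;> linarith)]
    rcases Fin.exists_fin_two.1 ⟨F.bit t (F.edge z), rfl⟩ with hb | hb <;>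
    rcases Fin.exists_fin_two.1 ⟨u, rfl⟩ with hu | hu <;>
    simp [hb, hu, bernoulliMass]
  have key := closure_binDBN_succ hq hg hθ
  refine (congrArg (· ∈ closure (binDBN n (L' + 1))) (funext fun y => ?_)).mp key
  refine Finset.sum_congr rfl fun z _ => congrArg (· * q z) ?_
  refine prod_copy_except (fun i u => bernoulliMass (limitUnit (g i z) (θ i z)) u) z y
    (F.unit t (F.edge z)) _ (fun u => ?_) fun i hi u => ?_
  · by_cases hz : F.level z = t
    · simp only [if_pos hz, flipped z hz]
    · simp only [copy z _ fun h => hz h.1, if_neg hz, bernoulliMass_zero_or_one, sub_zero]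
  · simp only [copy z i fun h => hi h.2, bernoulliMass_zero_or_one]

/-- The total mass that `w` assigns from level `t` on. -/
def tail (_ : FacePaths n N E) (w : Fin 2 → E → ℕ → ℝ) (t : ℕ) (x : Fin 2) (e : E) : ℝ :=
  ∑ s ∈ Finset.Icc t N, w x e s

/-- The intermediate distribution with final masses below level `t`, and with all the remaining
mass on level `t`. -/
def stage (w : Fin 2 → E → ℕ → ℝ) (t : ℕ) (v : Fin n → Fin 2) : ℝ :=
  if F.level v < t then w (v F.free) (F.edge v) (F.level v)
  else if F.level v = t then F.tail w t (v F.free) (F.edge v) else 0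

variable {w : Fin 2 → E → ℕ → ℝ}

theorem tail_pos (hw : ∀ x e s, 0 < w x e s) {t : ℕ} (ht : t ≤ N) (x : Fin 2) (e : E) :
    0 < F.tail w t x e :=
  Finset.sum_pos (fun s _ => hw x e s) ⟨t, Finset.mem_Icc.2 ⟨le_rfl, ht⟩⟩

theorem tail_eq_add {t : ℕ} (ht : t ≤ N) (x : Fin 2) (e : E) :
    F.tail w t x e = w x e t + F.tail w (t + 1) x e := by
  rw [tail, tail, ← Finset.insert_Icc_add_one_left_eq_Icc ht, Finset.sum_insert (by simp)]

theorem stage_last (v : Fin n → Fin 2) :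
    F.stage w N v = w (v F.free) (F.edge v) (F.level v) := by
  unfold stage
  split_ifs with h1 h2
  · rfl
  · simp [tail, h2]
  · exact absurd (lt_of_le_of_ne (F.level_le v) h2) h1

theorem stage_succ (hw : ∀ x e s, 0 < w x e s) {t : ℕ} (ht : t < N) :
    F.stage w (t + 1) = fun y => ∑ z, ((if y = z then
        1 - (if F.level z = t then
          F.tail w (t + 1) (z F.free) (F.edge z) / F.tail w t (z F.free) (F.edge z) else 0)
        else 0) +
      (if y = F.flip t z then
        (if F.level z = t then
          F.tail w (t + 1) (z F.free) (F.edge z) / F.tail w t (z F.free) (F.edge z) else 0)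
        else 0)) * F.stage w t z := by
  funext y
  simp only [add_mul, Finset.sum_add_distrib, ite_mul, zero_mul]
  rw [Finset.sum_ite_eq, if_pos (Finset.mem_univ y)]
  have hT := F.tail_pos hw ht.le (y F.free) (F.edge y)
  by_cases h : F.level y = t + 1
  · have hf : F.level (F.flip t y) = t := F.level_flip_succ t y ht h
    have he : F.edge (F.flip t y) = F.edge y := F.edge_flip t y
    rw [Finset.sum_eq_single (F.flip t y)]
    · rw [if_pos (F.flip_flip t y).symm, if_pos hf]
      simp only [stage, h, hf, he, F.flip_apply_free]
      simp [hT.ne']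
    · intro z _ hz
      exact if_neg fun hy => hz (by rw [hy, F.flip_flip])
    · simp
  · rw [Finset.sum_eq_zero]
    · by_cases h' : F.level y = t
      · simp only [stage, h']
        rw [F.tail_eq_add ht.le] at hT ⊢
        simp
        field_simp
        ring
      · have : F.level y < t + 1 ↔ F.level y < t := by omega
        simp [stage, h, h', this]
    · intro z _
      by_cases hz : F.level z = t
      · exact if_neg fun hy => h (by rw [hy]; exact F.level_flip t z ht hz)
      · simp [hz]

theorem sum_stage_succ (hw : ∀ x e s, 0 < w x e s) {t : ℕ} (ht : t < N) :
    ∑ v, F.stage w (t + 1) v = ∑ v, F.stage w t v := by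
  rw [F.stage_succ hw ht, Finset.sum_comm]
  refine Finset.sum_congr rfl fun z _ => ?_
  rw [← Finset.sum_mul, Finset.sum_add_distrib, Finset.sum_ite_eq', Finset.sum_ite_eq',
    if_pos (Finset.mem_univ _), if_pos (Finset.mem_univ _), sub_add_cancel, one_mul]

theorem stage_zero_mem (hw : ∀ x e s, 0 < w x e s) (hsum : ∑ v, F.stage w 0 v = 1) :
    F.stage w 0 ∈ closure (binDBN n 0) := by
  let G : Fin n → (Fin n → Fin 2) → ℝ :=
    Function.extend (F.unit 0) (fun e v => 1 - 2 * F.penalty e 0 v) fun _ _ => -1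
  let θ : Fin n → (Fin n → Fin 2) → ℝ :=
    Function.extend (F.unit 0) (fun e v => Real.log (F.tail w 0 (v F.free) e)) fun _ _ => 0
  have hG : ∀ i, IsCubeAffine (G i) := by
    intro i
    by_cases hi : ∃ e, F.unit 0 e = i
    · obtain ⟨e, rfl⟩ := hi
      simp only [G, (F.unit_injective 0).extend_apply]
      exact (IsCubeAffine.const 1).sub ((F.penalty_affine e 0).const_mul 2)
    · simp only [G, Function.extend_apply' _ _ _ hi]
      exact .const (-1)
  have hθ : ∀ i, IsCubeAffine (θ i) := by
    intro i
    by_cases hi : ∃ e, F.unit 0 e = i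
    · obtain ⟨e, rfl⟩ := hi
      simp only [θ, (F.unit_injective 0).extend_apply]
      exact .coord F.free fun u => Real.log (F.tail w 0 u e)
    · simp only [θ, Function.extend_apply' _ _ _ hi]
      exact .const 0
  have neg : ∀ v i, ¬(F.level v = 0 ∧ i = F.unit 0 (F.edge v)) → G i v < 0 := by
    intro v i hvi
    by_cases hi : ∃ e, F.unit 0 e = i
    · obtain ⟨e, rfl⟩ := hi
      have hp : 1 ≤ F.penalty e 0 v :=
        F.one_le_penalty e 0 v N.zero_le fun h => hvi ⟨h.2, by rw [h.1]⟩
      simp only [G, (F.unit_injective 0).extend_apply]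
      linarith
    · simp [G, Function.extend_apply' _ _ _ hi]
  refine closure_binDBN_zero hG hθ hsum fun v => ?_
  by_cases hv : F.level v = 0
  · refine Or.inl ⟨F.unit 0 (F.edge v), ?_, fun i hi => neg v i fun h => hi h.2, ?_⟩
    · have hp : F.penalty (F.edge v) 0 v = 0 := hv ▸ F.penalty_eq_zero v
      simp [G, (F.unit_injective 0).extend_apply, hp]
    · simp only [θ, (F.unit_injective 0).extend_apply]
      rw [Real.exp_log (F.tail_pos hw N.zero_le _ _)]
      simp [stage, hv]
  · exact Or.inr ⟨fun i => neg v i fun h => hv h.1, by simp [stage, hv]⟩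

/-- A deep belief network with `N` sigmoid layers approximates all distributions with positive
masses that only depend on the coordinate `free`, the edge and the level. -/
theorem mem_closure_binDBN (hw : ∀ x e s, 0 < w x e s)
    (hsum : ∑ v, w (v F.free) (F.edge v) (F.level v) = 1) :
    (fun v => w (v F.free) (F.edge v) (F.level v)) ∈ closure (binDBN n N) := by
  have hlast : F.stage w N = fun v => w (v F.free) (F.edge v) (F.level v) := funext F.stage_last
  have hconst : ∀ t ≤ N, ∑ v, F.stage w t v = ∑ v, F.stage w 0 v := by
    intro t ht
    induction t with
    | zero => rfl
    | succ t ih => rw [F.sum_stage_succ hw ht, ih (Nat.le_of_succ_le ht)]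
  have hzero : ∑ v, F.stage w 0 v = 1 := by rw [← hconst N le_rfl, hlast, hsum]
  have hmem : ∀ t ≤ N, F.stage w t ∈ closure (binDBN n t) := by
    intro t ht
    induction t with
    | zero => exact F.stage_zero_mem hw hzero
    | succ t ih =>
      rw [F.stage_succ hw ht]
      refine F.closure_binDBN_flip ht (ih (Nat.le_of_succ_le ht))
        (fun x e => F.tail w (t + 1) x e / F.tail w t x e)
        (fun x e => div_pos (F.tail_pos hw ht x e) (F.tail_pos hw (Nat.le_of_succ_le ht) x e))
        fun x e => ?_
      rw [div_lt_one (F.tail_pos hw (Nat.le_of_succ_le ht) x e),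
        F.tail_eq_add (Nat.le_of_succ_le ht)]
      exact lt_add_of_pos_left _ (hw x e t)
  exact hlast ▸ hmem N le_rfl

end FacePaths

theorem exists_gray_path (S : ℕ) : ∃ γ : ℕ → Fin S → Fin 2,
    Set.InjOn γ (Set.Iio (2 ^ S)) ∧
      ∀ t, t + 1 < 2 ^ S → ∃ j, γ (t + 1) = Function.update (γ t) j (γ t j + 1) := by
  induction S with
  | zero =>
    refine ⟨fun _ => 0, fun a ha b hb _ => ?_, fun t ht => by simp at ht⟩
    simp only [pow_zero, Set.mem_Iio] at ha hb
    omega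
  | succ S ih =>
    obtain ⟨γ, hinj, hstep⟩ := ih
    have hpow : 2 ^ (S + 1) = 2 * 2 ^ S := pow_succ' 2 S
    refine ⟨fun t => if t < 2 ^ S then Fin.cons 0 (γ t) else Fin.cons 1 (γ (2 * 2 ^ S - 1 - t)),
      fun a ha b hb hab => ?_, fun t ht => ?_⟩
    · simp only [Set.mem_Iio, hpow] at ha hb
      by_cases h1 : a < 2 ^ S <;> by_cases h2 : b < 2 ^ S <;>
      simp only [h1, h2, if_true, if_false, Fin.cons_inj] at hab
      · exact hinj h1 h2 hab.2
      · simp at hab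
      · simp at hab
      · have := hinj (Set.mem_Iio.2 (by omega)) (Set.mem_Iio.2 (by omega)) hab.2
        omega
    · rw [hpow] at ht
      by_cases h1 : t + 1 < 2 ^ S
      · obtain ⟨j, hj⟩ := hstep t h1
        refine ⟨j.succ, ?_⟩
        simp only [h1, (Nat.lt_succ_self t).trans h1, if_true, hj, Fin.cons_succ, Fin.cons_update]
      · by_cases h2 : t < 2 ^ S
        · refine ⟨0, ?_⟩
          have : 2 * 2 ^ S - 1 - (t + 1) = t := by omega
          simp only [h1, h2, if_true, if_false, this, Fin.cons_zero, Fin.update_cons_zero, zero_add]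
        · obtain ⟨j, hj⟩ := hstep (2 * 2 ^ S - 1 - (t + 1)) (by omega)
          refine ⟨j.succ, ?_⟩
          have : 2 * 2 ^ S - 1 - t = 2 * 2 ^ S - 1 - (t + 1) + 1 := by omega
          simp only [h1, h2, if_false, this, hj, Fin.cons_succ, ← Fin.cons_update,
            Function.update_self, Function.update_idem, fin_two_add_one_add_one,
            Function.update_eq_self]

theorem exists_gray_code (S : ℕ) : ∃ (γ : ℕ → Fin S → Fin 2) (rank : (Fin S → Fin 2) → ℕ),
    (∀ u, rank u < 2 ^ S) ∧ (∀ u, γ (rank u) = u) ∧ (∀ t, t < 2 ^ S → rank (γ t) = t) ∧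
      ∀ t, t + 1 < 2 ^ S → ∃ j, γ (t + 1) = Function.update (γ t) j (γ t j + 1) := by
  obtain ⟨γ, hinj, hstep⟩ := exists_gray_path S
  have hbij : Function.Bijective fun t : Fin (2 ^ S) => γ t :=
    (Fintype.bijective_iff_injective_and_card _).2
      ⟨fun a b h => Fin.ext (hinj a.2 b.2 h), by simp⟩
  let φ := Equiv.ofBijective _ hbij
  exact ⟨γ, fun u => φ.symm u, fun u => (φ.symm u).2, fun u => φ.apply_symm_apply u,
    fun t ht => congrArg Fin.val (φ.symm_apply_apply ⟨t, ht⟩), hstep⟩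

theorem exists_facePaths (κ S : ℕ) (hS : S ≤ 2 ^ κ) :
    ∃ F : FacePaths (2 ^ κ + (κ + 1)) (2 ^ S - 1) (Fin (2 ^ κ)), ∀ v,
      (Finset.univ.filter fun v' => v' F.free = v F.free ∧ F.edge v' = F.edge v ∧
        F.level v' = F.level v).card ≤ 2 ^ (2 ^ κ - S) := by
  obtain ⟨γ, rank, hlt, hγ, hrank, hstep⟩ := exists_gray_code S
  have hpos : 0 < 2 ^ S := by positivity
  have hslot : ∀ t, ∃ d : Fin (2 ^ κ), t < 2 ^ S - 1 → ∃ j, Fin.castLE hS j = d ∧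
      γ (t + 1) = Function.update (γ t) j (γ t j + 1) := by
    intro t
    by_cases ht : t + 1 < 2 ^ S
    · obtain ⟨j, hj⟩ := hstep t ht
      exact ⟨Fin.castLE hS j, fun _ => ⟨j, rfl, hj⟩⟩
    · exact ⟨0, fun h => absurd h (by omega)⟩
  choose slot hslot using hslot
  let pos : Fin (2 ^ κ) → Fin S → Fin (2 ^ κ + (κ + 1)) :=
    fun e j => Fin.castAdd (κ + 1) (e + Fin.castLE hS j)
  let code : Fin κ → Fin (2 ^ κ + (κ + 1)) := fun r => Fin.natAdd (2 ^ κ) r.castSucc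
  let edge : (Fin (2 ^ κ + (κ + 1)) → Fin 2) → Fin (2 ^ κ) :=
    fun v => finFunctionFinEquiv fun r => v (code r)
  let level : (Fin (2 ^ κ + (κ + 1)) → Fin 2) → ℕ := fun v => rank fun j => v (pos (edge v) j)
  let unit : ℕ → Fin (2 ^ κ) → Fin (2 ^ κ + (κ + 1)) := fun t e => Fin.castAdd (κ + 1) (e + slot t)
  have pos_inj : ∀ e, Function.Injective (pos e) := fun e a b h =>
    Fin.castLE_injective hS (add_left_cancel (Fin.castAdd_injective _ _ h))
  have code_ne : ∀ d r, Fin.castAdd (κ + 1) d ≠ code r := fun d r h => by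
    have := congrArg Fin.val h
    simp only [code, Fin.val_castAdd, Fin.val_natAdd] at this
    omega
  have hlevel : ∀ v, (fun j => v (pos (edge v) j)) = γ (level v) := fun v => (hγ _).symm
  have edge_flip : ∀ t v a, edge (Function.update v (unit t (edge v)) a) = edge v := by
    intro t v a
    refine congrArg finFunctionFinEquiv (funext fun r => ?_)
    exact Function.update_of_ne (code_ne _ r).symm _ _
  have flip_pos : ∀ t v j a, Fin.castLE hS j = slot t →
      (fun i => Function.update v (unit t (edge v)) a (pos (edge v) i)) =
        Function.update (fun i => v (pos (edge v) i)) j a := by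
    intro t v j a hj
    have : unit t (edge v) = pos (edge v) j := by simp only [unit, pos, hj]
    rw [this]
    exact Function.update_comp_eq_of_injective v (pos_inj _) j a
  have unit_eq : ∀ t v j, Fin.castLE hS j = slot t → v (unit t (edge v)) = γ (level v) j := by
    intro t v j hj
    rw [← hlevel]
    simp only [unit, pos, hj]
  refine ⟨{
    free := Fin.natAdd (2 ^ κ) (Fin.last κ)
    edge := edge
    level := level
    level_le := fun v => Nat.le_sub_one_of_lt (hlt _)
    penalty := fun e t v =>
      (∑ r, if v (code r) = finFunctionFinEquiv.symm e r then 0 else 1) +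
        ∑ j, if v (pos e j) = γ t j then 0 else 1
    penalty_affine := fun e t =>
      (IsCubeAffine.sum _ fun r => .coord (code r) fun u =>
        if u = finFunctionFinEquiv.symm e r then 0 else 1).add
      (IsCubeAffine.sum _ fun j => .coord (pos e j) fun u => if u = γ t j then 0 else 1)
    penalty_eq_zero := fun v => ?_
    one_le_penalty := fun e t v ht h => ?_
    unit := unit
    bit := fun t _ => Function.extend (Fin.castLE hS) (γ t) 0 (slot t)
    unit_injective := fun t a b h => add_right_cancel (Fin.castAdd_injective _ _ h)
    unit_ne_free := fun t e h => ?_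
    apply_unit := fun t v ht hv => ?_
    edge_flip := fun t v => edge_flip t v _
    level_flip := fun t v ht hv => ?_
    level_flip_succ := fun t v ht hv => ?_ }, fun v => ?_⟩
  · have h1 : ∀ r, v (code r) = finFunctionFinEquiv.symm (edge v) r := fun r => by
      simp only [edge, Equiv.symm_apply_apply]
    have h2 : ∀ j, v (pos (edge v) j) = γ (level v) j := fun j => congrFun (hlevel v) j
    simp [← h1, ← h2]
  · have one_le : ∀ {ι : Type} [Fintype ι] (P : ι → Prop) [DecidablePred P], (∃ i, ¬P i) →
        (1 : ℝ) ≤ ∑ i, if P i then (0 : ℝ) else 1 := by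
      rintro ι _ P _ ⟨i, hi⟩
      refine le_trans (by simp [hi]) (Finset.single_le_sum
        (f := fun i => if P i then (0 : ℝ) else 1) (fun i _ => ?_) (Finset.mem_univ i))
      split_ifs <;> norm_num
    have nonneg : ∀ {ι : Type} [Fintype ι] (P : ι → Prop) [DecidablePred P],
        (0 : ℝ) ≤ ∑ i, if P i then (0 : ℝ) else 1 := fun P _ =>
      Finset.sum_nonneg fun i _ => by split_ifs <;> norm_num
    by_cases he : edge v = e
    · have hl : ∃ j, ¬ v (pos e j) = γ t j := by
        by_contra! hl
        refine h ⟨he, ?_⟩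
        have : (fun j => v (pos (edge v) j)) = γ t := funext fun j => by rw [he, hl]
        simp only [level, this]
        exact hrank t (by omega)
      exact le_add_of_nonneg_of_le (nonneg _) (one_le _ hl)
    · have hr : ∃ r, ¬ v (code r) = finFunctionFinEquiv.symm e r := by
        by_contra! hr
        refine he ?_
        simp only [edge, hr]
        exact finFunctionFinEquiv.apply_symm_apply e
      exact le_add_of_le_of_nonneg (one_le _ hr) (nonneg _)
  · have := congrArg Fin.val h
    simp only [unit, Fin.val_castAdd, Fin.val_natAdd] at this
    omega
  · obtain ⟨j, hj, -⟩ := hslot t ht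
    rw [unit_eq t v j hj, hv, ← hj, (Fin.castLE_injective hS).extend_apply]
  · obtain ⟨j, hj, hstep⟩ := hslot t ht
    have : (fun i => Function.update v (unit t (edge v)) (v (unit t (edge v)) + 1)
        (pos (edge v) i)) = γ (t + 1) := by
      rw [flip_pos t v j _ hj, unit_eq t v j hj, hlevel, hv, hstep]
    simp only [level, edge_flip, this]
    exact hrank _ (by omega)
  · obtain ⟨j, hj, hstep⟩ := hslot t ht
    have : (fun i => Function.update v (unit t (edge v)) (v (unit t (edge v)) + 1)
        (pos (edge v) i)) = γ t := by
      rw [flip_pos t v j _ hj, unit_eq t v j hj, hlevel, hv, hstep, Function.update_self,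
        Function.update_idem, fin_two_add_one_add_one, Function.update_eq_self]
    simp only [level, edge_flip, this]
    exact hrank _ (by omega)
  · let shift : Fin S → Fin (2 ^ κ) := fun j => edge v + Fin.castLE hS j
    have shift_inj : Function.Injective shift := fun a b h =>
      Fin.castLE_injective hS (add_left_cancel h)
    classical
    have hcard : Fintype.card ({d // d ∉ Set.range shift} → Fin 2) = 2 ^ (2 ^ κ - S) := by
      rw [Fintype.card_fun, Fintype.card_fin, Fintype.card_subtype_compl, Fintype.card_fin,
        ← Fintype.card_congr (Equiv.ofInjective _ shift_inj), Fintype.card_fin]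
    rw [← hcard, ← Finset.card_univ]
    refine Finset.card_le_card_of_injOn (fun v' d => v' (Fin.castAdd (κ + 1) d.1))
      (fun _ _ => Finset.mem_univ _) fun a ha b hb hab => ?_
    simp only [Finset.coe_filter, Finset.mem_univ, true_and, Set.mem_ofPred_eq] at ha hb
    funext i
    refine Fin.addCases (fun d => ?_) (fun r => ?_) i
    · by_cases hd : d ∈ Set.range shift
      · obtain ⟨j, rfl⟩ := hd
        have h1 := congrFun (hlevel a) j
        have h2 := congrFun (hlevel b) j
        rw [ha.2.1, ha.2.2] at h1
        rw [hb.2.1, hb.2.2] at h2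
        exact h1.trans h2.symm
      · exact congrFun hab ⟨d, hd⟩
    · refine Fin.lastCases (ha.1.trans hb.1.symm) (fun r => ?_) r
      exact congrFun (finFunctionFinEquiv.injective (ha.2.1.trans hb.2.1.symm)) r

/-- Replacing a distribution by its averages over the fibers of a map preserves the total mass. -/
theorem sum_fiber_average {α β : Type*} [Fintype α] [DecidableEq β] (f : α → β) (p : α → ℝ) :
    ∑ a, (∑ b with f b = f a, p b) / (Finset.univ.filter fun b => f b = f a).card = ∑ a, p a := by
  simp only [Finset.sum_div, Finset.sum_filter, ite_div, zero_div]
  rw [Finset.sum_comm]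
  refine Finset.sum_congr rfl fun b _ => ?_
  rw [← Finset.sum_filter]
  have h : ∀ a ∈ Finset.univ.filter fun a => f b = f a,
      p b / ((Finset.univ.filter fun b => f b = f a).card : ℝ) =
        p b / ((Finset.univ.filter fun a => f b = f a).card : ℝ) := by
    intro a ha
    simp only [Finset.mem_filter, Finset.mem_univ, true_and] at ha
    simp only [← ha, eq_comm]
  rw [Finset.sum_congr rfl h, Finset.sum_const, nsmul_eq_mul]
  refine mul_div_cancel₀ _ ?_
  exact_mod_cast (Finset.card_pos.2 ⟨b, by simp⟩).ne'

theorem divFrom_le_of_mem_closure {𝒳 : Type*} [Fintype 𝒳] {p q : 𝒳 → ℝ} {M : Set (𝒳 → ℝ)}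
    (hq : q ∈ closure M) (hpq : ∀ x, p x ≠ 0 → q x ≠ 0) :
    divFrom p M ≤ ((∑ x, p x * Real.log (p x / q x) : ℝ) : EReal) := by
  obtain ⟨u, hu, hlim⟩ := mem_closure_iff_seq_limit.1 hq
  have hcoord := tendsto_pi_nhds.1 hlim
  have hreal : Tendsto (fun i => ∑ x, p x * Real.log (p x / u i x)) atTop
      (𝓝 (∑ x, p x * Real.log (p x / q x))) := by
    refine tendsto_finsetSum _ fun x _ => ?_
    by_cases hx : p x = 0
    · simp [hx]
    · exact ((tendsto_const_nhds.div (hcoord x) (hpq x hx)).log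
        (div_ne_zero hx (hpq x hx))).const_mul _
  refine ge_of_tendsto ((continuous_coe_real_ereal.tendsto _).comp hreal) ?_
  have hsupp : ∀ᶠ i in atTop, ∀ x, p x ≠ 0 → u i x ≠ 0 := by
    refine eventually_all.2 fun x => ?_
    by_cases hx : p x = 0
    · simp [hx]
    · filter_upwards [(hcoord x).eventually_ne (hpq x hx)] with i hi _ using hi
  filter_upwards [hsupp] with i hi
  refine (iInf₂_le (u i) (hu i)).trans ?_
  rw [KL, if_pos hi, Function.comp_apply]

theorem sum_mul_log_div_le {𝒳 : Type*} [Fintype 𝒳] {p q : 𝒳 → ℝ} (hp : IsProb p) {c : ℝ}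
    (h : ∀ x, p x / c ≤ q x) (hc : 0 < c) :
    ∑ x, p x * Real.log (p x / q x) ≤ Real.log c := by
  calc ∑ x, p x * Real.log (p x / q x) ≤ ∑ x, p x * Real.log c := by
        refine Finset.sum_le_sum fun x _ => ?_
        rcases (hp.1 x).eq_or_lt with hx | hx
        · simp [← hx]
        · have hq : 0 < q x := (div_pos hx hc).trans_le (h x)
          refine mul_le_mul_of_nonneg_left (Real.log_le_log (div_pos hx hq) ?_) hx.le
          rw [div_le_iff₀ hq, mul_comm, ← div_le_iff₀ hc]
          exact h x
    _ = Real.log c := by rw [← Finset.sum_mul, hp.2, one_mul]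

/-- The divergence is at most the logarithm of the size of the largest block on which the
approximating distributions are constant. -/
theorem FacePaths.maxDiv_le {n N : ℕ} {E : Type*} [DecidableEq E] (F : FacePaths n N E) {c : ℕ}
    (hc : ∀ v, (Finset.univ.filter fun v' => v' F.free = v F.free ∧ F.edge v' = F.edge v ∧
      F.level v' = F.level v).card ≤ c) {L' : ℕ} (hL : N ≤ L') :
    maxDiv (binDBN n L') ≤ ((Real.log c : ℝ) : EReal) := by
  refine iSup₂_le fun p hp => ?_
  let block : Fin 2 → E → ℕ → Finset (Fin n → Fin 2) := fun x e s =>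
    Finset.univ.filter fun v' => v' F.free = x ∧ F.edge v' = e ∧ F.level v' = s
  let w : Fin 2 → E → ℕ → ℝ := fun x e s => (∑ v' ∈ block x e s, p v') / (block x e s).card
  have hw : ∀ x e s, 0 ≤ w x e s := fun x e s =>
    div_nonneg (Finset.sum_nonneg fun v _ => hp.1 v) (Nat.cast_nonneg _)
  let q : (Fin n → Fin 2) → ℝ := fun v => w (v F.free) (F.edge v) (F.level v)
  have hqsum : ∑ v, q v = 1 := by
    rw [← hp.2, ← sum_fiber_average (fun v => (v F.free, F.edge v, F.level v)) p]
    simp only [Prod.mk.injEq]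
    rfl
  have hmem : q ∈ closure (binDBN n L') := by
    refine closure_binDBN_mono hL ?_
    have hlim : Tendsto (fun (ε : ℝ) v => (1 - ε) * q v + ε * (1 / 2) ^ n) (𝓝[>] 0) (𝓝 q) := by
      have hcont : Continuous fun (ε : ℝ) (v : Fin n → Fin 2) =>
          (1 - ε) * q v + ε * (1 / 2) ^ n := by fun_prop
      simpa using (hcont.tendsto 0).mono_left nhdsWithin_le_nhds
    refine isClosed_closure.mem_of_tendsto hlim ?_
    filter_upwards [Ioo_mem_nhdsGT (zero_lt_one' ℝ)] with ε hε
    refine F.mem_closure_binDBN (w := fun x e s => (1 - ε) * w x e s + ε * (1 / 2) ^ n)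
      (fun x e s => ?_) ?_
    · have h1 : 0 ≤ (1 - ε) * w x e s := mul_nonneg (sub_nonneg.2 hε.2.le) (hw x e s)
      have h2 : 0 < ε * (1 / 2 : ℝ) ^ n := mul_pos hε.1 (by positivity)
      exact add_pos_of_nonneg_of_pos h1 h2
    · change ∑ v, ((1 - ε) * q v + ε * (1 / 2) ^ n) = 1
      rw [Finset.sum_add_distrib, ← Finset.mul_sum, hqsum]
      simp [mul_left_comm]
  have hself : ∀ v, v ∈ block (v F.free) (F.edge v) (F.level v) := fun v => by simp [block]
  have hbound : ∀ v, p v / c ≤ q v := fun v =>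
    div_le_div₀ (Finset.sum_nonneg fun v _ => hp.1 v)
      (Finset.single_le_sum (fun v _ => hp.1 v) (hself v))
      (Nat.cast_pos.2 (Finset.card_pos.2 ⟨v, hself v⟩)) (Nat.cast_le.2 (hc v))
  have hcpos : 0 < (c : ℝ) :=
    Nat.cast_pos.2 ((Finset.card_pos.2 ⟨0, hself 0⟩).trans_le (hc 0))
  refine (divFrom_le_of_mem_closure hmem fun v hv => ?_).trans
    (EReal.coe_le_coe_iff.2 (sum_mul_log_div_le hp hbound hcpos))
  exact ((div_pos ((hp.1 v).lt_of_ne' hv) hcpos).trans_le (hbound v)).ne'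

/-- for a binary DBN with $L ≥ 1 + 2^S$ layers of width $n = 2^{k-1} + k$,
$D_{DBN} ≤ (2^{k-1} - S)\log 2$. -/
theorem maxDiv_binDBN_le (k : ℕ) (hk : 1 ≤ k) (S : ℕ) (hS : S ≤ 2 ^ (k - 1))
    (L : ℕ) (hL : 1 + 2 ^ S ≤ L) :
    maxDiv (binDBN (2 ^ (k - 1) + k) (L - 2)) ≤
      ((((2 : ℝ) ^ (k - 1) - (S : ℝ)) * Real.log 2 : ℝ) : EReal) := by
  obtain ⟨κ, rfl⟩ : ∃ κ, k = κ + 1 := ⟨k - 1, by omega⟩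
  simp only [Nat.add_sub_cancel] at hS ⊢
  obtain ⟨F, hF⟩ := exists_facePaths κ S hS
  have h := F.maxDiv_le hF (L' := L - 2) (by omega)
  rwa [Nat.cast_pow, Real.log_pow, Nat.cast_sub hS, Nat.cast_pow, Nat.cast_ofNat] at h
end

section
/- Let 𝒳 be a finite set with |𝒳| = N, let ν be a strictly positive distribution on 𝒳 and f : 𝒳 → ℝ^k, and let ℰ be the k-dimensional exponential family ℰ = { p_θ : θ ∈ ℝ^k } where p_θ(x) = ν(x)·exp(⟨θ, f(x)⟩)/Z(θ). Then the maximal information divergence satisfies D_ℰ ≥ log(N) − log(k+1). -/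
open scoped BigOperators

/-- The exponential family with reference measure $ν$ and sufficient statistic $f$:
$p_θ(x) = ν(x)\exp(⟨θ, f(x)⟩)/Z(θ)$. -/
noncomputable def expFamily {𝒳 : Type*} [Fintype 𝒳] {k : ℕ} (ν : 𝒳 → ℝ)
    (f : 𝒳 → Fin k → ℝ) : Set (𝒳 → ℝ) :=
  {p | ∃ θ : Fin k → ℝ, ∀ x, p x =
    ν x * Real.exp (∑ i, θ i * f x i) / ∑ y, ν y * Real.exp (∑ i, θ i * f y i)}

/-- More than `k + 1` points in `ℝ^k` admit a nontrivial affine dependence, and its sign can be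
chosen so that a given linear functional is nonpositive on it. -/
theorem exists_affine_dependence {𝒳 : Type*} [Fintype 𝒳] {k : ℕ} (f : 𝒳 → Fin k → ℝ) (c : 𝒳 → ℝ)
    (S : Finset 𝒳) (hS : k + 1 < S.card) :
    ∃ d : 𝒳 → ℝ, (∀ x, x ∉ S → d x = 0) ∧ ∑ x, d x = 0 ∧ (∀ i, ∑ x, d x * f x i = 0) ∧
      ∑ x, d x * c x ≤ 0 ∧ ∃ x, d x ≠ 0 := by
  classical
  have hdep : ¬ LinearIndepOn ℝ (fun x => ((1 : ℝ), f x)) (S : Set 𝒳) := by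
    intro h
    have h' := LinearIndependent.fintype_card_le_finrank h
    simp at h'
    omega
  obtain ⟨g, hg, x₀, hx₀, hgx₀⟩ := not_linearIndepOn_finset_iff.1 hdep
  have hsum : ∀ a : 𝒳 → ℝ,
      ∑ x, (if x ∈ S then g x else 0) * a x = ∑ x ∈ S, g x * a x := fun a => by
    simp [ite_mul, Finset.sum_ite_mem]
  have h₁ : ∑ x, (if x ∈ S then g x else 0) = 0 := by
    have := congrArg Prod.fst hg
    simpa [Prod.fst_sum, Finset.sum_ite_mem] using this
  have h₂ : ∀ i, ∑ x, (if x ∈ S then g x else 0) * f x i = 0 := fun i => by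
    have := congrFun (congrArg Prod.snd hg) i
    rw [hsum]
    simpa [Prod.snd_sum, Finset.sum_apply] using this
  rcases le_total (∑ x, (if x ∈ S then g x else 0) * c x) 0 with hc | hc
  · exact ⟨fun x => if x ∈ S then g x else 0, fun x hx => by simp [hx], h₁, h₂, hc, x₀,
      by simpa [hx₀] using hgx₀⟩
  · refine ⟨fun x => -(if x ∈ S then g x else 0), fun x hx => by simp [hx], ?_, fun i => ?_, ?_, x₀,
      by simpa [hx₀] using hgx₀⟩
    · rw [Finset.sum_neg_distrib, h₁, neg_zero]
    · simp only [neg_mul]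
      rw [Finset.sum_neg_distrib, h₂, neg_zero]
    · simp only [neg_mul]
      rw [Finset.sum_neg_distrib]
      linarith

/-- A nonnegative vector can be moved along any direction `d ≠ 0` with total mass zero, supported
where the vector is, until one of its coordinates vanishes. -/
theorem exists_smaller_support {𝒳 : Type*} [Fintype 𝒳] {p d : 𝒳 → ℝ} (hp : ∀ x, 0 ≤ p x)
    (hd : ∀ x, p x = 0 → d x = 0) (hd0 : ∑ x, d x = 0) (hne : ∃ x, d x ≠ 0) :
    ∃ t : ℝ, 0 ≤ t ∧ (∀ x, 0 ≤ p x + t * d x) ∧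
      (Finset.univ.filter fun x => p x + t * d x ≠ 0).card <
        (Finset.univ.filter fun x => p x ≠ 0).card := by
  classical
  have hneg : (Finset.univ.filter fun x => d x < 0).Nonempty := by
    by_contra h
    have hnn : ∀ x, 0 ≤ d x := fun x => by
      by_contra hx
      exact h ⟨x, by simpa using hx⟩
    obtain ⟨x, hx⟩ := hne
    exact hx ((Finset.sum_eq_zero_iff_of_nonneg fun x _ => hnn x).1 hd0 x (Finset.mem_univ x))
  obtain ⟨x₀, hx₀, hmin⟩ := Finset.exists_min_image _ (fun x => p x / -d x) hneg
  have hdx₀ : d x₀ < 0 := by simpa using hx₀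
  have ht : 0 ≤ p x₀ / -d x₀ := div_nonneg (hp x₀) (by linarith)
  refine ⟨p x₀ / -d x₀, ht, fun x => ?_, Finset.card_lt_card ?_⟩
  · rcases lt_or_ge (d x) 0 with hx | hx
    · have := hmin x (by simpa using hx)
      rw [le_div_iff₀ (by linarith)] at this
      linarith
    · exact add_nonneg (hp x) (mul_nonneg ht hx)
  · refine (Finset.ssubset_iff_of_subset fun x hx => ?_).2 ⟨x₀, ?_, ?_⟩
    · simp only [Finset.mem_filter, Finset.mem_univ, true_and] at hx ⊢
      intro h
      simp [h, hd x h] at hx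
    · simp only [Finset.mem_filter, Finset.mem_univ, true_and]
      exact fun h => hdx₀.ne (hd x₀ h)
    · simp only [Finset.mem_filter, Finset.mem_univ, true_and, not_not]
      field_simp [hdx₀.ne]
      ring

/-- A linear functional on the distributions with prescribed expectations of `k` statistics is made
no larger by passing to a suitable distribution with at most `k + 1` support points. -/
theorem IsProb.exists_card_support_le {𝒳 : Type*} [Fintype 𝒳] {k : ℕ} (f : 𝒳 → Fin k → ℝ)
    (c : 𝒳 → ℝ) {u : 𝒳 → ℝ} (hu : IsProb u) :
    ∃ p : 𝒳 → ℝ, IsProb p ∧ (∀ i, ∑ x, p x * f x i = ∑ x, u x * f x i) ∧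
      ∑ x, p x * c x ≤ ∑ x, u x * c x ∧
      (Finset.univ.filter fun x => p x ≠ 0).card ≤ k + 1 := by
  induction hn : (Finset.univ.filter fun x => u x ≠ 0).card using Nat.strong_induction_on
    generalizing u with
  | _ n ih =>
    rcases le_or_gt n (k + 1) with hle | hlt
    · exact ⟨u, hu, fun _ => rfl, le_rfl, hn.trans_le hle⟩
    · obtain ⟨d, hdS, hd0, hdf, hdc, hne⟩ :=
        exists_affine_dependence f c (Finset.univ.filter fun x => u x ≠ 0) (hn ▸ hlt)
      obtain ⟨t, ht, hnn, hcard⟩ :=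
        exists_smaller_support hu.1 (fun x hx => hdS x (by simpa using hx)) hd0 hne
      have hsum : ∀ a : 𝒳 → ℝ,
          ∑ x, (u x + t * d x) * a x = ∑ x, u x * a x + t * ∑ x, d x * a x := fun a => by
        rw [Finset.mul_sum, ← Finset.sum_add_distrib]
        exact Finset.sum_congr rfl fun x _ => by ring
      have hprob : IsProb fun x => u x + t * d x :=
        ⟨hnn, by rw [Finset.sum_add_distrib, ← Finset.mul_sum, hd0, hu.2, mul_zero, add_zero]⟩
      obtain ⟨p, hp, hpf, hpc, hps⟩ := ih _ (hn ▸ hcard) hprob rfl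
      refine ⟨p, hp, fun i => ?_, hpc.trans ?_, hps⟩
      · rw [hpf, hsum fun x => f x i, hdf, mul_zero, add_zero]
      · rw [hsum]
        linarith [mul_nonpos_of_nonneg_of_nonpos ht hdc]

/-- The entropy of a distribution is at most the logarithm of the size of its support. -/
theorem IsProb.neg_log_le_sum_mul_log {𝒳 : Type*} [Fintype 𝒳] {p : 𝒳 → ℝ} (hp : IsProb p) {n : ℝ}
    (hn : 0 < n) (hcard : ((Finset.univ.filter fun x => p x ≠ 0).card : ℝ) ≤ n) :
    -Real.log n ≤ ∑ x, p x * Real.log (p x) := by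
  have key : ∀ x, p x - (if p x ≠ 0 then 1 / n else 0) ≤
      p x * Real.log (p x) + p x * Real.log n := fun x => by
    by_cases hx : p x = 0
    · simp [hx]
    · have hpx : 0 < p x := lt_of_le_of_ne (hp.1 x) (Ne.symm hx)
      have h := mul_le_mul_of_nonneg_left
        (Real.one_sub_inv_le_log_of_pos (mul_pos hpx hn)) hpx.le
      rw [Real.log_mul hx hn.ne'] at h
      have h' : p x * (1 - (p x * n)⁻¹) = p x - 1 / n := by field_simp
      simp only [ne_eq, hx, not_false_eq_true, if_true]
      linarith
  have hle := Finset.sum_le_sum fun x (_ : x ∈ Finset.univ) => key x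
  rw [Finset.sum_sub_distrib, Finset.sum_add_distrib, ← Finset.sum_mul, hp.2, ← Finset.sum_filter,
    Finset.sum_const, nsmul_eq_mul, mul_one_div] at hle
  have : ((Finset.univ.filter fun x => p x ≠ 0).card : ℝ) / n ≤ 1 := (div_le_one hn).2 hcard
  linarith

/-- Gibbs' inequality for the uniform distribution. -/
theorem sum_log_le_neg_log_card {𝒳 : Type*} [Fintype 𝒳] [Nonempty 𝒳] {q : 𝒳 → ℝ}
    (hq : ∀ x, 0 < q x) (hsum : ∑ x, q x = 1) :
    ∑ x, (Fintype.card 𝒳 : ℝ)⁻¹ * Real.log (q x) ≤ -Real.log (Fintype.card 𝒳) := by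
  have hN : (0 : ℝ) < Fintype.card 𝒳 := by exact_mod_cast Fintype.card_pos
  have key : ∀ x, (Fintype.card 𝒳 : ℝ)⁻¹ * Real.log (q x) ≤
      q x - (Fintype.card 𝒳 : ℝ)⁻¹ - (Fintype.card 𝒳 : ℝ)⁻¹ * Real.log (Fintype.card 𝒳) :=
    fun x => by
      have h := mul_le_mul_of_nonneg_left
        (Real.log_le_sub_one_of_pos (mul_pos hN (hq x))) (inv_pos.2 hN).le
      rw [Real.log_mul hN.ne' (hq x).ne', mul_sub, inv_mul_cancel_left₀ hN.ne'] at h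
      linarith
  refine (Finset.sum_le_sum fun x _ => key x).trans_eq ?_
  simp only [Finset.sum_sub_distrib, hsum, Finset.sum_const, Finset.card_univ, nsmul_eq_mul]
  field_simp
  ring

/-- any $k$-dimensional exponential family satisfies
$D_ℰ ≥ \log N - \log(k+1)$. -/
theorem maxDiv_expFamily_ge (𝒳 : Type) [Fintype 𝒳] [Nonempty 𝒳] (k : ℕ)
    (ν : 𝒳 → ℝ) (hν : IsProb ν) (hνpos : ∀ x, 0 < ν x) (f : 𝒳 → Fin k → ℝ) :
    ((Real.log (Fintype.card 𝒳 : ℝ) - Real.log ((k : ℝ) + 1) : ℝ) : EReal) ≤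
      maxDiv (expFamily ν f) := by
  classical
  set N : ℝ := (Fintype.card 𝒳 : ℝ) with hNdef
  have hN : 0 < N := by rw [hNdef]; exact_mod_cast Fintype.card_pos
  have hu : IsProb fun _ : 𝒳 => N⁻¹ :=
    ⟨fun _ => (inv_pos.2 hN).le, by simp [← hNdef, hN.ne']⟩
  obtain ⟨p, hp, hpf, hpc, hps⟩ := hu.exists_card_support_le f fun x => Real.log (ν x)
  refine le_iSup₂_of_le p hp (le_iInf₂ fun q hq => ?_)
  obtain ⟨θ, hθ⟩ := hq
  set Z : ℝ := ∑ y, ν y * Real.exp (∑ i, θ i * f y i)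
  have hZ : 0 < Z :=
    Finset.sum_pos (fun y _ => mul_pos (hνpos y) (Real.exp_pos _)) Finset.univ_nonempty
  have hqpos : ∀ x, 0 < q x := fun x => by
    rw [hθ]; exact div_pos (mul_pos (hνpos x) (Real.exp_pos _)) hZ
  have hqsum : ∑ x, q x = 1 := by
    simp only [hθ]
    rw [← Finset.sum_div, div_self hZ.ne']
  have hlog : ∀ x, Real.log (q x) = Real.log (ν x) + ∑ i, θ i * f x i - Real.log Z := fun x => by
    rw [hθ, Real.log_div (mul_pos (hνpos x) (Real.exp_pos _)).ne' hZ.ne',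
      Real.log_mul (hνpos x).ne' (Real.exp_pos _).ne', Real.log_exp]
  have hcross : ∀ r : 𝒳 → ℝ, IsProb r → ∑ x, r x * Real.log (q x) =
      ∑ x, r x * Real.log (ν x) + ∑ i, θ i * ∑ x, r x * f x i - Real.log Z := fun r hr => by
    have hswap : ∑ i, θ i * ∑ x, r x * f x i = ∑ x, r x * ∑ i, θ i * f x i := by
      simp only [Finset.mul_sum]
      rw [Finset.sum_comm]
      exact Finset.sum_congr rfl fun x _ => Finset.sum_congr rfl fun i _ => by ring
    simp only [hlog, mul_sub, mul_add]
    rw [Finset.sum_sub_distrib, Finset.sum_add_distrib, ← Finset.sum_mul, hr.2, one_mul, hswap]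
  have hcross_le : ∑ x, p x * Real.log (q x) ≤ -Real.log N := by
    refine le_trans ?_ (sum_log_le_neg_log_card hqpos hqsum)
    rw [hcross p hp, hcross _ hu]
    simp only [hpf]
    linarith
  have hent : -Real.log ((k : ℝ) + 1) ≤ ∑ x, p x * Real.log (p x) :=
    hp.neg_log_le_sum_mul_log (by positivity) (by exact_mod_cast hps)
  have hsplit : ∑ x, p x * Real.log (p x / q x) =
      ∑ x, p x * Real.log (p x) - ∑ x, p x * Real.log (q x) := by
    rw [← Finset.sum_sub_distrib]
    refine Finset.sum_congr rfl fun x _ => ?_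
    by_cases hx : p x = 0
    · simp [hx]
    · rw [Real.log_div hx (hqpos x).ne', mul_sub]
  rw [KL, if_pos fun x _ => (hqpos x).ne', EReal.coe_le_coe_iff, hsplit]
  linarith
end

section
/- Given any finite set of probability distributions {p^{(1)},…,p^{(K)}} ⊆ Δ_{N−1}, there exist a two-dimensional exponential family ℰ ⊆ Δ_{K−1} (i.e., an exponential family with a sufficient statistic f : [K] → ℝ²) and a linear map ψ : ℝ^K → ℝ^N mapping Δ_{K−1} into Δ_{N−1}, such that the image ψ(cl(ℰ)) of the closure of ℰ contains all of p^{(1)},…,p^{(K)}. -/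
open scoped BigOperators

open Filter Topology in
/-- The Gibbs weights of an energy with a unique maximizer `j` converge to the point mass at `j`
as the inverse temperature tends to infinity. -/
theorem tendsto_exp_mul_div_sum_exp_mul {ι : Type*} [Fintype ι] [DecidableEq ι] (a : ι → ℝ) (j : ι)
    (h : ∀ x, x ≠ j → a x < a j) :
    Tendsto (fun t : ℝ => fun x => Real.exp (t * a x) / ∑ y, Real.exp (t * a y)) atTop
      (𝓝 (Pi.single j 1)) := by
  have hexp (x : ι) : Tendsto (fun t : ℝ => Real.exp (t * (a x - a j))) atTop
      (𝓝 ((Pi.single j 1 : ι → ℝ) x)) := by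
    by_cases hx : x = j
    · subst hx
      simp
    · rw [Pi.single_eq_of_ne hx]
      exact Real.tendsto_exp_atBot.comp
        (tendsto_id.atTop_mul_const_of_neg (sub_neg.2 (h x hx)))
  have hsum : Tendsto (fun t : ℝ => ∑ y, Real.exp (t * (a y - a j))) atTop (𝓝 1) := by
    simpa using tendsto_finsetSum Finset.univ fun y _ => hexp y
  refine tendsto_pi_nhds.2 fun x => ?_
  have hdiv := (hexp x).div hsum one_ne_zero
  rw [div_one] at hdiv
  refine hdiv.congr fun t => ?_
  simp only [Pi.div_apply, mul_sub, Real.exp_sub, ← Finset.sum_div]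
  exact div_div_div_cancel_right₀ (Real.exp_pos _).ne' _ _

/-- A convex combination of probability distributions is a probability distribution. -/
theorem IsProb.linearCombination {ι 𝒳 : Type*} [Fintype ι] [Fintype 𝒳] {p : ι → 𝒳 → ℝ}
    (hp : ∀ j, IsProb (p j)) {q : ι → ℝ} (hq : IsProb q) :
    IsProb (Fintype.linearCombination ℝ p q) := by
  simp only [IsProb, Fintype.linearCombination_apply, Finset.sum_apply, Pi.smul_apply, smul_eq_mul]
  refine ⟨fun x => Finset.sum_nonneg fun j _ => mul_nonneg (hq.1 j) ((hp j).1 x), ?_⟩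
  rw [Finset.sum_comm]
  simp only [← Finset.mul_sum, (hp _).2, mul_one, hq.2]

/-- any finite set of distributions $\{p^{(i)}\}_{i=1}^K ⊆ Δ_{N-1}$ is
contained in the image, under a linear map $ψ$ sending $Δ_{K-1}$ into $Δ_{N-1}$, of the
closure of a two-dimensional exponential family $ℰ ⊆ Δ_{K-1}$. -/
theorem finite_set_in_image_of_two_dim_expFamily (N K : ℕ)
    (p : Fin K → (Fin N → ℝ)) (hp : ∀ j, IsProb (p j)) :
    ∃ (f : Fin K → Fin 2 → ℝ) (ψ : (Fin K → ℝ) →ₗ[ℝ] (Fin N → ℝ)),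
      (∀ q : Fin K → ℝ, IsProb q → IsProb (ψ q)) ∧
      ∀ j : Fin K, p j ∈ ψ '' closure {q : Fin K → ℝ | ∃ θ : Fin 2 → ℝ, ∀ x, q x =
        Real.exp (∑ i, θ i * f x i) / ∑ y : Fin K, Real.exp (∑ i, θ i * f y i)} := by
  refine ⟨fun x => ![(x : ℝ), -(x : ℝ) ^ 2], Fintype.linearCombination ℝ p,
    fun q hq => IsProb.linearCombination hp hq, fun j => ⟨Pi.single j 1, ?_, by simp⟩⟩
  have hmax (x : Fin K) (hx : x ≠ j) :
      2 * (j : ℝ) * x - (x : ℝ) ^ 2 < 2 * (j : ℝ) * j - (j : ℝ) ^ 2 := by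
    have hne : (x : ℝ) - j ≠ 0 := sub_ne_zero.2 fun h => hx (Fin.ext (Nat.cast_injective h))
    linarith [sq_pos_of_ne_zero hne, sub_sq (x : ℝ) j]
  refine mem_closure_of_tendsto (tendsto_exp_mul_div_sum_exp_mul
    (fun x : Fin K => 2 * (j : ℝ) * x - (x : ℝ) ^ 2) j hmax) (.of_forall fun t => ?_)
  have hexponent (x : Fin K) : ∑ i, (![2 * t * j, t] : Fin 2 → ℝ) i *
      (![(x : ℝ), -(x : ℝ) ^ 2] : Fin 2 → ℝ) i = t * (2 * (j : ℝ) * x - (x : ℝ) ^ 2) := by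
    simp only [Fin.sum_univ_two, Matrix.cons_val_zero, Matrix.cons_val_one]
    ring
  exact ⟨![2 * t * j, t], fun x => by simp only [hexponent]⟩
end

section
/- The maximal information divergence from the multinomial model with n trials and q categories (q ≥ 2) equals (n−1)·log(q). -/
open scoped BigOperators

/-- A multinomial coefficient times one of its nonzero lower entries is at least the upper entry. -/
theorem sum_le_multinomial_mul {ι : Type*} [Fintype ι] (f : ι → ℕ) (i : ι) (hi : f i ≠ 0) :
    ∑ j, f j ≤ Nat.multinomial Finset.univ f * f i := by
  classical
  have h := Nat.multinomial_insert (Finset.notMem_erase i Finset.univ) f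
  rw [Finset.insert_erase (Finset.mem_univ i), Finset.add_sum_erase _ _ (Finset.mem_univ i)] at h
  have hpos : 1 ≤ Nat.multinomial (Finset.univ.erase i) f := Nat.multinomial_pos _ _
  have hle : f i ≤ ∑ j, f j := Finset.single_le_sum (fun _ _ => Nat.zero_le _) (Finset.mem_univ i)
  rw [h]
  obtain ⟨k, hk⟩ := Nat.exists_eq_succ_of_ne_zero hi
  obtain ⟨m, hm⟩ := Nat.exists_eq_succ_of_ne_zero (by omega : ∑ j, f j ≠ 0)
  rw [hm, hk] at hle ⊢
  have hc : 1 ≤ m.choose k := Nat.choose_pos (by omega)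
  have hs : m.succ * m.choose k = m.succ.choose k.succ * k.succ := Nat.add_one_mul_choose_eq m k
  calc m.succ = m.succ * 1 * 1 := by ring
    _ ≤ m.succ * m.choose k * Nat.multinomial (Finset.univ.erase i) f := by gcongr
    _ = _ := by rw [hs]; ring

/-- The Shannon entropy of a distribution on `ι` is at most `log |ι|`. -/
theorem neg_log_card_le_sum_mul_log {ι : Type*} [Fintype ι] (θ : ι → ℝ) (h0 : ∀ i, 0 ≤ θ i)
    (h1 : ∑ i, θ i = 1) (hq : 0 < Fintype.card ι) :
    -Real.log (Fintype.card ι) ≤ ∑ i, θ i * Real.log (θ i) := by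
  have hc : (0 : ℝ) < Fintype.card ι := by exact_mod_cast hq
  have key : ∀ i, θ i - 1 / Fintype.card ι - θ i * Real.log (Fintype.card ι)
      ≤ θ i * Real.log (θ i) := by
    intro i
    rcases (h0 i).eq_or_lt with h | h
    · rw [← h]
      have : 0 < 1 / (Fintype.card ι : ℝ) := by positivity
      linarith
    · have hl := Real.log_le_sub_one_of_pos (inv_pos.2 (mul_pos hc h))
      rw [Real.log_inv, Real.log_mul hc.ne' h.ne'] at hl
      have := mul_le_mul_of_nonneg_left hl h.le
      have e : θ i * ((Fintype.card ι * θ i)⁻¹ - 1) = 1 / Fintype.card ι - θ i := by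
        field_simp
      linarith
  have hs := Finset.sum_le_sum (s := Finset.univ) fun i _ => key i
  simp only [Finset.sum_sub_distrib, ← Finset.sum_mul, h1, Finset.sum_const, Finset.card_univ,
    nsmul_eq_mul] at hs
  rw [mul_one_div_cancel hc.ne'] at hs
  linarith

theorem sum_log_le_neg_card_mul_log {ι : Type*} [Fintype ι] (θ : ι → ℝ) (h0 : ∀ i, 0 < θ i)
    (h1 : ∑ i, θ i = 1) (hq : 0 < Fintype.card ι) :
    ∑ i, Real.log (θ i) ≤ -(Fintype.card ι * Real.log (Fintype.card ι)) := by
  have hc : (0 : ℝ) < Fintype.card ι := by exact_mod_cast hq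
  have hs := Finset.sum_le_sum (s := Finset.univ) fun i _ =>
    Real.log_le_sub_one_of_pos (mul_pos hc (h0 i))
  simp only [Real.log_mul hc.ne' (h0 _).ne', Finset.sum_add_distrib, Finset.sum_sub_distrib,
    ← Finset.mul_sum, h1, Finset.sum_const, Finset.card_univ, nsmul_eq_mul] at hs
  linarith

/-- Every distribution on compositions has divergence at most `(n - 1) log q` from the multinomial
distribution whose parameter is its normalized mean. -/
theorem exists_multinomial_KL_le (n q : ℕ) (hn : 1 ≤ n) (hq : 2 ≤ q)
    (p : {f : Fin q → Fin (n + 1) // ∑ i, (f i : ℕ) = n} → ℝ) (hp : IsProb p) :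
    ∃ θ : Fin q → ℝ, (∀ i, 0 ≤ θ i) ∧ ∑ i, θ i = 1 ∧
      KL p (fun x => (Nat.multinomial Finset.univ (fun i => (x.1 i : ℕ)) : ℝ) *
          ∏ i, θ i ^ (x.1 i : ℕ)) ≤ ((((n : ℝ) - 1) * Real.log q : ℝ) : EReal) := by
  obtain ⟨hp0, hp1⟩ := hp
  have hn0 : (0 : ℝ) < n := by exact_mod_cast hn
  have hn1 : (1 : ℝ) ≤ n := by exact_mod_cast hn
  set M : {f : Fin q → Fin (n + 1) // ∑ i, (f i : ℕ) = n} → ℝ :=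
    fun x => (Nat.multinomial Finset.univ (fun i => (x.1 i : ℕ)) : ℝ) with hM
  have hMpos : ∀ x, 0 < M x := fun x =>
    Nat.cast_pos.2 (Nat.multinomial_pos Finset.univ (fun i => (x.1 i : ℕ)))
  have hsum : ∀ x : {f : Fin q → Fin (n + 1) // ∑ i, (f i : ℕ) = n},
      ∑ i, ((x.1 i : ℕ) : ℝ) = n := fun x => by exact_mod_cast x.2
  set θ : Fin q → ℝ := fun i => ∑ x, p x * ((x.1 i : ℕ) : ℝ) / n with hθ
  have hθ0 : ∀ i, 0 ≤ θ i := fun i =>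
    Finset.sum_nonneg fun x _ => div_nonneg (mul_nonneg (hp0 x) (Nat.cast_nonneg _)) hn0.le
  have hθ1 : ∑ i, θ i = 1 := by
    rw [hθ, Finset.sum_comm]
    simp only [← Finset.sum_div, ← Finset.mul_sum, hsum]
    rw [← Finset.sum_mul, hp1, one_mul, div_self hn0.ne']
  have hle : ∀ x i, (x.1 i : ℕ) ≠ 0 → p x / M x ≤ θ i := by
    intro x i hi
    have h1 := sum_le_multinomial_mul (fun i => (x.1 i : ℕ)) i hi
    rw [x.2] at h1
    have h2 : (n : ℝ) ≤ M x * ((x.1 i : ℕ) : ℝ) := by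
      simp only [hM]
      exact_mod_cast h1
    calc p x / M x ≤ p x * ((x.1 i : ℕ) : ℝ) / n := by
          rw [div_le_div_iff₀ (hMpos x) hn0]
          nlinarith [mul_le_mul_of_nonneg_left h2 (hp0 x)]
      _ ≤ θ i := Finset.single_le_sum
          (f := fun x : {f : Fin q → Fin (n + 1) // ∑ i, (f i : ℕ) = n} =>
            p x * ((x.1 i : ℕ) : ℝ) / n)
          (fun x _ => div_nonneg (mul_nonneg (hp0 x) (Nat.cast_nonneg _)) hn0.le)
          (Finset.mem_univ x)
  have hprod : ∀ x, p x ≠ 0 → ∀ i, θ i ^ (x.1 i : ℕ) ≠ 0 := by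
    intro x hx i
    by_cases hi : (x.1 i : ℕ) = 0
    · simp [hi]
    · have : 0 < p x / M x := div_pos ((hp0 x).lt_of_ne' hx) (hMpos x)
      exact pow_ne_zero _ (this.trans_le (hle x i hi)).ne'
  refine ⟨θ, hθ0, hθ1, ?_⟩
  rw [KL, if_pos fun x hx =>
    mul_ne_zero (hMpos x).ne' (Finset.prod_ne_zero_iff.2 fun i _ => hprod x hx i),
    EReal.coe_le_coe_iff]
  have hterm : ∀ x, p x * Real.log (p x / (M x * ∏ i, θ i ^ (x.1 i : ℕ))) ≤
      -(n - 1) * ∑ i, p x * ((x.1 i : ℕ) : ℝ) / n * Real.log (θ i) := by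
    intro x
    by_cases hx : p x = 0
    · simp [hx]
    have hpx : 0 < p x := (hp0 x).lt_of_ne' hx
    have hlog : Real.log (p x / (M x * ∏ i, θ i ^ (x.1 i : ℕ))) =
        Real.log (p x / M x) - ∑ i, ((x.1 i : ℕ) : ℝ) * Real.log (θ i) := by
      rw [← div_div, Real.log_div (div_pos hpx (hMpos x)).ne'
        (Finset.prod_ne_zero_iff.2 fun i _ => hprod x hx i),
        Real.log_prod fun i _ => hprod x hx i]
      simp only [Real.log_pow]
    have hmean : n * Real.log (p x / M x) ≤ ∑ i, ((x.1 i : ℕ) : ℝ) * Real.log (θ i) := by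
      rw [← hsum x, Finset.sum_mul]
      refine Finset.sum_le_sum fun i _ => ?_
      by_cases hi : (x.1 i : ℕ) = 0
      · simp [hi]
      · exact mul_le_mul_of_nonneg_left
          (Real.log_le_log (div_pos hpx (hMpos x)) (hle x i hi)) (Nat.cast_nonneg _)
    have hre : ∑ i, p x * ((x.1 i : ℕ) : ℝ) / n * Real.log (θ i) =
        p x / n * ∑ i, ((x.1 i : ℕ) : ℝ) * Real.log (θ i) := by
      rw [Finset.mul_sum]
      exact Finset.sum_congr rfl fun i _ => by ring
    rw [hlog, hre]
    set S := ∑ i, ((x.1 i : ℕ) : ℝ) * Real.log (θ i)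
    have h2 : Real.log (p x / M x) ≤ S / n := by
      rw [le_div_iff₀ hn0]
      linarith
    calc p x * (Real.log (p x / M x) - S) ≤ p x * (S / n - S) := by gcongr
      _ = -(n - 1) * (p x / n * S) := by field_simp; ring
  have hent := neg_log_card_le_sum_mul_log θ hθ0 hθ1 (by rw [Fintype.card_fin]; omega)
  rw [Fintype.card_fin] at hent
  calc _ ≤ ∑ x, -((n : ℝ) - 1) * ∑ i, p x * ((x.1 i : ℕ) : ℝ) / n * Real.log (θ i) :=
        Finset.sum_le_sum fun x _ => hterm x
    _ = -((n : ℝ) - 1) * ∑ i, θ i * Real.log (θ i) := by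
        rw [← Finset.mul_sum, Finset.sum_comm]
        simp only [hθ, Finset.sum_mul]
    _ ≤ (n - 1) * Real.log q := by nlinarith

/-- The composition of `n` concentrated in the category `i`. -/
def vertexComposition (n q : ℕ) (i : Fin q) :
    {f : Fin q → Fin (n + 1) // ∑ i, (f i : ℕ) = n} :=
  ⟨fun j => if j = i then Fin.last n else 0, by simp [apply_ite]⟩

theorem vertexComposition_apply (n q : ℕ) (i j : Fin q) :
    (((vertexComposition n q i).1 j : Fin (n + 1)) : ℕ) = if j = i then n else 0 := by
  unfold vertexComposition
  split_ifs with h <;> simp [h]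

theorem vertexComposition_injective (n q : ℕ) (hn : 1 ≤ n) :
    Function.Injective (vertexComposition n q) := by
  intro i j h
  by_contra hij
  have h1 := vertexComposition_apply n q i i
  rw [h, vertexComposition_apply, if_neg hij, if_pos rfl] at h1
  omega

theorem multinomial_vertexComposition (n q : ℕ) (i : Fin q) :
    Nat.multinomial Finset.univ (fun j => ((vertexComposition n q i).1 j : ℕ)) = 1 := by
  simp only [vertexComposition_apply, Nat.multinomial, Finset.sum_ite_eq', Finset.mem_univ,
    if_true, apply_ite Nat.factorial, Nat.factorial_zero, Finset.prod_ite_eq']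
  exact Nat.div_self (Nat.factorial_pos n)

/-- The uniform distribution on the compositions concentrated in a single category. -/
noncomputable def uniformVertex (n q : ℕ) :
    {f : Fin q → Fin (n + 1) // ∑ i, (f i : ℕ) = n} → ℝ :=
  fun x => ∑ i, if x = vertexComposition n q i then 1 / (q : ℝ) else 0

theorem sum_uniformVertex_mul (n q : ℕ)
    (g : {f : Fin q → Fin (n + 1) // ∑ i, (f i : ℕ) = n} → ℝ) :
    ∑ x, uniformVertex n q x * g x = ∑ i, 1 / (q : ℝ) * g (vertexComposition n q i) := by
  simp only [uniformVertex, Finset.sum_mul]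
  rw [Finset.sum_comm]
  simp [ite_mul]

theorem uniformVertex_vertexComposition (n q : ℕ) (hn : 1 ≤ n) (i : Fin q) :
    uniformVertex n q (vertexComposition n q i) = 1 / q := by
  simp [uniformVertex, (vertexComposition_injective n q hn).eq_iff]

theorem isProb_uniformVertex (n q : ℕ) (hq : q ≠ 0) : IsProb (uniformVertex n q) := by
  refine ⟨fun x => Finset.sum_nonneg fun i _ => ?_, ?_⟩
  · split_ifs <;> positivity
  · have h := sum_uniformVertex_mul n q fun _ => 1
    have : (q : ℝ) ≠ 0 := by exact_mod_cast hq
    simpa [this] using h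

theorem le_KL_uniformVertex (n q : ℕ) (hn : 1 ≤ n) (hq : 2 ≤ q)
    (r : {f : Fin q → Fin (n + 1) // ∑ i, (f i : ℕ) = n} → ℝ) (θ : Fin q → ℝ)
    (h0 : ∀ i, 0 ≤ θ i) (h1 : ∑ i, θ i = 1)
    (hr : ∀ x, r x = (Nat.multinomial Finset.univ (fun i => (x.1 i : ℕ)) : ℝ) *
      ∏ i, θ i ^ (x.1 i : ℕ)) :
    ((((n : ℝ) - 1) * Real.log q : ℝ) : EReal) ≤ KL (uniformVertex n q) r := by
  have hq0 : (0 : ℝ) < q := by exact_mod_cast (by omega : 0 < q)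
  have hrv : ∀ i, r (vertexComposition n q i) = θ i ^ n := by
    intro i
    rw [hr, multinomial_vertexComposition]
    simp only [vertexComposition_apply, pow_ite, pow_zero, Finset.prod_ite_eq', Finset.mem_univ,
      if_true, Nat.cast_one, one_mul]
  rw [KL]
  split_ifs with hsupp
  · have hpos : ∀ i, 0 < θ i := by
      intro i
      have h := hsupp (vertexComposition n q i) (by
        rw [uniformVertex_vertexComposition n q hn]; positivity)
      rw [hrv] at h
      exact (h0 i).lt_of_ne' fun h' => h (by rw [h', zero_pow (by omega)])
    rw [EReal.coe_le_coe_iff, sum_uniformVertex_mul]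
    have hlog : ∀ i, Real.log (1 / q / θ i ^ n) = -Real.log q - n * Real.log (θ i) := by
      intro i
      rw [Real.log_div (by positivity) (pow_pos (hpos i) n).ne', Real.log_pow, one_div,
        Real.log_inv]
    simp only [uniformVertex_vertexComposition n q hn, hrv, hlog]
    rw [← Finset.mul_sum, Finset.sum_sub_distrib, ← Finset.mul_sum, Finset.sum_const,
      Finset.card_univ, Fintype.card_fin, nsmul_eq_mul, one_div, inv_mul_eq_div,
      le_div_iff₀ hq0]
    have hs := sum_log_le_neg_card_mul_log θ hpos h1 (by rw [Fintype.card_fin]; omega)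
    rw [Fintype.card_fin] at hs
    have := mul_le_mul_of_nonneg_left hs (Nat.cast_nonneg (α := ℝ) n)
    linarith
  · exact le_top

/-- the maximal divergence from the multinomial model with $n$ trials and
$q$ categories equals $(n-1)\log q$. The sample space is the set of compositions of $n$
into $q$ nonnegative parts. -/
theorem maxDiv_multinomial (n q : ℕ) (hn : 1 ≤ n) (hq : 2 ≤ q) :
    maxDiv {p : {f : Fin q → Fin (n + 1) // ∑ i, (f i : ℕ) = n} → ℝ |
      ∃ θ : Fin q → ℝ, (∀ i, 0 ≤ θ i) ∧ ∑ i, θ i = 1 ∧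
        ∀ x, p x = (Nat.multinomial Finset.univ (fun i => (x.1 i : ℕ)) : ℝ) *
          ∏ i, θ i ^ (x.1 i : ℕ)} =
      ((((n : ℝ) - 1) * Real.log q : ℝ) : EReal) := by
  apply le_antisymm
  · refine iSup₂_le fun p hp => ?_
    obtain ⟨θ, h0, h1, hle⟩ := exists_multinomial_KL_le n q hn hq p hp
    exact iInf₂_le_of_le _ ⟨θ, h0, h1, fun _ => rfl⟩ hle
  · refine le_iSup₂_of_le (uniformVertex n q) (isProb_uniformVertex n q (by omega)) ?_
    refine le_iInf₂ fun r hr => ?_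
    obtain ⟨θ, h0, h1, hr⟩ := hr
    exact le_KL_uniformVertex n q hn hq r θ h0 h1 hr
end

section
/- For any 0 ≤ k ≤ m, the closure of the binary restricted Boltzmann machine model RBM_{n,m} contains every mixture of: one arbitrary product distribution on {0,1}^n, m−k product distributions with mutually disjoint supports (also disjoint from each other), and k distributions supported on arbitrary edges of the n-cube (an edge being a pair of binary vectors differing in exactly one coordinate). In particular, the closure of RBM_{n,m} contains UMPD_{n,m+1}, the union over all cubical partitions ϱ of {0,1}^n into m+1 blocks of the mixtures of products with disjoint supports MPD_ϱ. -/
open scoped BigOperators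

/-- The binary restricted Boltzmann machine model $RBM_{n,m}$. -/
def binRBM (n m : ℕ) : Set ((Fin n → Fin 2) → ℝ) :=
  {p | ∃ (W : Fin n → Fin m → ℝ) (b : Fin n → ℝ) (c : Fin m → ℝ),
    ∀ x, p x =
      (∑ h : Fin m → Fin 2, Real.exp ((∑ i, ∑ j, W i j * ((x i : ℕ) : ℝ) * ((h j : ℕ) : ℝ)) +
        (∑ i, b i * ((x i : ℕ) : ℝ)) + (∑ j, c j * ((h j : ℕ) : ℝ)))) /
      (∑ x' : Fin n → Fin 2, ∑ h : Fin m → Fin 2,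
        Real.exp ((∑ i, ∑ j, W i j * ((x' i : ℕ) : ℝ) * ((h j : ℕ) : ℝ)) +
        (∑ i, b i * ((x' i : ℕ) : ℝ)) + (∑ j, c j * ((h j : ℕ) : ℝ))))}

/-- Product distributions on $\{0,1\}^n$. -/
def binProd (n : ℕ) : Set ((Fin n → Fin 2) → ℝ) :=
  {p | ∃ f : Fin n → Fin 2 → ℝ, (∀ i, IsProb (f i)) ∧ ∀ x, p x = ∏ i, f i (x i)}

/-- The mixture of a family of models. -/
def mixtureFam {𝒳 : Type*} [Fintype 𝒳] {k : ℕ} (M : Fin k → Set (𝒳 → ℝ)) :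
    Set (𝒳 → ℝ) :=
  {p | ∃ (l : Fin k → ℝ) (f : Fin k → 𝒳 → ℝ),
    (∀ i, 0 ≤ l i) ∧ ∑ i, l i = 1 ∧ (∀ i, f i ∈ M i) ∧ ∀ x, p x = ∑ i, l i * f i x}

/-- Product distributions on $\{0,1\}^n$ with support exactly the cubical set
$Y_1 × ⋯ × Y_n$. -/
def binProductOn (n : ℕ) (Y : Fin n → Finset (Fin 2)) : Set ((Fin n → Fin 2) → ℝ) :=
  {p | ∃ f : Fin n → Fin 2 → ℝ,
    (∀ j, (∀ y, 0 ≤ f j y) ∧ ∑ y, f j y = 1 ∧ ∀ y, (f j y ≠ 0 ↔ y ∈ Y j)) ∧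
    ∀ x, p x = ∏ j, f j (x j)}

/-- $UMPD_{n,k}$: union over all cubical partitions of $\{0,1\}^n$ with $k$ blocks of the
mixtures of products with disjoint supports. -/
def UMPD (n k : ℕ) : Set ((Fin n → Fin 2) → ℝ) :=
  {p | ∃ Y : Fin k → Fin n → Finset (Fin 2),
    (∀ x : Fin n → Fin 2, ∃! i : Fin k, ∀ j, x j ∈ Y i j) ∧
    p ∈ mixtureFam fun i : Fin k => closure (binProductOn n (Y i))}

/-- Exponentials of affine functions on the `n`-cube. -/
def expAffine (n : ℕ) : Set ((Fin n → Fin 2) → ℝ) :=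
  {q | ∃ (a : ℝ) (b : Fin n → ℝ), ∀ x, q x = Real.exp (a + ∑ i, b i * ((x i : ℕ) : ℝ))}

/-- The unnormalized binary restricted Boltzmann machine, in factorized form. -/
def unnormRBM (n m : ℕ) : Set ((Fin n → Fin 2) → ℝ) :=
  {q | ∃ q₀ ∈ expAffine n, ∃ t : Fin m → (Fin n → Fin 2) → ℝ, (∀ j, t j ∈ expAffine n) ∧
    ∀ x, q x = q₀ x * ∏ j, (1 + t j x)}

theorem expAffine_pos {n : ℕ} {q : (Fin n → Fin 2) → ℝ} (hq : q ∈ expAffine n)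
    (x : Fin n → Fin 2) : 0 < q x := by
  obtain ⟨a, b, h⟩ := hq
  rw [h]
  exact Real.exp_pos _

theorem div_mem_expAffine {n : ℕ} {q r : (Fin n → Fin 2) → ℝ} (hq : q ∈ expAffine n)
    (hr : r ∈ expAffine n) : (fun x => q x / r x) ∈ expAffine n := by
  obtain ⟨a, b, h⟩ := hq
  obtain ⟨a', b', h'⟩ := hr
  refine ⟨a - a', fun i => b i - b' i, fun x => ?_⟩
  simp only [h, h', ← Real.exp_sub, sub_mul, Finset.sum_sub_distrib]
  congr 1
  ring

theorem unnormRBM_pos {n m : ℕ} {q : (Fin n → Fin 2) → ℝ} (hq : q ∈ unnormRBM n m)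
    (x : Fin n → Fin 2) : 0 < q x := by
  obtain ⟨q₀, h₀, t, ht, h⟩ := hq
  rw [h]
  exact mul_pos (expAffine_pos h₀ x)
    (Finset.prod_pos fun j _ => add_pos one_pos (expAffine_pos (ht j) x))

/-- Summing out the hidden units factorizes the joint weight. -/
theorem sum_exp_hidden {n m : ℕ} (W : Fin n → Fin m → ℝ) (b : Fin n → ℝ) (c : Fin m → ℝ)
    (x : Fin n → Fin 2) :
    ∑ h : Fin m → Fin 2, Real.exp ((∑ i, ∑ j, W i j * ((x i : ℕ) : ℝ) * ((h j : ℕ) : ℝ)) +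
        (∑ i, b i * ((x i : ℕ) : ℝ)) + (∑ j, c j * ((h j : ℕ) : ℝ))) =
      Real.exp (∑ i, b i * ((x i : ℕ) : ℝ)) *
        ∏ j, (1 + Real.exp (c j + ∑ i, W i j * ((x i : ℕ) : ℝ))) := by
  have key : ∀ j, 1 + Real.exp (c j + ∑ i, W i j * ((x i : ℕ) : ℝ)) =
      ∑ s : Fin 2, Real.exp ((c j + ∑ i, W i j * ((x i : ℕ) : ℝ)) * ((s : ℕ) : ℝ)) := by
    intro j
    simp [Fin.sum_univ_two]
  simp only [key]
  rw [Fintype.prod_sum, Finset.mul_sum]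
  refine Finset.sum_congr rfl fun h _ => ?_
  rw [← Real.exp_sum, ← Real.exp_add, Finset.sum_comm]
  congr 1
  simp only [add_mul, Finset.sum_mul, Finset.sum_add_distrib]
  ring

theorem normalize_mem_binRBM {n m : ℕ} {q : (Fin n → Fin 2) → ℝ} (hq : q ∈ unnormRBM n m) :
    (fun x => q x / ∑ x', q x') ∈ binRBM n m := by
  obtain ⟨q₀, ⟨a, b, hab⟩, t, ht, h⟩ := hq
  choose c w hcw using ht
  refine ⟨fun i j => w j i, b, c, fun x => ?_⟩
  have hq : ∀ x, q x = Real.exp a * (Real.exp (∑ i, b i * ((x i : ℕ) : ℝ)) *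
      ∏ j, (1 + Real.exp (c j + ∑ i, w j i * ((x i : ℕ) : ℝ)))) := by
    intro x
    rw [h, hab, Real.exp_add, mul_assoc]
    simp only [hcw]
  simp only [sum_exp_hidden, hq]
  rw [← Finset.mul_sum, mul_div_mul_left _ _ (Real.exp_pos a).ne']

theorem mem_closure_binRBM {n m : ℕ} {p : (Fin n → Fin 2) → ℝ}
    (hp : p ∈ closure (unnormRBM n m)) (hsum : ∑ x, p x = 1) : p ∈ closure (binRBM n m) := by
  have hc : ContinuousAt (fun (q : (Fin n → Fin 2) → ℝ) x => q x / ∑ x', q x') p := by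
    refine continuousAt_pi.2 fun x => ContinuousAt.div
      (continuous_apply x).continuousAt
      (continuous_finsetSum _ fun i _ => continuous_apply i).continuousAt ?_
    simp [hsum]
  have h := mem_closure_image hc hp
  simp only [hsum, div_one] at h
  refine closure_mono ?_ h
  rintro _ ⟨q, hq, rfl⟩
  exact normalize_mem_binRBM hq

theorem prod_mem_expAffine {n : ℕ} {c : ℝ} (hc : 0 < c) {g : Fin n → Fin 2 → ℝ}
    (hg : ∀ i s, 0 < g i s) : (fun x => c * ∏ i, g i (x i)) ∈ expAffine n := by
  refine ⟨Real.log c + ∑ i, Real.log (g i 0),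
    fun i => Real.log (g i 1) - Real.log (g i 0), fun x => ?_⟩
  rw [add_assoc, ← Finset.sum_add_distrib, Real.exp_add, Real.exp_log hc, Real.exp_sum]
  refine congrArg (c * ·) ?_
  refine Finset.prod_congr rfl fun i _ => ?_
  have h2 : ∀ s : Fin 2, g i s = Real.exp (Real.log (g i 0) +
      (Real.log (g i 1) - Real.log (g i 0)) * ((s : ℕ) : ℝ)) := by
    intro s
    fin_cases s <;> simp [Real.exp_log (hg i _)]
  exact h2 (x i)

theorem prod_mem_closure_expAffine {n : ℕ} {c : ℝ} (hc : 0 ≤ c) {g : Fin n → Fin 2 → ℝ}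
    (hg : ∀ i s, 0 ≤ g i s) : (fun x => c * ∏ i, g i (x i)) ∈ closure (expAffine n) := by
  have hcont : Continuous fun (ε : ℝ) (x : Fin n → Fin 2) => (c + ε) * ∏ i, (g i (x i) + ε) := by
    fun_prop
  have h0 : (0 : ℝ) ∈ closure (Set.Ioi 0) := by simp
  have h := map_mem_closure hcont h0 (t := expAffine n) fun ε hε =>
    prod_mem_expAffine (g := fun i s => g i s + ε) (add_pos_of_nonneg_of_pos hc hε)
      fun i s => add_pos_of_nonneg_of_pos (hg i s) hε
  simpa using h

theorem smul_binProd_mem_closure_expAffine {n : ℕ} {p : (Fin n → Fin 2) → ℝ}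
    (hp : p ∈ binProd n) {c : ℝ} (hc : 0 ≤ c) :
    (fun x => c * p x) ∈ closure (expAffine n) := by
  obtain ⟨f, hf, h⟩ := hp
  simp only [h]
  exact prod_mem_closure_expAffine hc fun i => (hf i).1

/-- A nonnegative function supported on an edge of the cube is a product function. -/
theorem edge_mem_closure_expAffine {n : ℕ} {e : (Fin n → Fin 2) → ℝ} (he : ∀ z, 0 ≤ e z)
    {x y : Fin n → Fin 2} {j₀ : Fin n} (hxy : ∀ j, j ≠ j₀ → x j = y j)
    (hsupp : ∀ z, e z ≠ 0 → z = x ∨ z = y) : e ∈ closure (expAffine n) := by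
  have h := prod_mem_closure_expAffine (n := n) zero_le_one
    (g := fun i s => if i = j₀ then e (Function.update x j₀ s) else if s = x i then 1 else 0)
    (by intro i s; split_ifs <;> simp [he])
  convert h using 1
  funext z
  rw [one_mul]
  by_cases hz : ∀ j, j ≠ j₀ → z j = x j
  · rw [Finset.prod_eq_single j₀]
    · have : Function.update x j₀ (z j₀) = z := by
        funext j
        by_cases hj : j = j₀
        · subst hj; simp
        · simp [hj, hz j hj]
      simp [this]
    · intro j _ hj
      simp [hj, hz j hj]
    · simp
  · push Not at hz
    obtain ⟨j, hj, hne⟩ := hz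
    rw [Finset.prod_eq_zero (Finset.mem_univ j) (by simp [hj, hne])]
    by_contra h0
    rcases hsupp z h0 with rfl | rfl
    · exact hne rfl
    · exact hne (hxy j hj).symm

theorem add_edge_mem_closure_unnormRBM {n m : ℕ} {q : (Fin n → Fin 2) → ℝ}
    (hq : q ∈ closure (unnormRBM n m)) {e : (Fin n → Fin 2) → ℝ} (he : ∀ z, 0 ≤ e z)
    {x y : Fin n → Fin 2} {j₀ : Fin n} (hxy : ∀ j, j ≠ j₀ → x j = y j)
    (hsupp : ∀ z, e z ≠ 0 → z = x ∨ z = y) :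
    (fun z => q z + e z) ∈ closure (unnormRBM n (m + 1)) := by
  have hcont : Continuous fun (q : (Fin n → Fin 2) → ℝ) z => q z + e z := by fun_prop
  rw [← closure_closure]
  refine map_mem_closure hcont hq fun q hq => ?_
  have hpos := unnormRBM_pos hq
  have hc' : Continuous fun (t : (Fin n → Fin 2) → ℝ) z => q z * (1 + t z) := by fun_prop
  have hmem : (fun z => e z / q z) ∈ closure (expAffine n) :=
    edge_mem_closure_expAffine (fun z => div_nonneg (he z) (hpos z).le) hxy
      fun z hz => hsupp z fun h => hz (by simp [h])
  have h := map_mem_closure hc' hmem (t := unnormRBM n (m + 1)) ?_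
  · convert h using 1
    funext z
    have := (hpos z).ne'
    field_simp
  · intro s hs
    obtain ⟨q₀, h₀, t, ht, h⟩ := hq
    refine ⟨q₀, h₀, Fin.snoc t s, fun j => ?_, fun z => ?_⟩
    · refine Fin.lastCases ?_ (fun j => ?_) j
      · simpa using hs
      · simpa using ht j
    · simp [Fin.prod_univ_castSucc, h, mul_assoc]

theorem add_edges_mem_closure_unnormRBM {n m k : ℕ} {q : (Fin n → Fin 2) → ℝ}
    (hq : q ∈ closure (unnormRBM n m)) {e : Fin k → (Fin n → Fin 2) → ℝ}
    (he : ∀ i z, 0 ≤ e i z)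
    (hedge : ∀ i, ∃ x y : Fin n → Fin 2, (∃ j₀ : Fin n, ∀ j, j ≠ j₀ → x j = y j) ∧
      ∀ z, e i z ≠ 0 → z = x ∨ z = y) :
    (fun z => q z + ∑ i, e i z) ∈ closure (unnormRBM n (m + k)) := by
  induction k with
  | zero => simpa using hq
  | succ k ih =>
    obtain ⟨x, y, ⟨j₀, hxy⟩, hsupp⟩ := hedge (Fin.last k)
    have h := add_edge_mem_closure_unnormRBM
      (ih (e := fun i => e i.castSucc) (fun i => he _) fun i => hedge _) (he _) hxy hsupp
    simpa only [Fin.sum_univ_castSucc, add_assoc] using h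

theorem prod_one_add_of_disjoint {ι : Type*} (s : Finset ι) {t : ι → ℝ}
    (h : ∀ i j, i ≠ j → t i = 0 ∨ t j = 0) : ∏ i ∈ s, (1 + t i) = 1 + ∑ i ∈ s, t i := by
  by_cases hz : ∀ i, t i = 0
  · simp [hz]
  · push Not at hz
    obtain ⟨i, hi⟩ := hz
    have h0 : ∀ j, j ≠ i → t j = 0 := fun j hj => (h j i hj).resolve_right hi
    by_cases his : i ∈ s
    · rw [Finset.prod_eq_single_of_mem i his fun j _ hj => by simp [h0 j hj],
        Finset.sum_eq_single_of_mem i his fun j _ hj => h0 j hj]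
    · have h1 : ∀ j ∈ s, t j = 0 := fun j hj => h0 j fun hji => his (hji ▸ hj)
      rw [Finset.sum_eq_zero h1, Finset.prod_eq_one fun j hj => by simp [h1 j hj], add_zero]

theorem add_disjoint_mem_closure_unnormRBM {n r : ℕ} {q : (Fin n → Fin 2) → ℝ}
    (hq : q ∈ closure (expAffine n)) {Q : Fin r → (Fin n → Fin 2) → ℝ}
    (hQ : ∀ i, Q i ∈ closure (expAffine n))
    (hdisj : ∀ i i', i ≠ i' → ∀ x, Q i x = 0 ∨ Q i' x = 0) :
    (fun x => q x + ∑ i, Q i x) ∈ closure (unnormRBM n r) := by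
  have hcont : Continuous fun (q : (Fin n → Fin 2) → ℝ) z => q z + ∑ i, Q i z := by fun_prop
  rw [← closure_closure]
  refine map_mem_closure hcont hq fun q hq => ?_
  have hc' : Continuous fun (R : Fin r → (Fin n → Fin 2) → ℝ) x =>
      q x * ∏ i, (1 + R i x / q x) := by
    simp only [div_eq_mul_inv]
    fun_prop
  have hmem : Q ∈ closure (Set.univ.pi fun _ : Fin r => expAffine n) := by
    rw [closure_pi_set]
    exact fun i _ => hQ i
  have h := map_mem_closure hc' hmem (t := unnormRBM n r) fun R hR =>
    ⟨q, hq, fun i x => R i x / q x, fun i => div_mem_expAffine (hR i trivial) hq, fun _ => rfl⟩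
  convert h using 1
  funext x
  have hne := (expAffine_pos hq x).ne'
  rw [prod_one_add_of_disjoint, ← Finset.sum_div]
  · field_simp
  · intro i j hij
    rcases hdisj i j hij x with h | h <;> simp [h]

theorem binProd_sum_eq_one {n : ℕ} {p : (Fin n → Fin 2) → ℝ} (hp : p ∈ binProd n) :
    ∑ x, p x = 1 := by
  obtain ⟨f, hf, h⟩ := hp
  simp only [h]
  rw [← Fintype.prod_sum]
  exact Finset.prod_eq_one fun i _ => (hf i).2

theorem binProductOn_subset_binProd (n : ℕ) (Y : Fin n → Finset (Fin 2)) :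
    binProductOn n Y ⊆ binProd n := by
  rintro p ⟨f, hf, h⟩
  exact ⟨f, fun j => ⟨(hf j).1, (hf j).2.1⟩, h⟩

theorem mem_of_binProductOn_ne_zero {n : ℕ} {Y : Fin n → Finset (Fin 2)}
    {p : (Fin n → Fin 2) → ℝ} (hp : p ∈ binProductOn n Y) {x : Fin n → Fin 2} (hx : p x ≠ 0)
    (j : Fin n) : x j ∈ Y j := by
  obtain ⟨f, hf, h⟩ := hp
  rw [h, Finset.prod_ne_zero_iff] at hx
  exact ((hf j).2.2 _).1 (hx j (Finset.mem_univ j))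

theorem mixture_mem_closure_binRBM {n m k : ℕ} (hk : k ≤ m)
    {p0 : (Fin n → Fin 2) → ℝ} (hp0 : p0 ∈ binProd n)
    {P : Fin (m - k) → (Fin n → Fin 2) → ℝ} (hP : ∀ i, P i ∈ binProd n)
    (hdisj : ∀ i i' : Fin (m - k), i ≠ i' → ∀ x, P i x = 0 ∨ P i' x = 0)
    {E : Fin k → (Fin n → Fin 2) → ℝ}
    (hE : ∀ i, IsProb (E i) ∧ ∃ x y : Fin n → Fin 2,
      (∃ j₀ : Fin n, ∀ j, j ≠ j₀ → x j = y j) ∧ ∀ z, E i z ≠ 0 → z = x ∨ z = y)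
    {l0 : ℝ} {l1 : Fin (m - k) → ℝ} {l2 : Fin k → ℝ}
    (hl0 : 0 ≤ l0) (hl1 : ∀ i, 0 ≤ l1 i) (hl2 : ∀ i, 0 ≤ l2 i)
    (hsum : l0 + ∑ i, l1 i + ∑ i, l2 i = 1) :
    (fun x => l0 * p0 x + ∑ i, l1 i * P i x + ∑ i, l2 i * E i x) ∈ closure (binRBM n m) := by
  refine mem_closure_binRBM ?_ ?_
  · have h := add_edges_mem_closure_unnormRBM (e := fun i x => l2 i * E i x)
      (add_disjoint_mem_closure_unnormRBM (Q := fun i x => l1 i * P i x)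
        (smul_binProd_mem_closure_expAffine hp0 hl0)
        (fun i => smul_binProd_mem_closure_expAffine (hP i) (hl1 i))
        (fun i i' hi x => (hdisj i i' hi x).imp (by simp +contextual) (by simp +contextual)))
      (fun i z => mul_nonneg (hl2 i) ((hE i).1.1 z)) fun i => by
        obtain ⟨x, y, hxy, hs⟩ := (hE i).2
        exact ⟨x, y, hxy, fun z hz => hs z (right_ne_zero_of_mul hz)⟩
    rwa [Nat.sub_add_cancel hk] at h
  · rw [Finset.sum_add_distrib, Finset.sum_add_distrib, Finset.sum_comm,
      Finset.sum_comm (f := fun x i => l2 i * E i x)]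
    simp only [← Finset.mul_sum, binProd_sum_eq_one hp0, binProd_sum_eq_one (hP _), (hE _).1.2,
      mul_one, hsum]

theorem UMPD_subset_closure_binRBM (n m : ℕ) : UMPD n (m + 1) ⊆ closure (binRBM n m) := by
  rintro p ⟨Y, hY, l, f, hl, hsum, hf, hp⟩
  have hcont : Continuous fun (f : Fin (m + 1) → (Fin n → Fin 2) → ℝ) x =>
      ∑ i, l i * f i x := by fun_prop
  have hmem : f ∈ closure (Set.univ.pi fun i => binProductOn n (Y i)) := by
    rw [closure_pi_set]
    exact fun i _ => hf i
  rw [funext hp, ← closure_closure]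
  refine map_mem_closure hcont hmem fun f hf => ?_
  have hprod : ∀ i, f i ∈ binProd n := fun i => binProductOn_subset_binProd n _ (hf i trivial)
  have h := mixture_mem_closure_binRBM (m := m) (k := 0) (Nat.zero_le m) (hprod 0)
    (P := fun i => f (Fin.succ i)) (fun i => hprod _) ?_ (E := Fin.elim0) (fun i => i.elim0)
    (l1 := fun i => l (Fin.succ i)) (l2 := Fin.elim0) (hl 0) (fun i => hl _) (fun i => i.elim0)
    (by simpa [Fin.sum_univ_succ] using hsum)
  · simpa [Fin.sum_univ_succ] using h
  · intro i i' hi x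
    by_contra! hne
    exact hi (Fin.succ_injective _ ((hY x).unique
      (mem_of_binProductOn_ne_zero (hf _ trivial) hne.1)
      (mem_of_binProductOn_ne_zero (hf _ trivial) hne.2)))

/-- the closure of $RBM_{n,m}$ contains every mixture of one arbitrary
product distribution, $m-k$ product distributions with mutually disjoint supports, and
$k$ distributions supported on edges of the $n$-cube; in particular it contains
$UMPD_{n,m+1}$. -/
theorem binRBM_contains_mixtures (n m k : ℕ) (hk : k ≤ m)
    (p0 : (Fin n → Fin 2) → ℝ) (hp0 : p0 ∈ binProd n)
    (P : Fin (m - k) → (Fin n → Fin 2) → ℝ) (hP : ∀ i, P i ∈ binProd n)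
    (hdisj : ∀ i i' : Fin (m - k), i ≠ i' → ∀ x, P i x = 0 ∨ P i' x = 0)
    (E : Fin k → (Fin n → Fin 2) → ℝ)
    (hE : ∀ i, IsProb (E i) ∧ ∃ x y : Fin n → Fin 2,
      (∃ j₀ : Fin n, x j₀ ≠ y j₀ ∧ ∀ j, j ≠ j₀ → x j = y j) ∧
      ∀ z, E i z ≠ 0 → z = x ∨ z = y)
    (l0 : ℝ) (l1 : Fin (m - k) → ℝ) (l2 : Fin k → ℝ)
    (hl0 : 0 ≤ l0) (hl1 : ∀ i, 0 ≤ l1 i) (hl2 : ∀ i, 0 ≤ l2 i)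
    (hsum : l0 + ∑ i, l1 i + ∑ i, l2 i = 1) :
    (fun x => l0 * p0 x + ∑ i, l1 i * P i x + ∑ i, l2 i * E i x) ∈
      closure (binRBM n m) ∧
    UMPD n (m + 1) ⊆ closure (binRBM n m) := by
  refine ⟨mixture_mem_closure_binRBM hk hp0 hP hdisj (fun i => ?_) hl0 hl1 hl2 hsum,
    UMPD_subset_closure_binRBM n m⟩
  obtain ⟨h, x, y, ⟨j₀, _, hxy⟩, hs⟩ := hE i
  exact ⟨h, x, y, ⟨j₀, hxy⟩, hs⟩
end

section
/- Let L ∈ ℕ, let k be the largest integer for which L ≥ 1 + 2^{2^{k−1}}, and suppose K = 2^{k−1} + k ≤ n. Then the closure of the binary deep belief network model with L layers of width n contains every partition model 𝒫_ϱ whose partition has the form ϱ = { { x ∈ {0,1}^n : x_λ = y_λ } : y_λ ∈ {0,1}^K } for some coordinate subset λ ⊆ [n] with |λ| = K. -/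
open scoped BigOperators

/-! ### Affine functions on the cube and limits of sigmoid and exponential units -/

/-- Real functions on the cube of the form `z ↦ ∑ j, w j * z j + b`. -/
def IsAffineOnCube (n : ℕ) (g : (Fin n → Fin 2) → ℝ) : Prop :=
  ∃ (w : Fin n → ℝ) (b : ℝ), ∀ z, g z = ∑ j, w j * ((z j : ℕ) : ℝ) + b

namespace IsAffineOnCube

variable {n : ℕ}

lemma const (c : ℝ) : IsAffineOnCube n fun _ => c := ⟨0, c, by simp⟩

lemma coord (i : Fin n) : IsAffineOnCube n fun z => ((z i : ℕ) : ℝ) :=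
  ⟨Pi.single i 1, 0, fun z => by simp [Pi.single_apply]⟩

lemma add {f g : (Fin n → Fin 2) → ℝ} (hf : IsAffineOnCube n f) (hg : IsAffineOnCube n g) :
    IsAffineOnCube n fun z => f z + g z := by
  obtain ⟨w, b, h⟩ := hf
  obtain ⟨w', b', h'⟩ := hg
  refine ⟨w + w', b + b', fun z => ?_⟩
  simp only [h, h', Pi.add_apply, add_mul, Finset.sum_add_distrib]
  ring

lemma const_mul {f : (Fin n → Fin 2) → ℝ} (c : ℝ) (hf : IsAffineOnCube n f) :
    IsAffineOnCube n fun z => c * f z := by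
  obtain ⟨w, b, h⟩ := hf
  refine ⟨c • w, c * b, fun z => ?_⟩
  simp only [h, Pi.smul_apply, smul_eq_mul, mul_add, Finset.mul_sum, mul_assoc]

lemma sub {f g : (Fin n → Fin 2) → ℝ} (hf : IsAffineOnCube n f) (hg : IsAffineOnCube n g) :
    IsAffineOnCube n fun z => f z - g z := by
  simpa [sub_eq_add_neg] using hf.add (hg.const_mul (-1))

lemma sum {ι : Type*} (s : Finset ι) {f : ι → (Fin n → Fin 2) → ℝ}
    (hf : ∀ i, IsAffineOnCube n (f i)) : IsAffineOnCube n fun z => ∑ i ∈ s, f i z := by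
  classical
  induction s using Finset.induction_on with
  | empty => simpa using const 0
  | insert a s ha ih => simpa [Finset.sum_insert ha] using (hf a).add ih

end IsAffineOnCube

/-- The number of coordinates in `s` at which `z` and `c` differ. -/
def cubeDist {n : ℕ} (s : Finset (Fin n)) (c z : Fin n → Fin 2) : ℝ :=
  ∑ i ∈ s, if z i = c i then 0 else 1

section CubeDist

variable {n : ℕ} (s : Finset (Fin n)) (c z : Fin n → Fin 2)

lemma isAffineOnCube_cubeDist : IsAffineOnCube n (cubeDist s c) := by
  refine IsAffineOnCube.sum s fun i => ?_
  have h : ∀ x y : Fin 2, (if x = y then (0 : ℝ) else 1)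
      = ((y : ℕ) : ℝ) + (1 - 2 * ((y : ℕ) : ℝ)) * ((x : ℕ) : ℝ) := by
    intro x y
    fin_cases x <;> fin_cases y <;> norm_num
  simp only [h]
  exact (IsAffineOnCube.const _).add ((IsAffineOnCube.coord i).const_mul _)

lemma cubeDist_nonneg : 0 ≤ cubeDist s c z :=
  Finset.sum_nonneg fun i _ => by split_ifs <;> norm_num

lemma cubeDist_le : cubeDist s c z ≤ n := by
  calc cubeDist s c z ≤ ∑ _i ∈ s, (1 : ℝ) :=
        Finset.sum_le_sum fun i _ => by split_ifs <;> norm_num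
    _ = s.card := by simp
    _ ≤ n := by exact_mod_cast s.card_le_univ.trans_eq (Fintype.card_fin n)

lemma cubeDist_eq_zero_iff : cubeDist s c z = 0 ↔ ∀ i ∈ s, z i = c i := by
  rw [cubeDist, Finset.sum_eq_zero_iff_of_nonneg fun i _ => by split_ifs <;> norm_num]
  simp

end CubeDist

open Filter Topology in
lemma tendsto_affine_atTop {a b : ℝ} (hb : 0 < b) :
    Tendsto (fun N : ℕ => a + N * b) atTop atTop :=
  tendsto_atTop_add_const_left _ _ (tendsto_natCast_atTop_atTop.atTop_mul_const hb)

open Filter Topology in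
lemma tendsto_affine_atBot {a b : ℝ} (hb : b < 0) :
    Tendsto (fun N : ℕ => a + N * b) atTop atBot :=
  tendsto_atBot_add_const_left _ _ (tendsto_natCast_atTop_atTop.atTop_mul_const_of_neg hb)

/-- Activation probability functions of a single sigmoid unit with `n` inputs. -/
def sigmoidUnits (n : ℕ) : Set ((Fin n → Fin 2) → ℝ) :=
  {f | ∃ w b, ∀ z, f z = sigCond n w b 1 z}

/-- Exponentials of affine functions on the cube. -/
def expUnits (n : ℕ) : Set ((Fin n → Fin 2) → ℝ) :=
  {f | ∃ g, IsAffineOnCube n g ∧ ∀ z, f z = Real.exp (g z)}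

section Limits

open Filter Topology

variable {n : ℕ}

lemma sigmoid_comp_mem_sigmoidUnits {g : (Fin n → Fin 2) → ℝ} (hg : IsAffineOnCube n g) :
    (fun z => Real.sigmoid (g z)) ∈ sigmoidUnits n := by
  obtain ⟨w, b, h⟩ := hg
  refine ⟨w, b, fun z => ?_⟩
  simp only [sigCond, if_pos, h, Real.sigmoid_def, one_div, neg_add, sub_eq_add_neg]

lemma mem_closure_sigmoidUnits {g h f : (Fin n → Fin 2) → ℝ} (hg : IsAffineOnCube n g)
    (hh : IsAffineOnCube n h) (h_pos : ∀ z, 0 < g z → f z = 1) (h_neg : ∀ z, g z < 0 → f z = 0)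
    (h_zero : ∀ z, g z = 0 → f z = Real.sigmoid (h z)) : f ∈ closure (sigmoidUnits n) := by
  refine mem_closure_of_tendsto (f := fun N : ℕ => fun z => Real.sigmoid (h z + N * g z))
    (b := atTop) (tendsto_pi_nhds.2 fun z => ?_)
    (Eventually.of_forall fun N => sigmoid_comp_mem_sigmoidUnits (hh.add (hg.const_mul _)))
  rcases lt_trichotomy (g z) 0 with hz | hz | hz
  · rw [h_neg z hz]
    exact Real.tendsto_sigmoid_atBot.comp (tendsto_affine_atBot hz)
  · simp [h_zero z hz, hz]
  · rw [h_pos z hz]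
    exact Real.tendsto_sigmoid_atTop.comp (tendsto_affine_atTop hz)

lemma mem_closure_expUnits {g h f : (Fin n → Fin 2) → ℝ} (hg : IsAffineOnCube n g)
    (hh : IsAffineOnCube n h) (h_nonneg : ∀ z, 0 ≤ g z) (h_pos : ∀ z, 0 < g z → f z = 0)
    (h_zero : ∀ z, g z = 0 → f z = Real.exp (h z)) : f ∈ closure (expUnits n) := by
  refine mem_closure_of_tendsto (f := fun N : ℕ => fun z => Real.exp (h z + N * -g z))
    (b := atTop) (tendsto_pi_nhds.2 fun z => ?_)
    (Eventually.of_forall fun N => ⟨_, hh.add (IsAffineOnCube.const_mul N (f := fun z => -g z) (by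
      simpa using hg.const_mul (-1))), fun z => rfl⟩)
  rcases (h_nonneg z).eq_or_lt with hz | hz
  · simp [h_zero z hz.symm, ← hz]
  · rw [h_pos z hz]
    exact Real.tendsto_exp_atBot.comp (tendsto_affine_atBot (neg_lt_zero.2 hz))

lemma coord_mem_closure_sigmoidUnits (j : Fin n) :
    (fun z : Fin n → Fin 2 => ((z j : ℕ) : ℝ)) ∈ closure (sigmoidUnits n) := by
  have key : ∀ x : Fin 2, ((x : ℕ) : ℝ) = 0 ∨ ((x : ℕ) : ℝ) = 1 := by
    intro x; fin_cases x <;> simp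
  refine mem_closure_sigmoidUnits (((IsAffineOnCube.coord j).const_mul 2).sub
    (IsAffineOnCube.const 1)) (IsAffineOnCube.const 0) ?_ ?_ ?_ <;> intro z hz <;>
  rcases key (z j) with h | h <;> rw [h] at hz ⊢ <;> norm_num at hz

/-- A unit can copy the input coordinate `j` except on a cylinder set, where it is activated with
probabilities that depend on one further coordinate `l`. -/
lemma share_mem_closure_sigmoidUnits {s : Finset (Fin n)} {j l : Fin n} {c : Fin n → Fin 2}
    (hj : j ∈ s) (hc : c j = 0) {r : Fin 2 → ℝ} (hr : ∀ x, r x ∈ Set.Ioo (0 : ℝ) 1)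
    {f : (Fin n → Fin 2) → ℝ} (hf : ∀ z, (∀ i ∈ s, z i = c i) → f z = r (z l))
    (hf' : ∀ z, (¬ ∀ i ∈ s, z i = c i) → f z = ((z j : ℕ) : ℝ)) :
    f ∈ closure (sigmoidUnits n) := by
  choose t ht using fun x => (Real.range_sigmoid ▸ hr x : r x ∈ Set.range Real.sigmoid)
  have hval : ∀ x : Fin 2, x = 0 ∨ x = 1 := by decide
  have hmem : ∀ z : Fin n → Fin 2, (∀ i ∈ s, z i = c i) ↔
      z j = 0 ∧ cubeDist (s.erase j) c z = 0 := by
    intro z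
    rw [cubeDist_eq_zero_iff]
    refine ⟨fun h => ⟨(h j hj).trans hc, fun i hi => h i (Finset.mem_of_mem_erase hi)⟩,
      fun h i hi => ?_⟩
    by_cases hij : i = j
    · rw [hij, h.1, hc]
    · exact h.2 i (Finset.mem_erase.2 ⟨hij, hi⟩)
  have hpos : ∀ z : Fin n → Fin 2, z j = 1 →
      0 < ((n : ℝ) + 1) * ((z j : ℕ) : ℝ) - cubeDist (s.erase j) c z := by
    intro z hz
    have := cubeDist_le (s.erase j) c z
    simp only [hz, Fin.val_one, Nat.cast_one]
    linarith
  have hneg : ∀ z : Fin n → Fin 2, z j = 0 →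
      ((n : ℝ) + 1) * ((z j : ℕ) : ℝ) - cubeDist (s.erase j) c z ≤ 0 := by
    intro z hz
    have := cubeDist_nonneg (s.erase j) c z
    simp only [hz, Fin.val_zero, Nat.cast_zero]
    linarith
  refine mem_closure_sigmoidUnits (((IsAffineOnCube.coord j).const_mul ((n : ℝ) + 1)).sub
    (isAffineOnCube_cubeDist (s.erase j) c))
    ((IsAffineOnCube.const (t 0)).add ((IsAffineOnCube.coord l).const_mul (t 1 - t 0))) ?_ ?_ ?_
  · intro z hz
    rcases hval (z j) with h | h
    · exact absurd hz (hneg z h).not_gt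
    · rw [hf' z fun h' => by simp [hmem, h] at h', h]
      simp
  · intro z hz
    rcases hval (z j) with h | h
    · rw [hf' z fun h' => ?_, h]
      · simp
      · simp [((hmem z).1 h').2, h] at hz
    · exact absurd hz (hpos z h).not_gt
  · intro z hz
    rcases hval (z j) with h | h
    · rw [hf z ((hmem z).2 ⟨h, by simpa [h] using hz⟩), ← ht]
      rcases hval (z l) with h' | h' <;> simp [h']
    · exact absurd hz (hpos z h).ne'

lemma zero_mem_closure_expUnits : (0 : (Fin n → Fin 2) → ℝ) ∈ closure (expUnits n) :=
  mem_closure_expUnits (IsAffineOnCube.const 1) (IsAffineOnCube.const 0) (by simp) (by simp)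
    (by simp)

lemma cylinder_mem_closure_expUnits {s : Finset (Fin n)} {l : Fin n} {c : Fin n → Fin 2}
    {r : Fin 2 → ℝ} (hr : ∀ x, 0 < r x)
    {f : (Fin n → Fin 2) → ℝ} (hf : ∀ z, (∀ i ∈ s, z i = c i) → f z = r (z l))
    (hf' : ∀ z, (¬ ∀ i ∈ s, z i = c i) → f z = 0) :
    f ∈ closure (expUnits n) := by
  refine mem_closure_expUnits (isAffineOnCube_cubeDist s c)
    ((IsAffineOnCube.const (Real.log (r 0))).add
      ((IsAffineOnCube.coord l).const_mul (Real.log (r 1) - Real.log (r 0))))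
    (cubeDist_nonneg s c) ?_ ?_
  · intro z hz
    exact hf' z fun h => hz.ne' ((cubeDist_eq_zero_iff s c z).2 h)
  · intro z hz
    rw [hf z ((cubeDist_eq_zero_iff s c z).1 hz)]
    have hval : ∀ x : Fin 2, x = 0 ∨ x = 1 := by decide
    rcases hval (z l) with h | h <;> simp [h, Real.exp_log (hr _)]

end Limits

/-! ### Layerwise structure of deep belief networks -/

/-- The distribution obtained from `p` by resampling every unit `i` independently with activation
probability `F i z`, given the state `z`. -/
def pushUnits {n : ℕ} (F : Fin n → (Fin n → Fin 2) → ℝ) (p : (Fin n → Fin 2) → ℝ)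
    (x : Fin n → Fin 2) : ℝ :=
  ∑ z, (∏ i, if x i = 1 then F i z else 1 - F i z) * p z

lemma continuous_pushUnits (n : ℕ) :
    Continuous (Function.uncurry (pushUnits (n := n))) := by
  refine continuous_pi fun x => ?_
  simp only [Function.uncurry_def, pushUnits]
  refine continuous_finsetSum _ fun z _ => Continuous.mul (continuous_finsetProd _ fun i _ => ?_)
    (by fun_prop)
  split_ifs <;> fun_prop

lemma pushUnits_mem_binDBN {n L : ℕ} {F : Fin n → (Fin n → Fin 2) → ℝ}
    (hF : ∀ i, F i ∈ sigmoidUnits n) {p : (Fin n → Fin 2) → ℝ} (hp : p ∈ binDBN n L) :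
    pushUnits F p ∈ binDBN n (L + 1) := by
  choose w c hwc using hF
  obtain ⟨W, b, Wr, br, cr, hp⟩ := hp
  refine ⟨Fin.cons w W, Fin.cons c b, Wr, br, cr, fun v => ?_⟩
  rw [← (Fin.consEquiv fun _ : Fin (L + 3) => Fin n → Fin 2).sum_comp, Fintype.sum_prod_type,
    Finset.sum_eq_single v]
  · simp only [pushUnits, hp, Finset.mul_sum]
    rw [Finset.sum_comm]
    refine Finset.sum_congr rfl fun xs _ => ?_
    rw [Finset.sum_eq_single (xs 0)]
    · rw [if_pos rfl, if_pos (by simp [Fin.consEquiv])]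
      have hv : ∀ i, (if v i = 1 then F i (xs 0) else 1 - F i (xs 0)) =
          sigCond n (w i) (c i) (v i) (xs 0) := by
        intro i
        simp only [hwc, sigCond, if_true]
      simp only [hv]
      rw [Fin.prod_univ_succ, mul_left_comm]
      rfl
    · intro z _ hz
      simp [hz.symm]
    · simp
  · intro z _ hz
    refine Finset.sum_eq_zero fun xs _ => if_neg ?_
    simpa [Fin.consEquiv] using hz
  · simp

lemma pushUnits_mem_closure_binDBN {n L : ℕ} {F : Fin n → (Fin n → Fin 2) → ℝ}
    (hF : ∀ i, F i ∈ closure (sigmoidUnits n)) {p : (Fin n → Fin 2) → ℝ}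
    (hp : p ∈ closure (binDBN n L)) : pushUnits F p ∈ closure (binDBN n (L + 1)) := by
  have hF' : F ∈ closure (Set.pi Set.univ fun _ : Fin n => sigmoidUnits n) := by
    rw [closure_pi_set]
    exact fun i _ => hF i
  exact map_mem_closure₂ (continuous_pushUnits n) hF' hp
    fun G hG q hq => pushUnits_mem_binDBN (fun i => hG i trivial) hq

/-- Unnormalized visible marginal of a restricted Boltzmann machine. -/
lemma sum_binRBM_weights {n : ℕ} (W : Fin n → Fin n → ℝ) (b c : Fin n → ℝ)
    (v : Fin n → Fin 2) :
    ∑ h : Fin n → Fin 2, Real.exp ((∑ i, ∑ j, W i j * ((v i : ℕ) : ℝ) * ((h j : ℕ) : ℝ)) +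
      (∑ i, b i * ((v i : ℕ) : ℝ)) + (∑ j, c j * ((h j : ℕ) : ℝ))) =
    Real.exp (∑ i, b i * ((v i : ℕ) : ℝ)) *
      ∏ j, (1 + Real.exp (∑ i, W i j * ((v i : ℕ) : ℝ) + c j)) := by
  have hj : ∀ j, 1 + Real.exp (∑ i, W i j * ((v i : ℕ) : ℝ) + c j) =
      ∑ y : Fin 2, Real.exp ((∑ i, W i j * ((v i : ℕ) : ℝ) + c j) * ((y : ℕ) : ℝ)) := by
    intro j
    simp [Fin.sum_univ_two]
  simp only [hj]
  rw [Fintype.prod_sum, Finset.mul_sum]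
  refine Finset.sum_congr rfl fun h _ => ?_
  rw [← Real.exp_sum, ← Real.exp_add]
  congr 1
  simp only [add_mul, Finset.sum_add_distrib, Finset.sum_mul]
  rw [Finset.sum_comm]
  ring

lemma rbm_mem_binDBN_zero {n : ℕ} {E : (Fin n → Fin 2) → ℝ} {G : Fin n → (Fin n → Fin 2) → ℝ}
    (hE : E ∈ expUnits n) (hG : ∀ j, G j ∈ expUnits n) :
    (fun v => (E v * ∏ j, (1 + G j v)) / ∑ v', E v' * ∏ j, (1 + G j v')) ∈ binDBN n 0 := by
  obtain ⟨g, ⟨b, b0, hb⟩, hE⟩ := hE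
  choose γ hγ hG using hG
  choose W c hW using hγ
  refine ⟨Fin.elim0, Fin.elim0, fun i j => W j i, b, c, fun v => ?_⟩
  have hw : ∀ v, E v * ∏ j, (1 + G j v) = Real.exp b0 *
      ∑ h : Fin n → Fin 2, Real.exp ((∑ i, ∑ j, W j i * ((v i : ℕ) : ℝ) * ((h j : ℕ) : ℝ)) +
      (∑ i, b i * ((v i : ℕ) : ℝ)) + (∑ j, c j * ((h j : ℕ) : ℝ))) := by
    intro v
    rw [sum_binRBM_weights (fun i j => W j i), hE, hb, Real.exp_add]
    simp only [hG, hW]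
    ring
  simp only [hw]
  rw [← Finset.mul_sum, mul_div_mul_left _ _ (Real.exp_ne_zero _),
    ← (Fin.consEquiv fun _ : Fin 2 => Fin n → Fin 2).sum_comp, Fintype.sum_prod_type]
  symm
  refine (Finset.sum_eq_single v ?_ (by simp)).trans ?_
  · intro z _ hz
    refine Finset.sum_eq_zero fun xs _ => if_neg ?_
    simpa [Fin.consEquiv] using hz
  · rw [← (Equiv.funUnique (Fin 1) (Fin n → Fin 2)).symm.sum_comp, Finset.sum_div]
    refine Finset.sum_congr rfl fun h _ => ?_
    rw [if_pos (by simp [Fin.consEquiv]), Finset.univ_eq_empty, Finset.prod_empty, mul_one]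
    rfl

lemma rbm_mem_closure_binDBN_zero {n : ℕ} {E : (Fin n → Fin 2) → ℝ}
    {G : Fin n → (Fin n → Fin 2) → ℝ} (hE : E ∈ closure (expUnits n))
    (hG : ∀ j, G j ∈ closure (expUnits n)) (hZ : ∑ v, E v * ∏ j, (1 + G j v) ≠ 0) :
    (fun v => (E v * ∏ j, (1 + G j v)) / ∑ v', E v' * ∏ j, (1 + G j v')) ∈
      closure (binDBN n 0) := by
  let Φ : ((Fin n → Fin 2) → ℝ) × (Fin n → (Fin n → Fin 2) → ℝ) → (Fin n → Fin 2) → ℝ :=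
    fun q v => (q.1 v * ∏ j, (1 + q.2 j v)) / ∑ v', q.1 v' * ∏ j, (1 + q.2 j v')
  have hmem : (E, G) ∈ closure (expUnits n ×ˢ Set.pi Set.univ fun _ : Fin n => expUnits n) := by
    rw [closure_prod_eq, closure_pi_set]
    exact ⟨hE, fun j _ => hG j⟩
  have hcont : ContinuousAt Φ (E, G) := by
    refine continuousAt_pi.2 fun v => ContinuousAt.div ?_ ?_ hZ <;> fun_prop
  refine closure_mono (Set.image_subset_iff.2 ?_) (mem_closure_image hcont hmem)
  exact fun q hq => rbm_mem_binDBN_zero hq.1 fun j => hq.2 j trivial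
lemma prod_copy_units {n : ℕ} (x z : Fin n → Fin 2) :
    ∏ i, (if x i = 1 then ((z i : ℕ) : ℝ) else 1 - ((z i : ℕ) : ℝ)) = if x = z then 1 else 0 := by
  have h : ∀ a b : Fin 2, (if a = 1 then ((b : ℕ) : ℝ) else 1 - ((b : ℕ) : ℝ)) =
      if a = b then 1 else 0 := by
    intro a b
    fin_cases a <;> fin_cases b <;> simp
  simp only [h, Finset.prod_ite_zero, Finset.prod_const_one, funext_iff, Finset.mem_univ,
    true_imp_iff]

lemma prod_copy_units_except {n : ℕ} (x z : Fin n → Fin 2) (j : Fin n) (hz : z j = 0) (ρ : ℝ) :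
    ∏ i, (if x i = 1 then (if i = j then ρ else ((z i : ℕ) : ℝ))
        else 1 - (if i = j then ρ else ((z i : ℕ) : ℝ))) =
      (if x = z then 1 - ρ else 0) + (if x = Function.update z j 1 then ρ else 0) := by
  have hval : ∀ a : Fin 2, a = 0 ∨ a = 1 := by decide
  by_cases hx : ∃ i, i ≠ j ∧ x i ≠ z i
  · obtain ⟨i, hij, hi⟩ := hx
    rw [if_neg (fun h => hi (congrFun h i)), if_neg (fun h => hi (by simp [h, hij])), add_zero]
    refine Finset.prod_eq_zero (Finset.mem_univ i) ?_
    rw [if_neg hij]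
    rcases hval (x i) with h | h <;> rcases hval (z i) with h' | h' <;> simp_all
  · push Not at hx
    have hx' : x = Function.update z j (x j) := by
      ext1 i
      by_cases hij : i = j
      · simp [hij]
      · simp [hij, hx i hij]
    rw [Finset.prod_eq_single j]
    · have hne : Function.update z j 1 ≠ z := fun h => by simpa [hz] using congrFun h j
      rcases hval (x j) with h | h
      · have : x = z := by rw [hx', h, ← hz, Function.update_eq_self]
        simp [this, hz, hne.symm]
      · have : x = Function.update z j 1 := by rw [hx', h]
        simp [this, hne]
    · intro i _ hij
      rw [if_neg hij, hx i hij]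
      rcases hval (z i) with h | h <;> simp [h]
    · simp

lemma pushUnits_copy {n : ℕ} (p : (Fin n → Fin 2) → ℝ) :
    pushUnits (fun i z => ((z i : ℕ) : ℝ)) p = p := by
  ext x
  simp [pushUnits, prod_copy_units]

lemma closure_binDBN_mono_s17 {n : ℕ} : Monotone fun L => closure (binDBN n L) := by
  refine monotone_nat_of_le_succ fun L p hp => ?_
  have := pushUnits_mem_closure_binDBN (fun i => coord_mem_closure_sigmoidUnits i) hp
  rwa [pushUnits_copy] at this

/-! ### Addressed blocks of coordinates -/

/-- Labels of the distinguished coordinates: a block indexed by the addresses `Fin k → Fin 2`,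
the `k` address bits, and one further bit. -/
abbrev BlockCoord (k : ℕ) := (Fin k → Fin 2) ⊕ Fin k ⊕ Unit

section Block

variable {n k : ℕ} (e : BlockCoord k → Fin n)

/-- The address stored in the address bits of `z`. -/
def addr (z : Fin n → Fin 2) : Fin k → Fin 2 := fun i => z (e (.inr (.inl i)))

/-- The set of active block coordinates of `z`, relative to the address of `z`. -/
def block (z : Fin n → Fin 2) : Finset (Fin k → Fin 2) :=
  Finset.univ.filter fun a => z (e (.inl (a + addr e z))) = 1

/-- Flip the block coordinate of `z` at position `a` relative to the address of `z`. -/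
def toggle (a : Fin k → Fin 2) (z : Fin n → Fin 2) : Fin n → Fin 2 :=
  Function.update z (e (.inl (a + addr e z))) (z (e (.inl (a + addr e z))) + 1)

/-- The function `q` depends only on the distinguished coordinates. -/
def DependsOnBlock (q : (Fin n → Fin 2) → ℝ) : Prop :=
  ∀ x y : Fin n → Fin 2, (∀ c, x (e c) = y (e c)) → q x = q y

variable {e}

lemma mem_block {z : Fin n → Fin 2} {a : Fin k → Fin 2} :
    a ∈ block e z ↔ z (e (.inl (a + addr e z))) = 1 := by
  simp [block]

lemma addr_congr {x y : Fin n → Fin 2} (h : ∀ i, x (e (.inr (.inl i))) = y (e (.inr (.inl i)))) :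
    addr e x = addr e y := funext h

lemma block_congr {x y : Fin n → Fin 2}
    (h : ∀ c, c ≠ .inr (.inr ()) → x (e c) = y (e c)) : block e x = block e y := by
  ext a
  rw [mem_block, mem_block, addr_congr fun i => h _ (by simp), h _ (by simp)]

lemma toggle_congr (a : Fin k → Fin 2) {x y : Fin n → Fin 2} (h : ∀ c, x (e c) = y (e c))
    (c : BlockCoord k) : toggle e a x (e c) = toggle e a y (e c) := by
  have := addr_congr fun i => h (.inr (.inl i))
  simp only [toggle, this, Function.update_apply, h]

variable (he : Function.Injective e)
include he

lemma addr_toggle (a : Fin k → Fin 2) (z : Fin n → Fin 2) : addr e (toggle e a z) = addr e z := by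
  ext1 i
  simp [addr, toggle, he.eq_iff]

lemma toggle_toggle (a : Fin k → Fin 2) (z : Fin n → Fin 2) :
    toggle e a (toggle e a z) = z := by
  have h : ∀ x : Fin 2, x + 1 + 1 = x := by decide
  rw [toggle, addr_toggle he, toggle, Function.update_self, h, Function.update_idem,
    Function.update_eq_self]

lemma mem_block_toggle {a b : Fin k → Fin 2} {z : Fin n → Fin 2} :
    b ∈ block e (toggle e a z) ↔ (b = a ∧ a ∉ block e z) ∨ (b ≠ a ∧ b ∈ block e z) := by
  have h : ∀ x : Fin 2, x + 1 = 1 ↔ x ≠ 1 := by decide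
  rw [mem_block, addr_toggle he, mem_block, mem_block, toggle]
  by_cases hb : b = a
  · subst hb
    simp [h]
  · simp [hb, he.eq_iff]

lemma block_toggle_eq_insert_iff {a : Fin k → Fin 2} {u : Finset (Fin k → Fin 2)} (ha : a ∉ u)
    {z : Fin n → Fin 2} : block e (toggle e a z) = insert a u ↔ block e z = u := by
  simp only [Finset.ext_iff, mem_block_toggle he, Finset.mem_insert]
  refine forall_congr' fun b => ?_
  by_cases hb : b = a
  · subst hb
    simp [ha]
  · simp [hb]

/-- One layer of units that share probability mass between the states with block `u` and those
with block `insert a u`. -/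
lemma shareUnit_mem_closure {a : Fin k → Fin 2} {u : Finset (Fin k → Fin 2)} (ha : a ∉ u)
    {R : (Fin n → Fin 2) → ℝ} (hR : DependsOnBlock e R)
    (hR01 : ∀ z, block e z = u → R z ∈ Set.Ioo (0 : ℝ) 1) (i : Fin n) :
    (fun z => if block e z = u ∧ i = e (.inl (a + addr e z)) then R z else ((z i : ℕ) : ℝ)) ∈
      closure (sigmoidUnits n) := by
  by_cases hi : ∃ z, block e z = u ∧ i = e (.inl (a + addr e z))
  · obtain ⟨c, hc, rfl⟩ := hi
    have hmem : ∀ z : Fin n → Fin 2,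
        (∀ i ∈ (Finset.univ.erase (.inr (.inr ()))).image e, z i = c i) ↔
          ∀ d, d ≠ .inr (.inr ()) → z (e d) = c (e d) := by
      intro z
      simp only [Finset.forall_mem_image, Finset.mem_erase, Finset.mem_univ, and_true]
    have hupd : ∀ x d, d ≠ .inr (.inr ()) →
        Function.update c (e (.inr (.inr ()))) x (e d) = c (e d) := by
      intro x d hd
      rw [Function.update_of_ne (he.ne hd)]
    refine share_mem_closure_sigmoidUnits (l := e (.inr (.inr ()))) (c := c)
      (r := fun x => R (Function.update c (e (.inr (.inr ()))) x))
      (s := (Finset.univ.erase (.inr (.inr ()))).image e)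
      (j := e (.inl (a + addr e c))) (Finset.mem_image_of_mem e (by simp)) ?_ (fun x => hR01 _ ?_) ?_ ?_
    · have h : ∀ x : Fin 2, x ≠ 1 → x = 0 := by decide
      exact h _ fun h' => ha (hc ▸ mem_block.2 h')
    · rw [block_congr (hupd x), hc]
    · intro z hz
      rw [hmem] at hz
      rw [if_pos ⟨(block_congr hz).trans hc, by rw [addr_congr fun i => hz _ (by simp)]⟩]
      refine hR _ _ fun d => ?_
      by_cases hd : d = .inr (.inr ())
      · rw [hd, Function.update_self]
      · rw [hupd _ _ hd, hz d hd]
    · intro z hz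
      rw [hmem] at hz
      refine if_neg fun ⟨hb, hj⟩ => hz ?_
      have haddr : addr e z = addr e c := by simpa [he.eq_iff, eq_comm] using hj
      have h : ∀ x y : Fin 2, (x = 1 ↔ y = 1) → x = y := by decide
      rintro (b | i | ⟨⟩) hd
      · refine h _ _ ?_
        have := Finset.ext_iff.1 (hb.trans hc.symm) (b - addr e c)
        simpa [mem_block, haddr] using this
      · exact congrFun haddr i
      · exact absurd rfl hd
  · push Not at hi
    convert coord_mem_closure_sigmoidUnits i using 2 with z
    exact if_neg fun h => hi z h.1 h.2

lemma mem_closure_binDBN_succ_of_merge {L : ℕ} {a : Fin k → Fin 2} {u : Finset (Fin k → Fin 2)}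
    (ha : a ∉ u) {q : (Fin n → Fin 2) → ℝ} (hq : DependsOnBlock e q)
    (hpos : ∀ z, block e z = u ∨ block e z = insert a u → 0 < q z)
    (hmerge : (fun z => if block e z = insert a u then 0 else
      if block e z = u then q z + q (toggle e a z) else q z) ∈ closure (binDBN n L)) :
    q ∈ closure (binDBN n (L + 1)) := by
  have hne : u ≠ insert a u := fun h => ha (h ▸ Finset.mem_insert_self a u)
  have hpos' : ∀ z, block e z = u → 0 < q z ∧ 0 < q (toggle e a z) := fun z hz =>
    ⟨hpos z (.inl hz), hpos _ (.inr ((block_toggle_eq_insert_iff he ha).2 hz))⟩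
  convert pushUnits_mem_closure_binDBN (fun i => shareUnit_mem_closure he ha
    (R := fun z => q (toggle e a z) / (q z + q (toggle e a z))) ?_ ?_ i) hmerge using 1
  · ext x
    have hterm : ∀ z, (∏ i, if x i = 1 then
          (if block e z = u ∧ i = e (.inl (a + addr e z)) then
            q (toggle e a z) / (q z + q (toggle e a z)) else ((z i : ℕ) : ℝ))
          else 1 - (if block e z = u ∧ i = e (.inl (a + addr e z)) then
            q (toggle e a z) / (q z + q (toggle e a z)) else ((z i : ℕ) : ℝ))) *
        (if block e z = insert a u then 0 else
          if block e z = u then q z + q (toggle e a z) else q z) =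
        (if x = z then (if block e z = insert a u then 0 else q z) else 0) +
          (if toggle e a x = z then (if block e z = u then q (toggle e a z) else 0) else 0) := by
      intro z
      have htx : toggle e a x = z ↔ x = toggle e a z :=
        ⟨fun h => by rw [← h, toggle_toggle he], fun h => by rw [h, toggle_toggle he]⟩
      by_cases hz : block e z = u
      · obtain ⟨h1, h2⟩ := hpos' z hz
        have h3 : q z + q (toggle e a z) ≠ 0 := (add_pos h1 h2).ne'
        have h0 : z (e (.inl (a + addr e z))) = 0 := by
          have h : ∀ x : Fin 2, x ≠ 1 → x = 0 := by decide
          exact h _ fun h' => ha (hz ▸ mem_block.2 h')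
        have ht : Function.update z (e (.inl (a + addr e z))) 1 = toggle e a z := by
          rw [toggle, h0, zero_add]
        simp only [hz, true_and, if_true, if_neg hne]
        rw [prod_copy_units_except x z _ h0, ht, add_mul]
        simp only [htx]
        congr 1 <;> split_ifs <;> field_simp <;> ring
      · simp only [hz, false_and, if_false, prod_copy_units]
        split_ifs <;> simp
    simp only [pushUnits, hterm, Finset.sum_add_distrib, Finset.sum_ite_eq, Finset.mem_univ,
      if_true, toggle_toggle he]
    have : block e (toggle e a x) = u ↔ block e x = insert a u := by
      rw [← block_toggle_eq_insert_iff he ha, toggle_toggle he]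
    simp only [this]
    split_ifs <;> simp
  · intro x y h
    simp only [hq x y h, hq _ _ (toggle_congr a h)]
  · intro z hz
    obtain ⟨h1, h2⟩ := hpos' z hz
    exact ⟨by positivity, (div_lt_one (by positivity)).2 (by linarith)⟩

lemma isProb_merge {a : Fin k → Fin 2} {u : Finset (Fin k → Fin 2)} (ha : a ∉ u)
    {q : (Fin n → Fin 2) → ℝ} (hq : IsProb q) :
    IsProb fun z => if block e z = insert a u then 0 else
      if block e z = u then q z + q (toggle e a z) else q z := by
  have hne : u ≠ insert a u := fun h => ha (h ▸ Finset.mem_insert_self a u)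
  refine ⟨fun z => ?_, ?_⟩
  · have h1 := hq.1 z
    have h2 := hq.1 (toggle e a z)
    dsimp only
    split_ifs <;> positivity
  · have hsplit : ∀ z, (if block e z = insert a u then 0 else
        if block e z = u then q z + q (toggle e a z) else q z) =
        (if block e z = insert a u then 0 else q z) +
          if block e (toggle e a z) = insert a u then q (toggle e a z) else 0 := by
      intro z
      simp only [block_toggle_eq_insert_iff he ha]
      split_ifs with h1 h2 <;> simp_all
    have hinv : Function.Involutive (toggle e a) := toggle_toggle he a
    simp only [hsplit, Finset.sum_add_distrib]
    have hcomp : (∑ z, if block e (toggle e a z) = insert a u then q (toggle e a z) else 0) =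
        ∑ z, if block e z = insert a u then q z else 0 :=
      Equiv.sum_comp hinv.toPerm fun z => if block e z = insert a u then q z else 0
    rw [hcomp, ← Finset.sum_add_distrib, ← hq.2]
    refine Finset.sum_congr rfl fun z _ => ?_
    split_ifs <;> simp

/-- Distributions supported on the states with empty block are limits of restricted Boltzmann
machines. -/
lemma mem_closure_binDBN_zero {q : (Fin n → Fin 2) → ℝ} (hprob : IsProb q)
    (hq : DependsOnBlock e q) (hpos : ∀ z, block e z = ∅ → 0 < q z)
    (hzero : ∀ z, block e z ≠ ∅ → q z = 0) : q ∈ closure (binDBN n 0) := by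
  obtain ⟨C, hC0, hC⟩ : ∃ C : ℝ, 0 < C ∧ ∀ z, block e z = ∅ → 1 < C * q z := by
    have hinv : ∀ z, 0 ≤ (q z)⁻¹ := fun z => inv_nonneg.2 (hprob.1 z)
    refine ⟨1 + ∑ z, (q z)⁻¹, add_pos_of_pos_of_nonneg one_pos (Finset.sum_nonneg fun z _ => hinv z),
      fun z hz => ?_⟩
    have h1 := Finset.single_le_sum (fun z _ => hinv z) (Finset.mem_univ z)
    have h2 := mul_le_mul_of_nonneg_right h1 (hpos z hz).le
    rw [inv_mul_cancel₀ (hpos z hz).ne'] at h2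
    linarith [hpos z hz]
  have hblock : ∀ z, block e z = ∅ ↔ ∀ b, z (e (.inl b)) = 0 := by
    have h : ∀ x : Fin 2, x ≠ 1 ↔ x = 0 := by decide
    intro z
    simp only [Finset.eq_empty_iff_forall_notMem, mem_block, h]
    exact ⟨fun H b => by simpa using H (b - addr e z), fun H b => H _⟩
  let clear : (Fin n → Fin 2) → Fin n → Fin 2 := fun z i =>
    if i ∈ Finset.univ.image (e ∘ .inl) then 0 else z i
  have hclear_inl : ∀ z b, clear z (e (.inl b)) = 0 := fun z b =>
    if_pos (Finset.mem_image_of_mem _ (Finset.mem_univ b))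
  have hclear_inr : ∀ z b, clear z (e (.inr b)) = z (e (.inr b)) := fun z b =>
    if_neg (by simp [he.eq_iff])
  have hclear : ∀ z, block e (clear z) = ∅ := fun z => (hblock _).2 (hclear_inl z)
  let E : (Fin n → Fin 2) → ℝ := fun z => if block e z = ∅ then 1 else 0
  let G : Fin n → (Fin n → Fin 2) → ℝ := fun j z =>
    if j = e (.inl (addr e z)) then C * q (clear z) - 1 else 0
  have hE : E ∈ closure (expUnits n) := by
    refine cylinder_mem_closure_expUnits (s := Finset.univ.image (e ∘ .inl)) (c := 0)
      (l := e (.inr (.inr ()))) (r := 1) (fun _ => one_pos) (fun z hz => if_pos ?_)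
      fun z hz => if_neg ?_
    · simpa [hblock] using hz
    · simpa [hblock] using hz
  have hG : ∀ j, G j ∈ closure (expUnits n) := by
    intro j
    by_cases hj : ∃ z, j = e (.inl (addr e z))
    · obtain ⟨c, rfl⟩ := hj
      refine cylinder_mem_closure_expUnits (s := Finset.univ.image (e ∘ .inr ∘ .inl)) (c := c)
        (l := e (.inr (.inr ())))
        (r := fun x => C * q (clear (Function.update c (e (.inr (.inr ()))) x)) - 1)
        (fun x => sub_pos.2 (hC _ (hclear _))) (fun z hz => ?_) fun z hz => if_neg ?_
      · replace hz : ∀ i, z (e (.inr (.inl i))) = c (e (.inr (.inl i))) := by simpa using hz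
        simp only [G, addr_congr hz, if_true]
        congr 2
        refine hq _ _ ?_
        rintro (b | i | ⟨⟩)
        · rw [hclear_inl, hclear_inl]
        · rw [hclear_inr, hclear_inr, hz, Function.update_of_ne (he.ne (by simp))]
        · rw [hclear_inr, hclear_inr, Function.update_self]
      · contrapose! hz
        have haddr : addr e z = addr e c := by simpa [he.eq_iff, eq_comm] using hz
        simpa [addr] using fun i => congrFun haddr i
    · push Not at hj
      convert zero_mem_closure_expUnits (n := n) using 1
      ext z
      exact if_neg (hj z)
  have hEG : ∀ z, E z * ∏ j, (1 + G j z) = C * q z := by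
    intro z
    by_cases hz : block e z = ∅
    · have hqz : q (clear z) = q z := hq _ _ (by
        rintro (b | b)
        · rw [hclear_inl, (hblock z).1 hz]
        · exact hclear_inr z b)
      rw [Finset.prod_eq_single (e (.inl (addr e z)))]
      · simp [E, G, hz, hqz]
      · intro j _ hj
        simp [G, hj]
      · simp
    · simp [E, hz, hzero z hz]
  have hsum : ∑ v, E v * ∏ j, (1 + G j v) = C := by
    simp only [hEG, ← Finset.mul_sum, hprob.2, mul_one]
  convert rbm_mem_closure_binDBN_zero hE hG (hsum.trans_ne hC0.ne') using 1
  ext v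
  rw [hsum, hEG, mul_div_cancel_left₀ _ hC0.ne']

lemma mem_closure_binDBN_of_lowerSet {L : ℕ} {S : Finset (Finset (Fin k → Fin 2))}
    (hS : IsLowerSet (S : Set (Finset (Fin k → Fin 2)))) (hempty : ∅ ∈ S) (hcard : S.card ≤ L + 1)
    {q : (Fin n → Fin 2) → ℝ} (hprob : IsProb q) (hq : DependsOnBlock e q)
    (hpos : ∀ z, block e z ∈ S → 0 < q z) (hzero : ∀ z, block e z ∉ S → q z = 0) :
    q ∈ closure (binDBN n L) := by
  induction L generalizing S q with
  | zero =>
    have hS1 : S = {∅} := Finset.eq_singleton_iff_unique_mem.2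
      ⟨hempty, fun x hx => Finset.card_le_one.1 hcard x hx ∅ hempty⟩
    subst hS1
    exact mem_closure_binDBN_zero he hprob hq (fun z hz => hpos z (by simp [hz]))
      fun z hz => hzero z (by simp [hz])
  | succ L ih =>
    by_cases hle : S.card ≤ L + 1
    · exact closure_binDBN_mono_s17 (Nat.le_succ L) (ih hS hempty hle hprob hq hpos hzero)
    obtain ⟨v, hv, hmax⟩ := S.exists_max_image Finset.card ⟨∅, hempty⟩
    have hvne : v.Nonempty := by
      rw [Finset.nonempty_iff_ne_empty]
      rintro rfl
      have : S ⊆ {∅} := fun x hx => by simpa using hmax x hx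
      have := Finset.card_le_card this
      simp at this
      omega
    obtain ⟨a, hav⟩ := hvne
    obtain ⟨u, hau, rfl⟩ : ∃ u, a ∉ u ∧ insert a u = v :=
      ⟨v.erase a, Finset.notMem_erase a v, Finset.insert_erase hav⟩
    have hu : u ∈ S := hS (Finset.subset_insert a u) hv
    refine mem_closure_binDBN_succ_of_merge he hau hq
      (fun z hz => hpos z (by rcases hz with h | h <;> rw [h] <;> assumption))
      (ih (S := S.erase (insert a u)) ?_ ?_ ?_ (isProb_merge he hau hprob) ?_ ?_ ?_)
    · intro s t hts hs
      simp only [Finset.coe_erase, Set.mem_sdiff, Finset.mem_coe, Set.mem_singleton_iff] at hs ⊢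
      refine ⟨hS hts hs.1, ?_⟩
      rintro rfl
      exact hs.2 (Finset.eq_of_subset_of_card_le hts (hmax s hs.1)).symm
    · exact Finset.mem_erase.2 ⟨(Finset.insert_ne_empty a u).symm, hempty⟩
    · rw [Finset.card_erase_of_mem hv]
      omega
    · intro x y h
      simp only [block_congr fun c _ => h c, hq x y h, hq _ _ (toggle_congr a h)]
    · intro z hz
      rw [Finset.mem_erase] at hz
      rw [if_neg hz.1]
      have := hpos z hz.2
      split_ifs
      · exact add_pos_of_pos_of_nonneg this (hprob.1 _)
      · exact this
    · intro z hz
      split_ifs with h1 h2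
      · rfl
      · exact absurd (Finset.mem_erase.2 ⟨h1, h2 ▸ hu⟩) hz
      · exact hzero z fun h => hz (Finset.mem_erase.2 ⟨h1, h⟩)

lemma mem_closure_binDBN_of_dependsOnBlock {L : ℕ} (hL : 2 ^ 2 ^ k ≤ L + 1)
    {q : (Fin n → Fin 2) → ℝ} (hprob : IsProb q) (hq : DependsOnBlock e q)
    (hpos : ∀ z, 0 < q z) : q ∈ closure (binDBN n L) :=
  mem_closure_binDBN_of_lowerSet he (S := Finset.univ) (by simp [isLowerSet_univ])
    (Finset.mem_univ _) (by simpa using hL) hprob hq (fun z _ => hpos z) (by simp)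

end Block

open Filter Topology in
/-- A distribution is a limit of its mixtures with the uniform distribution. -/
lemma mem_closure_binDBN_of_mixtures {n L : ℕ} {p : (Fin n → Fin 2) → ℝ}
    (h : ∀ ε ∈ Set.Ioo (0 : ℝ) 1,
      (fun z => (1 - ε) * p z + ε * (Fintype.card (Fin n → Fin 2) : ℝ)⁻¹) ∈ closure (binDBN n L)) :
    p ∈ closure (binDBN n L) := by
  have hmem : ∀ᶠ ε : ℝ in 𝓝[>] 0, ε ∈ Set.Ioo (0 : ℝ) 1 := Ioo_mem_nhdsGT one_pos
  rw [← isClosed_closure.closure_eq]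
  refine mem_closure_of_tendsto (b := 𝓝[>] (0 : ℝ)) (tendsto_pi_nhds.2 fun z => ?_)
    (hmem.mono h)
  have : Continuous fun ε : ℝ => (1 - ε) * p z + ε * (Fintype.card (Fin n → Fin 2) : ℝ)⁻¹ := by
    fun_prop
  simpa using (this.tendsto 0).mono_left nhdsWithin_le_nhds

lemma isProb_mixture {n : ℕ} {p : (Fin n → Fin 2) → ℝ} (hp : IsProb p) {ε : ℝ}
    (hε : ε ∈ Set.Ioo (0 : ℝ) 1) :
    IsProb fun z => (1 - ε) * p z + ε * (Fintype.card (Fin n → Fin 2) : ℝ)⁻¹ := by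
  refine ⟨fun z => ?_, ?_⟩
  · have := mul_nonneg (sub_nonneg.2 hε.2.le) (hp.1 z)
    have := hε.1
    positivity
  · rw [Finset.sum_add_distrib, ← Finset.mul_sum, hp.2, Finset.sum_const, Finset.card_univ,
      nsmul_eq_mul]
    field_simp
    ring

/-- if $k$ is the largest integer with $L ≥ 1 + 2^{2^{k-1}}$ and
$K = 2^{k-1} + k ≤ n$, then the closure of the binary DBN with $L$ layers of width $n$
contains every partition model of a partition by the cylinder sets of $K$ coordinates. -/
theorem binDBN_contains_partitionModels (n L k : ℕ)
    (hk1 : 1 + 2 ^ (2 ^ (k - 1)) ≤ L)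
    (hk2 : ∀ k' : ℕ, 1 + 2 ^ (2 ^ (k' - 1)) ≤ L → k' ≤ k)
    (hK : 2 ^ (k - 1) + k ≤ n)
    (lam : Finset (Fin n)) (hlam : lam.card = 2 ^ (k - 1) + k)
    (p : (Fin n → Fin 2) → ℝ) (hp : IsProb p)
    (hconst : ∀ x y : Fin n → Fin 2, (∀ i ∈ lam, x i = y i) → p x = p y) :
    p ∈ closure (binDBN n (L - 2)) := by
  have hk : 1 ≤ k := by
    by_contra h
    obtain rfl : k = 0 := by omega
    exact h (hk2 1 (by simpa using hk1))
  obtain ⟨m, rfl⟩ : ∃ m, k = m + 1 := ⟨k - 1, by omega⟩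
  simp only [Nat.add_sub_cancel] at hk1 hlam
  let f : BlockCoord m ≃ lam := Fintype.equivOfCardEq (by simp [hlam])
  have he : Function.Injective fun c => (f c : Fin n) := Subtype.val_injective.comp f.injective
  refine mem_closure_binDBN_of_mixtures fun ε hε =>
    mem_closure_binDBN_of_dependsOnBlock he (k := m) (by omega) (isProb_mixture hp hε)
      (fun x y h => ?_) fun z => ?_
  · rw [hconst x y fun i hi => ?_]
    simpa using h (f.symm ⟨i, hi⟩)
  · have := mul_nonneg (sub_nonneg.2 hε.2.le) (hp.1 z)
    have := hε.1
    positivity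
end

section
/- Let 𝒳 = {0,1}^n and 1 ≤ k ≤ 2^{n−1}. Then the maximal information divergence from the union of mixtures of products with disjoint supports satisfies D_{UMPD_{n,k}} ≤ ( n − ⌊log₂ k⌋ − k / 2^{⌊log₂ k⌋} ) · log(2). -/
open scoped BigOperators

/-- The uniform distribution on a finite set. -/
noncomputable def uniformOn {α : Type*} [DecidableEq α] (s : Finset α) (y : α) : ℝ :=
  if y ∈ s then (s.card : ℝ)⁻¹ else 0

lemma uniformOn_nonneg {α : Type*} [DecidableEq α] (s : Finset α) (y : α) :
    0 ≤ uniformOn s y := by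
  unfold uniformOn
  split_ifs <;> positivity

lemma uniformOn_ne_zero_iff {α : Type*} [DecidableEq α] (s : Finset α) (y : α) :
    uniformOn s y ≠ 0 ↔ y ∈ s := by
  unfold uniformOn
  split_ifs with h
  · have : s.card ≠ 0 := Finset.card_ne_zero_of_mem h
    simpa [h] using Finset.ne_empty_of_mem h
  · simp [h]

lemma sum_uniformOn {α : Type*} [Fintype α] [DecidableEq α] {s : Finset α} (hs : s.Nonempty) :
    ∑ y, uniformOn s y = 1 := by
  have : (s.card : ℝ) ≠ 0 := by exact_mod_cast hs.card_pos.ne'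
  simp [uniformOn, Finset.sum_ite_mem, this]

/-- Products of distributions supported inside the factors of a cubical set lie in the closure of
the products with full support on it. -/
lemma prod_mem_closure_binProductOn {n : ℕ} {Y : Fin n → Finset (Fin 2)}
    (hY : ∀ j, (Y j).Nonempty) {f : Fin n → Fin 2 → ℝ} (h0 : ∀ j y, 0 ≤ f j y)
    (h1 : ∀ j, ∑ y, f j y = 1) (hs : ∀ j y, y ∉ Y j → f j y = 0) :
    (fun x => ∏ j, f j (x j)) ∈ closure (binProductOn n Y) := by
  have key : Filter.Tendsto
      (fun (ε : ℝ) (x : Fin n → Fin 2) =>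
        ∏ j, ((1 - ε) * f j (x j) + ε * uniformOn (Y j) (x j)))
      (nhdsWithin 0 (Set.Ioi 0)) (nhds (fun x => ∏ j, f j (x j))) := by
    have hc : Continuous (fun (ε : ℝ) (x : Fin n → Fin 2) =>
        ∏ j, ((1 - ε) * f j (x j) + ε * uniformOn (Y j) (x j))) := by fun_prop
    have := hc.tendsto 0
    simp only [sub_zero, one_mul, zero_mul, add_zero] at this
    exact this.mono_left nhdsWithin_le_nhds
  refine mem_closure_of_tendsto key ?_
  filter_upwards [Ioo_mem_nhdsGT (zero_lt_one' ℝ)] with ε hε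
  obtain ⟨hε0, hε1⟩ := hε
  refine ⟨fun j y => (1 - ε) * f j y + ε * uniformOn (Y j) y, fun j =>
    ⟨fun y => ?_, ?_, fun y => ?_⟩, fun x => rfl⟩
  · have := h0 j y
    have := uniformOn_nonneg (Y j) y
    have : 0 ≤ 1 - ε := by linarith
    positivity
  · rw [Finset.sum_add_distrib, ← Finset.mul_sum, ← Finset.mul_sum, h1, sum_uniformOn (hY j)]
    ring
  · by_cases hy : y ∈ Y j
    · have h2 : 0 < uniformOn (Y j) y :=
        lt_of_le_of_ne (uniformOn_nonneg _ _) ((uniformOn_ne_zero_iff _ _).2 hy).symm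
      have h3 : 0 ≤ (1 - ε) * f j y := mul_nonneg (by linarith) (h0 j y)
      have : 0 < (1 - ε) * f j y + ε * uniformOn (Y j) y := by positivity
      simp [hy, this.ne']
    · have h2 : uniformOn (Y j) y = 0 := by simp [uniformOn, hy]
      simp [hy, hs j y hy, h2]

/-- On a cubical set with a free coordinate `j₀`, a nonnegative function is dominated by a multiple
of a product distribution that is uniform in all coordinates except `j₀`. -/
lemma exists_dominating_product {n : ℕ} {Y : Fin n → Finset (Fin 2)} (hY : ∀ j, (Y j).Nonempty)
    {j₀ : Fin n} (hj : Y j₀ = Finset.univ) {p : (Fin n → Fin 2) → ℝ} (hp : ∀ x, 0 ≤ p x) :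
    ∃ q ∈ closure (binProductOn n Y), (∀ x, 0 ≤ q x) ∧ ∀ x ∈ Fintype.piFinset Y,
      p x ≤ (∑ z ∈ Fintype.piFinset Y, p z) * q x *
        ∏ j, (if j = j₀ then (1 : ℝ) else ((Y j).card : ℝ)) := by
  obtain ⟨g, hg0, hg1, hgp⟩ : ∃ g : Fin 2 → ℝ, (∀ y, 0 ≤ g y) ∧ ∑ y, g y = 1 ∧
      ∀ x ∈ Fintype.piFinset Y, p x ≤ (∑ z ∈ Fintype.piFinset Y, p z) * g (x j₀) := by
    have hw0 : 0 ≤ ∑ z ∈ Fintype.piFinset Y, p z := Finset.sum_nonneg fun z _ => hp z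
    rcases hw0.eq_or_lt with hw | hw
    · refine ⟨uniformOn Finset.univ, uniformOn_nonneg _, sum_uniformOn Finset.univ_nonempty,
        fun x hx => ?_⟩
      rw [← hw, zero_mul]
      exact ((Finset.sum_eq_zero_iff_of_nonneg fun z _ => hp z).1 hw.symm x hx).le
    · refine ⟨fun y => (∑ z ∈ Fintype.piFinset Y with z j₀ = y, p z) /
        ∑ z ∈ Fintype.piFinset Y, p z, fun y => ?_, ?_, fun x hx => ?_⟩
      · exact div_nonneg (Finset.sum_nonneg fun z _ => hp z) hw0
      · rw [← Finset.sum_div, Finset.sum_fiberwise, div_self hw.ne']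
      · rw [mul_div_cancel₀ _ hw.ne']
        exact Finset.single_le_sum (f := p) (fun z _ => hp z) (by simpa using hx)
  have hf0 : ∀ j y, 0 ≤ (if j = j₀ then g y else uniformOn (Y j) y) := by
    intro j y
    split_ifs
    · exact hg0 y
    · exact uniformOn_nonneg _ _
  refine ⟨fun x => ∏ j, (if j = j₀ then g (x j) else uniformOn (Y j) (x j)),
    prod_mem_closure_binProductOn (f := fun j y => if j = j₀ then g y else uniformOn (Y j) y) hY
      hf0 (fun j => ?_) (fun j y hy => ?_), fun x => Finset.prod_nonneg fun j _ => hf0 j _,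
    fun x hx => ?_⟩
  · by_cases h : j = j₀
    · simpa [h] using hg1
    · simpa only [h, if_false] using sum_uniformOn (hY j)
  · by_cases h : j = j₀
    · subst h
      simp [hj] at hy
    · simp [h, uniformOn, hy]
  · rw [mul_assoc, ← Finset.prod_mul_distrib]
    have : ∀ j, (if j = j₀ then g (x j) else uniformOn (Y j) (x j)) *
        (if j = j₀ then (1 : ℝ) else ((Y j).card : ℝ)) = if j = j₀ then g (x j) else 1 := by
      intro j
      by_cases h : j = j₀
      · simp [h]
      · have hc : ((Y j).card : ℝ) ≠ 0 := by exact_mod_cast (hY j).card_pos.ne'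
        simp [h, uniformOn, Fintype.mem_piFinset.1 hx j, hc]
    simp only [this, Finset.prod_ite_eq', Finset.mem_univ, if_true]
    exact hgp x hx

/-- If `p ≤ q · exp L` pointwise, the divergence of `p` from `q` is at most the mean of `L`. -/
lemma KL_le_of_le_mul_exp {𝒳 : Type*} [Fintype 𝒳] {p q L : 𝒳 → ℝ} (hp : ∀ x, 0 ≤ p x)
    (h : ∀ x, p x ≤ q x * Real.exp (L x)) : KL p q ≤ ((∑ x, p x * L x : ℝ) : EReal) := by
  have hne : ∀ x, p x ≠ 0 → 0 < q x := by
    intro x hx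
    have hpx : 0 < p x := lt_of_le_of_ne (hp x) hx.symm
    exact pos_of_mul_pos_left (hpx.trans_le (h x)) (Real.exp_pos _).le
  rw [KL, if_pos fun x hx => (hne x hx).ne', EReal.coe_le_coe_iff]
  refine Finset.sum_le_sum fun x _ => ?_
  by_cases hx : p x = 0
  · simp [hx]
  · have hpx : 0 < p x := lt_of_le_of_ne (hp x) (Ne.symm hx)
    refine mul_le_mul_of_nonneg_left ?_ (hp x)
    rw [Real.log_le_iff_le_exp (div_pos hpx (hne x hx)), div_le_iff₀ (hne x hx), mul_comm]
    exact h x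

/-- Upper bound for the divergence from the mixtures over a given cubical partition having a
common free coordinate. -/
lemma divFrom_UMPD_le_of_partition {n k : ℕ} {ι : Type*} [Fintype ι] (hι : Fintype.card ι = k)
    (Y : ι → Fin n → Finset (Fin 2)) (hY : ∀ i j, (Y i j).Nonempty)
    (hpart : ∀ x : Fin n → Fin 2, ∃! i, ∀ j, x j ∈ Y i j)
    (j₀ : Fin n) (hj : ∀ i, Y i j₀ = Finset.univ) {p : (Fin n → Fin 2) → ℝ} (hp : IsProb p)
    {L : (Fin n → Fin 2) → ℝ}
    (hL : ∀ i x, (∀ j, x j ∈ Y i j) →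
      ∏ j, (if j = j₀ then (1 : ℝ) else ((Y i j).card : ℝ)) ≤ Real.exp (L x)) :
    divFrom p (UMPD n k) ≤ ((∑ x, p x * L x : ℝ) : EReal) := by
  let e : Fin k ≃ ι := (Fintype.equivFinOfCardEq hι).symm
  choose q hq hq0 hqp using fun i => exists_dominating_product (hY i) (hj i) hp.1
  set w : ι → ℝ := fun i => ∑ z ∈ Fintype.piFinset (Y i), p z with hw
  have hw0 : ∀ i, 0 ≤ w i := fun i => Finset.sum_nonneg fun z _ => hp.1 z
  have hw1 : ∑ i, w i = 1 := by
    have : DecidableEq ι := Classical.decEq ι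
    choose c hc hcu using hpart
    have : ∀ i, w i = ∑ z with c z = i, p z := by
      intro i
      refine Finset.sum_congr ?_ fun _ _ => rfl
      ext z
      simp only [Fintype.mem_piFinset, Finset.mem_filter, Finset.mem_univ, true_and]
      exact ⟨fun h => (hcu z i h).symm, fun h => h ▸ hc z⟩
    simp only [this]
    rw [Finset.sum_fiberwise, hp.2]
  have hmem : (fun x => ∑ i, w i * q i x) ∈ UMPD n k := by
    refine ⟨fun a => Y (e a), fun x => ?_, fun a => w (e a), fun a => q (e a),
      fun a => hw0 _, ?_, fun a => hq _, fun x => ?_⟩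
    · exact (e.existsUnique_congr fun _ => Iff.rfl).2 (hpart x)
    · rw [e.sum_comp, hw1]
    · exact (e.sum_comp fun i => w i * q i x).symm
  refine (iInf₂_le _ hmem).trans (KL_le_of_le_mul_exp hp.1 fun x => ?_)
  obtain ⟨i, hi, -⟩ := hpart x
  have h1 : w i * q i x ≤ ∑ i, w i * q i x :=
    Finset.single_le_sum (f := fun i => w i * q i x) (fun i _ => mul_nonneg (hw0 i) (hq0 i x))
      (Finset.mem_univ i)
  calc p x ≤ _ := hqp i x (Fintype.mem_piFinset.2 hi)
    _ ≤ w i * q i x * Real.exp (L x) :=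
        mul_le_mul_of_nonneg_left (hL i x hi) (mul_nonneg (hw0 i) (hq0 i x))
    _ ≤ _ := mul_le_mul_of_nonneg_right h1 (Real.exp_pos _).le

/-- Some `r`-element subset has average at least the overall average. -/
lemma exists_subset_card_eq_sum_ge {α : Type*} [DecidableEq α] (μ : α → ℝ) (B : Finset α) :
    ∀ r ≤ B.card, ∃ S ⊆ B, S.card = r ∧ (r : ℝ) * ∑ b ∈ B, μ b ≤ B.card * ∑ b ∈ S, μ b := by
  induction hN : B.card generalizing B with
  | zero =>
    intro r hr
    exact ⟨∅, by simp, by simp; omega, by simp [Finset.card_eq_zero.1 hN]⟩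
  | succ N ih =>
    intro r hr
    rcases hr.eq_or_lt with rfl | hr
    · exact ⟨B, subset_rfl, hN, le_rfl⟩
    · have hB : B.Nonempty := Finset.card_pos.1 (by omega)
      obtain ⟨s, hs, hmin⟩ := B.exists_min_image μ hB
      have hcard : (B.erase s).card = N := by rw [Finset.card_erase_of_mem hs, hN]; rfl
      obtain ⟨S, hSB, hSr, hS⟩ := ih (B.erase s) hcard r (by omega)
      refine ⟨S, hSB.trans (Finset.erase_subset _ _), hSr, ?_⟩
      have h1 : (r : ℝ) * μ s ≤ ∑ b ∈ S, μ b := by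
        rw [← hSr, ← nsmul_eq_mul]
        exact Finset.card_nsmul_le_sum _ _ _ fun b hb =>
          hmin b (Finset.mem_of_mem_erase (hSB hb))
      rw [← Finset.add_sum_erase B μ hs]
      push_cast
      linarith

section PrefixPartition

variable {n m : ℕ}

/-- The first `m` coordinates. -/
def initialCoords (hm : m < n) (x : Fin n → Fin 2) (j : Fin m) : Fin 2 :=
  x (Fin.castLE hm.le j)

/-- The cube with prescribed first `m` coordinates `b`, and, if `b ∈ S`, prescribed next
coordinate. -/
def prefixCube (n : ℕ) (S : Finset (Fin m → Fin 2)) (i : (Fin m → Fin 2) × Fin 2) (j : Fin n) :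
    Finset (Fin 2) :=
  if h : j.val < m then {i.1 ⟨j, h⟩} else if j.val = m ∧ i.1 ∈ S then {i.2} else Finset.univ

/-- The labels of the cubes: prefixes outside `S` occur once, those in `S` twice. -/
def prefixLabels (S : Finset (Fin m → Fin 2)) : Finset ((Fin m → Fin 2) × Fin 2) :=
  {i | i.2 = 1 → i.1 ∈ S}

lemma card_prefixLabels (S : Finset (Fin m → Fin 2)) :
    (prefixLabels S).card = 2 ^ m + S.card := by
  have : prefixLabels S = Finset.univ ×ˢ {0} ∪ S ×ˢ {1} := by
    ext ⟨b, c⟩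
    fin_cases c <;> simp [prefixLabels]
  rw [this, Finset.card_union_of_disjoint]
  · simp
  · rw [Finset.disjoint_left]
    rintro ⟨b, c⟩ h1 h2
    simp only [Finset.mem_product, Finset.mem_singleton] at h1 h2
    exact absurd (h1.2.symm.trans h2.2) (by decide)

lemma prefixCube_nonempty (S : Finset (Fin m → Fin 2)) (i : (Fin m → Fin 2) × Fin 2) (j : Fin n) :
    (prefixCube n S i j).Nonempty := by
  unfold prefixCube
  split_ifs <;> simp

lemma mem_prefixCube_iff (hm : m < n) (S : Finset (Fin m → Fin 2))
    (i : (Fin m → Fin 2) × Fin 2) (x : Fin n → Fin 2) :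
    (∀ j, x j ∈ prefixCube n S i j) ↔
      initialCoords hm x = i.1 ∧ (i.1 ∈ S → x ⟨m, hm⟩ = i.2) := by
  constructor
  · intro h
    refine ⟨funext fun j => ?_, fun hS => ?_⟩
    · simpa [prefixCube, initialCoords] using h (Fin.castLE hm.le j)
    · simpa [prefixCube, hS] using h ⟨m, hm⟩
  · rintro ⟨h1, h2⟩ j
    unfold prefixCube
    split_ifs with hj hj'
    · simp [← h1, initialCoords]
    · have : j = ⟨m, hm⟩ := Fin.ext hj'.1
      simp [this, h2 hj'.2]
    · simp

lemma existsUnique_mem_prefixCube (hm : m < n) (S : Finset (Fin m → Fin 2)) (x : Fin n → Fin 2) :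
    ∃! i : prefixLabels S, ∀ j, x j ∈ prefixCube n S i j := by
  simp only [mem_prefixCube_iff hm]
  by_cases hS : initialCoords hm x ∈ S
  · refine ⟨⟨(initialCoords hm x, x ⟨m, hm⟩), by simp [prefixLabels, hS]⟩, by simp, ?_⟩
    rintro ⟨⟨b, c⟩, h⟩ ⟨h1, h2⟩
    dsimp only at h1 h2
    subst h1
    simp [h2 hS]
  · refine ⟨⟨(initialCoords hm x, 0), by simp [prefixLabels]⟩, by simp [hS], ?_⟩
    rintro ⟨⟨b, c⟩, h⟩ ⟨h1, h2⟩
    dsimp only at h1 h2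
    subst h1
    simp only [prefixLabels, Finset.mem_filter, Finset.mem_univ, true_and] at h
    have : c = 0 := by
      have : c ≠ 1 := fun hc => hS (h hc)
      omega
    simp [this]

lemma prod_card_prefixCube_le (hm : m < n) (S : Finset (Fin m → Fin 2))
    (hS : S.Nonempty → m + 1 < n) (i : (Fin m → Fin 2) × Fin 2) (j₀ : Fin n)
    (hj₀ : j₀.val = n - 1) :
    ∏ j, (if j = j₀ then (1 : ℝ) else ((prefixCube n S i j).card : ℝ)) ≤
      Real.exp (((n : ℝ) - m - 1 - if i.1 ∈ S then 1 else 0) * Real.log 2) := by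
  have h : ∀ j : Fin n, (if j = j₀ then (1 : ℝ) else ((prefixCube n S i j).card : ℝ)) =
      Real.exp ((1 - (if j.val < m then 1 else 0) - (if j.val = n - 1 then 1 else 0) -
        (if j.val = m then (if i.1 ∈ S then 1 else 0) else 0)) * Real.log 2) := by
    intro j
    have hS' : i.1 ∈ S → m + 1 < n := fun h => hS ⟨_, h⟩
    have e2 : Real.exp (Real.log 2) = 2 := Real.exp_log two_pos
    by_cases h1 : j = j₀
    · have h2 : j.val = n - 1 := by rw [h1, hj₀]
      have h3 : ¬ n - 1 < m := by omega
      by_cases h4 : i.1 ∈ S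
      · have := hS' h4
        have h5 : ¬ n - 1 = m := by omega
        simp [h1, hj₀, h3, h5]
      · simp [h1, hj₀, h3, h4]
    · have h2 : ¬ j.val = n - 1 := fun h => h1 (Fin.ext (h.trans hj₀.symm))
      by_cases h3 : j.val < m
      · simp [h1, h2, h3, h3.ne, prefixCube]
      · by_cases h4 : j.val = m
        · by_cases h5 : i.1 ∈ S
          · simp [h1, h4, h5, prefixCube, h4 ▸ h2]
          · simp [h1, h4, h5, prefixCube, h4 ▸ h2, e2]
        · simp [h1, h2, h3, h4, prefixCube, e2]
  refine le_of_eq ?_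
  rw [Finset.prod_congr rfl fun j _ => h j, ← Real.exp_sum, ← Finset.sum_mul]
  congr 2
  rw [Finset.sum_sub_distrib, Finset.sum_sub_distrib, Finset.sum_sub_distrib]
  have c1 : ∑ j : Fin n, (if j.val < m then (1 : ℝ) else 0) = m := by
    rw [Fin.sum_univ_eq_sum_range (fun j => if j < m then (1 : ℝ) else 0), Finset.sum_boole]
    congr 1
    have : Finset.filter (fun j => j < m) (Finset.range n) = Finset.range m := by
      ext j
      simp
      omega
    simp [this]
  have c2 : ∑ j : Fin n, (if j.val = n - 1 then (1 : ℝ) else 0) = 1 := by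
    rw [Fin.sum_univ_eq_sum_range (fun j => if j = n - 1 then (1 : ℝ) else 0)]
    simp
    omega
  have c3 : ∑ j : Fin n, (if j.val = m then (if i.1 ∈ S then (1 : ℝ) else 0) else 0) =
      if i.1 ∈ S then 1 else 0 := by
    rw [Fin.sum_univ_eq_sum_range
      (fun j => if j = m then (if i.1 ∈ S then (1 : ℝ) else 0) else 0)]
    simp [hm]
  rw [c1, c2, c3]
  simp

end PrefixPartition

/-- for $1 ≤ k ≤ 2^{n-1}$,
$D_{UMPD_{n,k}} ≤ (n - ⌊\log_2 k⌋ - k/2^{⌊\log_2 k⌋})\log 2$. -/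
theorem maxDiv_UMPD_le (n k : ℕ) (hn : 0 < n) (hk1 : 1 ≤ k) (hk2 : k ≤ 2 ^ (n - 1)) :
    maxDiv (UMPD n k) ≤
      ((((n : ℝ) - (Nat.log 2 k : ℝ) - (k : ℝ) / (2 : ℝ) ^ (Nat.log 2 k)) *
        Real.log 2 : ℝ) : EReal) := by
  set m := Nat.log 2 k with hmdef
  have hmk : 2 ^ m ≤ k := Nat.pow_log_le_self 2 (by omega)
  have hkm : k < 2 ^ (m + 1) := Nat.lt_pow_succ_log_self one_lt_two k
  have hm : m < n := by
    have := (Nat.pow_le_pow_iff_right one_lt_two).1 (hmk.trans hk2)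
    omega
  refine iSup₂_le fun p hp => ?_
  obtain ⟨S, -, hSr, hS⟩ := exists_subset_card_eq_sum_ge
    (fun b : Fin m → Fin 2 => ∑ x with initialCoords hm x = b, p x) Finset.univ (k - 2 ^ m)
    (by simp; omega)
  rw [Finset.sum_fiberwise, hp.2] at hS
  have hS1 : S.Nonempty → m + 1 < n := by
    intro h
    have h1 := h.card_pos
    have := (Nat.pow_lt_pow_iff_right one_lt_two).1 ((show 2 ^ m < k by omega).trans_le hk2)
    omega
  let j₀ : Fin n := ⟨n - 1, by omega⟩
  refine (divFrom_UMPD_le_of_partition (k := k) (ι := prefixLabels S) ?_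
    (fun i => prefixCube n S i) (fun i j => prefixCube_nonempty S i j)
    (existsUnique_mem_prefixCube hm S) j₀ (fun i => ?_) hp
    (L := fun x => ((n : ℝ) - m - 1 - if initialCoords hm x ∈ S then 1 else 0) * Real.log 2)
    fun i x hx => ?_).trans ?_
  · rw [Fintype.card_coe, card_prefixLabels, hSr]
    omega
  · unfold prefixCube
    rw [dif_neg (by simp [j₀]; omega), if_neg]
    rintro ⟨h1, h2⟩
    have := hS1 ⟨_, h2⟩
    simp only [j₀] at h1
    omega
  · rw [((mem_prefixCube_iff hm S i x).1 hx).1]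
    exact prod_card_prefixCube_le hm S hS1 i j₀ rfl
  · rw [EReal.coe_le_coe_iff]
    have hmass : ∑ x, p x * (if initialCoords hm x ∈ S then (1 : ℝ) else 0) =
        ∑ b ∈ S, ∑ x with initialCoords hm x = b, p x := by
      rw [Finset.sum_fiberwise_eq_sum_filter, Finset.sum_filter]
      simp
    have hsum : ∑ x, p x * (((n : ℝ) - m - 1 - if initialCoords hm x ∈ S then 1 else 0) *
        Real.log 2) = ((n : ℝ) - m - 1 -
          ∑ b ∈ S, ∑ x with initialCoords hm x = b, p x) * Real.log 2 := by
      rw [← hmass]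
      simp only [← mul_assoc, mul_sub]
      rw [← Finset.sum_mul, Finset.sum_sub_distrib, Finset.sum_sub_distrib,
        Finset.sum_sub_distrib, ← Finset.sum_mul, ← Finset.sum_mul, ← Finset.sum_mul, hp.2]
      ring
    rw [hsum]
    refine mul_le_mul_of_nonneg_right ?_ (Real.log_nonneg one_le_two)
    have h2 : (0 : ℝ) < 2 ^ m := by positivity
    rw [Nat.cast_sub hmk] at hS
    simp only [Finset.card_univ, Fintype.card_fun, Fintype.card_fin, Nat.cast_pow,
      Nat.cast_ofNat, mul_one] at hS
    have : (k : ℝ) / 2 ^ m ≤ 1 + ∑ b ∈ S, ∑ x with initialCoords hm x = b, p x := by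
      rw [div_le_iff₀ h2]
      linarith
    linarith
end

section
/- Let 𝒳 = {0,1}^n and 1 ≤ k ≤ 2^{n}. Then the maximal information divergence from the union of partition models of cubical partitions with k blocks satisfies D_{ℳ*_{n,k,0}} ≤ ( n + 1 − ⌊log₂ k⌋ − k / 2^{⌊log₂ k⌋} ) · log(2). -/
open scoped BigOperators

/-- $ℳ^*_{n,k,0}$: the union over all cubical partitions of $\{0,1\}^n$ with $k$ blocks
of the corresponding partition models. -/
def unionCubicalPartitionModels (n k : ℕ) : Set ((Fin n → Fin 2) → ℝ) :=
  {p | ∃ Y : Fin k → Fin n → Finset (Fin 2),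
    (∀ x : Fin n → Fin 2, ∃! i : Fin k, ∀ j, x j ∈ Y i j) ∧
    IsProb p ∧
    ∀ i : Fin k, ∀ x y : Fin n → Fin 2,
      (∀ j, x j ∈ Y i j) → (∀ j, y j ∈ Y i j) → p x = p y}

/-- Some `r`-subset has `W`-average at least that of the whole type. -/
lemma exists_finset_card_eq_mul_sum_le {A : Type*} [Fintype A] (W : A → ℝ) {r : ℕ}
    (hr : r ≤ Fintype.card A) :
    ∃ S : Finset A, S.card = r ∧ (r : ℝ) * ∑ a, W a ≤ Fintype.card A * ∑ a ∈ S, W a := by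
  classical
  induction hr using Nat.decreasingInduction with
  | self => exact ⟨Finset.univ, Finset.card_univ, le_rfl⟩
  | of_succ r hr ih =>
    obtain ⟨S, hS, hle⟩ := ih
    obtain ⟨b, hb, hmin⟩ := S.exists_min_image W (Finset.card_pos.1 (by omega))
    refine ⟨S.erase b, by rw [Finset.card_erase_of_mem hb]; omega, ?_⟩
    have hsum := Finset.add_sum_erase S W hb
    have hmean : (r : ℝ) * W b ≤ ∑ a ∈ S.erase b, W a := by
      have h := Finset.card_nsmul_le_sum (S.erase b) W (W b)
        fun a ha => hmin a (Finset.mem_of_mem_erase ha)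
      rwa [Finset.card_erase_of_mem hb, hS, Nat.add_sub_cancel, nsmul_eq_mul] at h
    have hcard : (0 : ℝ) ≤ Fintype.card A := Nat.cast_nonneg _
    push_cast at hle
    rw [← hsum] at hle
    refine le_of_mul_le_mul_left ?_ (by positivity : (0 : ℝ) < r + 1)
    nlinarith [mul_le_mul_of_nonneg_left hmean hcard,
      mul_le_mul_of_nonneg_left hle (Nat.cast_nonneg r : (0 : ℝ) ≤ r)]

/-- The divergence of `p` from the union of the cubical partition models is at most the
`p`-average of the logarithm of the block size, for any cubical partition with `k` blocks. -/
lemma divFrom_unionCubicalPartitionModels_le {n k : ℕ} {ι : Type*} [Fintype ι]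
    (hι : Fintype.card ι = k) (Y : ι → Fin n → Finset (Fin 2))
    (hY : ∀ x : Fin n → Fin 2, ∃! i, ∀ j, x j ∈ Y i j)
    {p : (Fin n → Fin 2) → ℝ} (hp : IsProb p) (L : (Fin n → Fin 2) → ℝ)
    (hL : ∀ i x, (∀ j, x j ∈ Y i j) → Real.log ((Fintype.piFinset (Y i)).card : ℝ) ≤ L x) :
    divFrom p (unionCubicalPartitionModels n k) ≤ ((∑ x, p x * L x : ℝ) : EReal) := by
  classical
  obtain ⟨hp0, hp1⟩ := hp
  choose f hf hfu using hY
  have hmem : ∀ i x, x ∈ Fintype.piFinset (Y i) ↔ f x = i := fun i x => by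
    rw [Fintype.mem_piFinset]
    exact ⟨fun h => (hfu x i h).symm, fun h => h ▸ hf x⟩
  have hcard : ∀ x, (0 : ℝ) < (Fintype.piFinset (Y (f x))).card := fun x =>
    Nat.cast_pos.2 (Finset.card_pos.2 ⟨x, (hmem _ _).2 rfl⟩)
  have hle : ∀ x, p x ≤ ∑ y ∈ Fintype.piFinset (Y (f x)), p y := fun x =>
    Finset.single_le_sum (fun y _ => hp0 y) ((hmem _ _).2 rfl)
  let q : (Fin n → Fin 2) → ℝ := fun x =>
    (∑ y ∈ Fintype.piFinset (Y (f x)), p y) / (Fintype.piFinset (Y (f x))).card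
  have hq0 : ∀ x, 0 ≤ q x := fun x =>
    div_nonneg (Finset.sum_nonneg fun y _ => hp0 y) (hcard x).le
  have hq1 : ∑ x, q x = 1 := by
    have hfiber : ∀ i, Finset.univ.filter (fun x => f x = i) = Fintype.piFinset (Y i) :=
      fun i => by ext x; rw [hmem]; simp
    rw [← Finset.sum_fiberwise Finset.univ f q, ← hp1, ← Finset.sum_fiberwise Finset.univ f p]
    refine Finset.sum_congr rfl fun i _ => ?_
    rw [hfiber]
    have hconst : ∀ x ∈ Fintype.piFinset (Y i), q x =
        (∑ y ∈ Fintype.piFinset (Y i), p y) / (Fintype.piFinset (Y i)).card := fun x hx => by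
      simp only [q, (hmem i x).1 hx]
    rw [Finset.sum_congr rfl hconst, Finset.sum_const, nsmul_eq_mul]
    rcases (Fintype.piFinset (Y i)).eq_empty_or_nonempty with h | h
    · simp [h]
    · exact mul_div_cancel₀ _ (Nat.cast_ne_zero.2 (Finset.card_pos.2 h).ne')
  have hqpos : ∀ x, p x ≠ 0 → 0 < q x := fun x hx =>
    div_pos (((hp0 x).lt_of_ne' hx).trans_le (hle x)) (hcard x)
  have hqM : q ∈ unionCubicalPartitionModels n k := by
    let e := Fintype.equivFinOfCardEq hι
    refine ⟨fun i => Y (e.symm i), fun x => ⟨e (f x), ?_, fun i hi => ?_⟩, ⟨hq0, hq1⟩, ?_⟩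
    · simpa using hf x
    · rw [← hfu x _ hi, e.apply_symm_apply]
    · intro i x y hx hy
      simp only [q, ← hfu x _ hx, ← hfu y _ hy]
  refine (iInf₂_le q hqM).trans ?_
  rw [KL, if_pos fun x hx => (hqpos x hx).ne']
  refine EReal.coe_le_coe_iff.2 (Finset.sum_le_sum fun x _ => ?_)
  by_cases hx : p x = 0
  · simp [hx]
  have hpx := (hp0 x).lt_of_ne' hx
  refine mul_le_mul_of_nonneg_left (le_trans ?_ (hL (f x) x (hf x))) hpx.le
  refine Real.log_le_log (div_pos hpx (hqpos x hx)) ((div_le_iff₀ (hqpos x hx)).2 ?_)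
  exact (hle x).trans_eq (mul_div_cancel₀ _ (hcard x).ne').symm

/-- The sides of the cylinder of all `x : Fin n → Fin 2` agreeing with `w` on the first `t`
coordinates. -/
def cylinderSides {n : ℕ} (t : ℕ) (w : Fin n → Fin 2) (j : Fin n) : Finset (Fin 2) :=
  if (j : ℕ) < t then {w j} else Finset.univ

lemma forall_mem_cylinderSides {n t : ℕ} {w x : Fin n → Fin 2} :
    (∀ j, x j ∈ cylinderSides t w j) ↔ ∀ j : Fin n, (j : ℕ) < t → x j = w j := by
  refine forall_congr' fun j => ?_
  unfold cylinderSides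
  split_ifs with h <;> simp [h]

lemma card_piFinset_cylinderSides {n t : ℕ} (w : Fin n → Fin 2) :
    (Fintype.piFinset (cylinderSides t w)).card = 2 ^ (n - t) := by
  have hside : ∀ j : Fin n, (cylinderSides t w j).card = if (j : ℕ) < t then 1 else 2 := by
    intro j
    unfold cylinderSides
    split_ifs <;> simp
  have hfilter : (Finset.range n).filter (fun j => ¬ j < t) = Finset.Ico t n := by
    ext j
    simp only [Finset.mem_filter, Finset.mem_range, Finset.mem_Ico]
    omega
  rw [Fintype.card_piFinset, Finset.prod_congr rfl fun j _ => hside j,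
    Fin.prod_univ_eq_prod_range (fun j => if j < t then 1 else 2) n, Finset.prod_ite, hfilter]
  simp

/-- Extension of a word `a` of length `m` to length `n` by the letter `c`. -/
def padWord {m n : ℕ} (c : Fin 2) (a : Fin m → Fin 2) (j : Fin n) : Fin 2 :=
  if h : (j : ℕ) < m then a ⟨j, h⟩ else c

lemma agree_padWord_iff {m n : ℕ} (hm : m ≤ n) {c : Fin 2} {a : Fin m → Fin 2}
    {x : Fin n → Fin 2} :
    (∀ j : Fin n, (j : ℕ) < m → x j = padWord c a j) ↔ x ∘ Fin.castLE hm = a := by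
  constructor
  · intro h
    funext j
    simpa [padWord] using h (Fin.castLE hm j) j.2
  · rintro rfl j hj
    simp [padWord, hj]

lemma agree_succ_padWord_iff {m n : ℕ} (hm : m < n) {c : Fin 2} {a : Fin m → Fin 2}
    {x : Fin n → Fin 2} :
    (∀ j : Fin n, (j : ℕ) < m + 1 → x j = padWord c a j) ↔
      x ∘ Fin.castLE hm.le = a ∧ x ⟨m, hm⟩ = c := by
  rw [← agree_padWord_iff hm.le (c := c)]
  constructor
  · exact fun h => ⟨fun j hj => h j (by omega), by simpa [padWord] using h ⟨m, hm⟩ (by simp)⟩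
  · rintro ⟨h, hc⟩ j hj
    rcases Nat.lt_succ_iff_lt_or_eq.1 hj with h' | h'
    · exact h j h'
    · obtain rfl : j = ⟨m, hm⟩ := Fin.ext h'
      simpa [padWord] using hc

/-- The sides of the blocks of the partition into the cylinders of the words `a` of length `m`,
where each cylinder with `a ∈ S` is cut in two along the next coordinate. -/
def splitCylinderSides {m : ℕ} (n : ℕ) (S : Finset (Fin m → Fin 2)) :
    (Fin m → Fin 2) ⊕ S → Fin n → Finset (Fin 2)
  | .inl a => cylinderSides (if a ∈ S then m + 1 else m) (padWord 0 a)
  | .inr a => cylinderSides (m + 1) (padWord 1 a.1)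

lemma mem_splitCylinderSides_inl_iff {m n : ℕ} (hm : m ≤ n) {S : Finset (Fin m → Fin 2)}
    (hS : S.Nonempty → m < n) {a : Fin m → Fin 2} {x : Fin n → Fin 2} :
    (∀ j, x j ∈ splitCylinderSides n S (.inl a) j) ↔
      x ∘ Fin.castLE hm = a ∧ ∀ h : a ∈ S, x ⟨m, hS ⟨a, h⟩⟩ = 0 := by
  simp only [splitCylinderSides]
  rw [forall_mem_cylinderSides]
  split_ifs with h
  · rw [agree_succ_padWord_iff (hS ⟨a, h⟩)]
    simp [h]
  · rw [agree_padWord_iff hm]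
    simp [h]

lemma mem_splitCylinderSides_inr_iff {m n : ℕ} (hm : m ≤ n) {S : Finset (Fin m → Fin 2)}
    (hS : S.Nonempty → m < n) {a : S} {x : Fin n → Fin 2} :
    (∀ j, x j ∈ splitCylinderSides n S (.inr a) j) ↔
      x ∘ Fin.castLE hm = a ∧ x ⟨m, hS ⟨a, a.2⟩⟩ = 1 := by
  simp only [splitCylinderSides]
  rw [forall_mem_cylinderSides, agree_succ_padWord_iff (hS ⟨a, a.2⟩)]

lemma existsUnique_mem_splitCylinderSides {m n : ℕ} (hm : m ≤ n) {S : Finset (Fin m → Fin 2)}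
    (hS : S.Nonempty → m < n) (x : Fin n → Fin 2) :
    ∃! i, ∀ j, x j ∈ splitCylinderSides n S i j := by
  by_cases h : ∃ h : x ∘ Fin.castLE hm ∈ S, x ⟨m, hS ⟨_, h⟩⟩ = 1
  · obtain ⟨hx, h1⟩ := h
    refine ⟨.inr ⟨_, hx⟩, (mem_splitCylinderSides_inr_iff hm hS).2 ⟨rfl, h1⟩, ?_⟩
    rintro (a | a) ha
    · obtain ⟨rfl, h0⟩ := (mem_splitCylinderSides_inl_iff hm hS).1 ha
      simp [h1] at h0
      exact absurd hx h0
    · exact congrArg _ (Subtype.ext ((mem_splitCylinderSides_inr_iff hm hS).1 ha).1.symm)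
  · refine ⟨.inl (x ∘ Fin.castLE hm), (mem_splitCylinderSides_inl_iff hm hS).2
      ⟨rfl, fun hx => ?_⟩, ?_⟩
    · by_contra h0
      exact h ⟨hx, Fin.eq_one_of_ne_zero _ h0⟩
    · rintro (a | a) ha
      · exact congrArg _ ((mem_splitCylinderSides_inl_iff hm hS).1 ha).1.symm
      · obtain ⟨hx, h1⟩ := (mem_splitCylinderSides_inr_iff hm hS).1 ha
        exact absurd ⟨hx ▸ a.2, h1⟩ h

lemma log_card_splitCylinderSides {m n : ℕ} (hm : m ≤ n) {S : Finset (Fin m → Fin 2)}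
    (hS : S.Nonempty → m < n) {i : (Fin m → Fin 2) ⊕ S} {x : Fin n → Fin 2}
    (hx : ∀ j, x j ∈ splitCylinderSides n S i j) :
    Real.log ((Fintype.piFinset (splitCylinderSides n S i)).card : ℝ) =
      ((n : ℝ) - m - if x ∘ Fin.castLE hm ∈ S then 1 else 0) * Real.log 2 := by
  rcases i with a | a
  · obtain ⟨rfl, -⟩ := (mem_splitCylinderSides_inl_iff hm hS).1 hx
    simp only [splitCylinderSides]
    rw [card_piFinset_cylinderSides, Nat.cast_pow, Real.log_pow]
    split_ifs with h
    · rw [Nat.cast_sub (hS ⟨_, h⟩)]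
      push_cast
      ring
    · rw [Nat.cast_sub hm]
      push_cast
      ring
  · have hxa := ((mem_splitCylinderSides_inr_iff hm hS).1 hx).1
    simp only [splitCylinderSides]
    rw [card_piFinset_cylinderSides, Nat.cast_pow, Real.log_pow, hxa, if_pos a.2,
      Nat.cast_sub (hS ⟨_, a.2⟩)]
    push_cast
    ring

/-- for $1 ≤ k ≤ 2^n$,
$D_{ℳ^*_{n,k,0}} ≤ (n + 1 - ⌊\log_2 k⌋ - k/2^{⌊\log_2 k⌋})\log 2$. -/
theorem maxDiv_unionCubicalPartitionModels_le (n k : ℕ) (hk1 : 1 ≤ k)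
    (hk2 : k ≤ 2 ^ n) :
    maxDiv (unionCubicalPartitionModels n k) ≤
      ((((n : ℝ) + 1 - (Nat.log 2 k : ℝ) - (k : ℝ) / (2 : ℝ) ^ (Nat.log 2 k)) *
        Real.log 2 : ℝ) : EReal) := by
  refine iSup₂_le fun p hp => ?_
  set m := Nat.log 2 k
  have hmk : 2 ^ m ≤ k := Nat.pow_log_le_self 2 (by omega)
  have hkm : k < 2 ^ (m + 1) := Nat.lt_pow_succ_log_self (by norm_num) k
  have hm : m ≤ n := (Nat.pow_le_pow_iff_right (by norm_num)).1 (hmk.trans hk2)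
  let W : (Fin m → Fin 2) → ℝ := fun a => ∑ x with x ∘ Fin.castLE hm = a, p x
  obtain ⟨S, hSr, hSW⟩ := exists_finset_card_eq_mul_sum_le W (r := k - 2 ^ m) (by
    simp only [Fintype.card_fun, Fintype.card_fin]
    omega)
  have hS : S.Nonempty → m < n := fun h => by
    have := Finset.card_pos.2 h
    exact (Nat.pow_lt_pow_iff_right (by norm_num : 1 < 2)).1 (by omega : 2 ^ m < 2 ^ n)
  refine (divFrom_unionCubicalPartitionModels_le ?_ (splitCylinderSides n S)
    (existsUnique_mem_splitCylinderSides hm hS) hp _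
    fun i x hx => (log_card_splitCylinderSides hm hS hx).le).trans (EReal.coe_le_coe_iff.2 ?_)
  · simp only [Fintype.card_sum, Fintype.card_fun, Fintype.card_fin, Fintype.card_coe]
    omega
  have hWsum : ∑ a, W a = 1 := by
    rw [← hp.2]
    exact Finset.sum_fiberwise Finset.univ _ p
  have hWS : ∑ x, p x * (if x ∘ Fin.castLE hm ∈ S then 1 else 0) = ∑ a ∈ S, W a := by
    simp only [mul_ite, mul_one, mul_zero, ← Finset.sum_filter]
    rw [← Finset.sum_fiberwise_of_maps_to (t := S) (g := fun x => x ∘ Fin.castLE hm)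
      (by simp)]
    refine Finset.sum_congr rfl fun a ha => Finset.sum_congr ?_ fun _ _ => rfl
    ext x
    simp only [Finset.mem_filter, Finset.mem_univ, true_and, and_iff_right_iff_imp]
    exact fun h => h ▸ ha
  have hsplit : ∑ x, p x * (((n : ℝ) - m - if x ∘ Fin.castLE hm ∈ S then 1 else 0) *
      Real.log 2) = ((n : ℝ) - m - ∑ a ∈ S, W a) * Real.log 2 := by
    calc _ = ∑ x, (p x * (((n : ℝ) - m) * Real.log 2) -
          (p x * if x ∘ Fin.castLE hm ∈ S then 1 else 0) * Real.log 2) :=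
          Finset.sum_congr rfl fun x _ => by ring
      _ = _ := by
          rw [Finset.sum_sub_distrib, ← Finset.sum_mul, ← Finset.sum_mul, hp.2, hWS]
          ring
  rw [hsplit]
  refine mul_le_mul_of_nonneg_right ?_ (Real.log_nonneg one_le_two)
  have hpow : (0 : ℝ) < 2 ^ m := by positivity
  rw [hWsum, mul_one, Nat.cast_sub hmk, Fintype.card_fun, Fintype.card_fin,
    Fintype.card_fin] at hSW
  push_cast at hSW
  have : (k : ℝ) / 2 ^ m ≤ 1 + ∑ a ∈ S, W a := by
    rw [div_le_iff₀ hpow]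
    linarith
  linarith
end
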